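/- Let D be a bounded open subset of ℂⁿ and A ⊂ D any subset. Then the relative extremal functions of A and of A* coincide on D: ω(z, A, D) = ω(z, A*, D) for all z ∈ D, where A* is the set of points of the closure of A in D at which A is locally pluriregular. -/

import Mathlib

open Complex Metric Filter Set MeasureTheory
open scoped Topology Real Manifold

noncomputable section

/-- Plurisubharmonic (subharmonic when `V = ℂ`) real-valued function on a set
in a complex normed space: upper semicontinuous plus the sub-mean value
inequality over small circles in every complex direction. -/
def PSHOn {V : Type*} [NormedAddCommGroup V] [NormedSpace ℂ V]
    (u : V → ℝ) (D : Set V) : Prop :=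
  UpperSemicontinuousOn u D ∧
  ∀ z ∈ D, ∀ v : V, ∀ᶠ r in 𝓝[>] (0:ℝ),
    u z ≤ (1 / (2 * Real.pi)) *
      ∫ θ in (0:ℝ)..(2 * Real.pi), u (z + (Complex.ofReal r * Complex.exp (θ * Complex.I)) • v)

/-- The (unregularized) extremal function `h_{A,D}` relative to the canonical
system of approach regions. -/
def hFun {V : Type*} [NormedAddCommGroup V] [NormedSpace ℂ V]
    (A D : Set V) : V → ℝ := fun z =>
  sSup ((fun u : V → ℝ => u z) ''
    {u | PSHOn u D ∧ (∀ x ∈ D, u x ≤ 1) ∧ ∀ a ∈ A, Filter.limsup u (𝓝[D] a) ≤ 0})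

/-- The relative extremal function `ω(·, A, D)` (canonical approach regions):
the upper semicontinuous regularization of `h_{A,D}`. -/
def omegaC {V : Type*} [NormedAddCommGroup V] [NormedSpace ℂ V]
    (A D : Set V) (z : V) : ℝ :=
  Filter.limsup (hFun A D) (𝓝[D] z)

/-- `A` is locally pluriregular at `a` (canonical approach regions). -/
def PlrgAt {V : Type*} [NormedAddCommGroup V] [NormedSpace ℂ V]
    (A D : Set V) (a : V) : Prop :=
  ∀ U : Set V, IsOpen U → a ∈ U → omegaC (A ∩ U) (D ∩ U) a = 0

/-- `A*`: the set of points of `closure A ∩ D` at which `A` is locally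
pluriregular. -/
def starSet {V : Type*} [NormedAddCommGroup V] [NormedSpace ℂ V]
    (A D : Set V) : Set V :=
  {a ∈ closure A ∩ D | PlrgAt A D a}

namespace RelExt

lemma measurable_circle_comp {g : ℂ → ℝ} (hg : UpperSemicontinuous g) (c : ℂ) (R : ℝ) :
    Measurable fun θ => g (circleMap c R θ) :=
  hg.measurable.comp (measurable_circleMap c R)

lemma circleIntegrable_of_usc {g : ℂ → ℝ} (hg : UpperSemicontinuous g) {m : ℝ}
    (hm : ∀ x, m ≤ g x) (c : ℂ) (R : ℝ) : CircleIntegrable g c R := by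
  obtain ⟨M, hM⟩ := (hg.upperSemicontinuousOn (sphere c |R|)).bddAbove_of_isCompact
    (isCompact_sphere c |R|)
  refine (intervalIntegrable_const (c := max |m| |M|)).mono_fun
    (measurable_circle_comp hg c R).aestronglyMeasurable ?_
  refine Eventually.of_forall fun θ => ?_
  have h1 := hm (circleMap c R θ)
  have h2 : g (circleMap c R θ) ≤ M := hM ⟨_, circleMap_mem_sphere' c R θ, rfl⟩
  have h3 : (0:ℝ) ≤ max |m| |M| := le_max_of_le_left (abs_nonneg m)
  simp only [Real.norm_eq_abs]
  rw [abs_of_nonneg h3]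
  rw [abs_le]
  constructor
  · linarith [neg_abs_le m, le_max_left |m| |M|]
  · linarith [le_abs_self M, le_max_right |m| |M|]

lemma circleAverage_le_of_forall {f g : ℂ → ℝ} {c : ℂ} {R : ℝ} (hf : CircleIntegrable f c R)
    (hg : CircleIntegrable g c R) (h : ∀ x, f x ≤ g x) :
    Real.circleAverage f c R ≤ Real.circleAverage g c R :=
  Real.circleAverage_mono hf hg fun x _ => h x

lemma circleAverage_re_of_differentiable {P : ℂ → ℂ} (hP : Differentiable ℂ P) (c : ℂ) (R : ℝ) :
    Real.circleAverage (fun z => (P z).re) c R = (P c).re := by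
  have hI : CircleIntegrable P c R := hP.continuous.continuousOn.circleIntegrable'
  have h := Complex.reCLM.circleAverage_comp_comm hI
  rw [DiffContOnCl.circleAverage (hP.diffContOnCl)] at h
  exact h

lemma circleAverage_norm_sq (c : ℂ) (R : ℝ) :
    Real.circleAverage (fun z => ‖z‖ ^ 2) c R = ‖c‖ ^ 2 + R ^ 2 := by
  have h : Set.EqOn (fun z : ℂ => ‖z‖ ^ 2)
      (fun z => (((‖c‖ ^ 2 + R ^ 2 : ℝ) : ℂ) + 2 * (starRingEnd ℂ) c * (z - c)).re)
      (sphere c |R|) := by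
    intro z hz
    have hz' : ‖z - c‖ ^ 2 = R ^ 2 := by
      rw [mem_sphere_iff_norm.1 hz, sq_abs]
    simp only [Complex.add_re, Complex.ofReal_re]
    simp only [← Complex.normSq_eq_norm_sq, Complex.normSq_apply] at hz' ⊢
    simp at hz' ⊢
    nlinarith
  rw [Real.circleAverage_congr_sphere h, circleAverage_re_of_differentiable (by fun_prop)]
  rw [Complex.add_re, Complex.ofReal_re]
  simp

/-- Real parts of trigonometric polynomials extend to real parts of entire functions. -/
lemma exists_entire_of_mem_span_fourier [Fact (0 < 2 * π)] {p : C(AddCircle (2 * π), ℂ)}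
    (hp : p ∈ Submodule.span ℂ (range (fourier (T := 2 * π)))) (c : ℂ) :
    ∃ P : ℂ → ℂ, Differentiable ℂ P ∧
      ∀ θ : ℝ, (c * p (θ : AddCircle (2 * π))).re = (P (circleMap 0 1 θ)).re := by
  induction hp using Submodule.span_induction generalizing c with
  | mem x hx =>
    obtain ⟨n, rfl⟩ := hx
    have hπ : (π : ℂ) ≠ 0 := by exact_mod_cast Real.pi_ne_zero
    have key : ∀ (n : ℤ) (θ : ℝ), fourier n (θ : AddCircle (2 * π))
        = Complex.exp (n * (θ * Complex.I)) := by
      intro n θ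
      rw [fourier_coe_apply]
      congr 1
      push_cast
      field_simp
    rcases Int.eq_nat_or_neg n with ⟨k, rfl | rfl⟩
    · refine ⟨fun z => c * z ^ k, by fun_prop, fun θ => ?_⟩
      rw [key, circleMap_zero, ofReal_one, one_mul]
      simp only [← Complex.exp_nat_mul]
      simp
    · refine ⟨fun z => (starRingEnd ℂ) c * z ^ k, by fun_prop, fun θ => ?_⟩
      rw [key, circleMap_zero, ofReal_one, one_mul]
      simp only [← Complex.exp_nat_mul]
      rw [← Complex.conj_re, map_mul, ← Complex.exp_conj]
      simp
  | zero => exact ⟨fun _ => 0, by fun_prop, fun θ => by simp⟩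
  | add x y _ _ hx hy =>
    obtain ⟨P, hP, hP'⟩ := hx c
    obtain ⟨Q, hQ, hQ'⟩ := hy c
    refine ⟨fun z => P z + Q z, hP.add hQ, fun θ => ?_⟩
    rw [Complex.add_re, ← hP', ← hQ', ← Complex.add_re, ContinuousMap.add_apply, mul_add]
  | smul a x _ hx =>
    obtain ⟨P, hP, hP'⟩ := hx (c * a)
    refine ⟨P, hP, fun θ => ?_⟩
    rw [← hP', ContinuousMap.smul_apply, smul_eq_mul, mul_assoc]

/-- A continuous function on the circle is uniformly approximated by real parts of entire
functions. -/
lemma exists_entire_approx {f : AddCircle (2 * π) → ℝ} (hf : Continuous f) {ε : ℝ} (hε : 0 < ε) :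
    ∃ P : ℂ → ℂ, Differentiable ℂ P ∧
      ∀ θ : ℝ, |f (θ : AddCircle (2 * π)) - (P (circleMap 0 1 θ)).re| < ε := by
  have : Fact (0 < 2 * π) := ⟨Real.two_pi_pos⟩
  let F : C(AddCircle (2 * π), ℂ) := ⟨fun x => (f x : ℂ), by fun_prop⟩
  have hF : F ∈ (Submodule.span ℂ (range (fourier (T := 2 * π)))).topologicalClosure := by
    rw [span_fourier_closure_eq_top]; trivial
  obtain ⟨p, hp, hpF⟩ := Metric.mem_closure_iff.1 hF ε hε
  obtain ⟨P, hP, hP'⟩ := exists_entire_of_mem_span_fourier hp 1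
  refine ⟨P, hP, fun θ => ?_⟩
  rw [← hP' θ, one_mul]
  have h1 : ‖F (θ : AddCircle (2 * π)) - p θ‖ < ε := by
    have := (ContinuousMap.dist_apply_le_dist (f := F) (g := p)
      (θ : AddCircle (2 * π))).trans_lt hpF
    rwa [dist_eq_norm] at this
  refine lt_of_le_of_lt ?_ h1
  have := Complex.abs_re_le_norm (F (θ : AddCircle (2 * π)) - p θ)
  simpa [F] using this

section LipEnv

variable {X : Type*} [PseudoMetricSpace X]

/-- The sup-convolution of `g` with `-k * dist`. -/
def lipEnv (g : X → ℝ) (k : ℝ) (x : X) : ℝ := ⨆ y, (g y - k * dist x y)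

variable {g : X → ℝ} {M : ℝ} (hM : ∀ x, g x ≤ M)
include hM

lemma lipEnv_bdd {k : ℝ} (hk : 0 ≤ k) (x : X) :
    BddAbove (range fun y => g y - k * dist x y) :=
  ⟨M, by rintro _ ⟨y, rfl⟩; nlinarith [hM y, mul_nonneg hk (dist_nonneg (x := x) (y := y))]⟩

lemma le_lipEnv {k : ℝ} (hk : 0 ≤ k) (x : X) : g x ≤ lipEnv g k x := by
  have h := le_ciSup (lipEnv_bdd hM hk x) x
  simp only [dist_self, mul_zero, sub_zero] at h
  exact h

lemma lipEnv_le {k : ℝ} (hk : 0 ≤ k) (x : X) : lipEnv g k x ≤ M :=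
  have : Nonempty X := ⟨x⟩
  ciSup_le fun y => by nlinarith [hM y, mul_nonneg hk (dist_nonneg (x := x) (y := y))]

lemma lipEnv_anti {k l : ℝ} (hk : 0 ≤ k) (hkl : k ≤ l) (x : X) : lipEnv g l x ≤ lipEnv g k x :=
  ciSup_mono (lipEnv_bdd hM hk x) fun y => by
    nlinarith [mul_le_mul_of_nonneg_right hkl (dist_nonneg (x := x) (y := y))]

lemma lipEnv_le_add {k : ℝ} (hk : 0 ≤ k) (x x' : X) :
    lipEnv g k x ≤ lipEnv g k x' + k * dist x x' := by
  have : Nonempty X := ⟨x⟩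
  refine ciSup_le fun y => ?_
  have := le_ciSup (lipEnv_bdd hM hk x') y
  have h2 := mul_le_mul_of_nonneg_left (dist_triangle_left x' y x) hk
  simp only [lipEnv] at this ⊢
  linarith

lemma continuous_lipEnv {k : ℝ} (hk : 0 ≤ k) : Continuous (lipEnv g k) := by
  have : LipschitzWith ⟨k, hk⟩ (lipEnv g k) :=
    LipschitzWith.of_le_add_mul _ fun x y => lipEnv_le_add hM hk x y
  exact this.continuous

lemma tendsto_lipEnv (hg : UpperSemicontinuous g) (x : X) :
    Tendsto (fun k : ℕ => lipEnv g k x) atTop (𝓝 (g x)) := by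
  have : Nonempty X := ⟨x⟩
  rw [Metric.tendsto_atTop]
  intro ε hε
  obtain ⟨δ, hδ, hδ'⟩ := Metric.eventually_nhds_iff.1 (hg x (g x + ε / 2) (by linarith))
  obtain ⟨N, hN⟩ := exists_nat_gt ((M - g x) / δ)
  refine ⟨N, fun n hn => ?_⟩
  have h1 := le_lipEnv hM (k := n) (by positivity) x
  have h2 : lipEnv g n x ≤ g x + ε / 2 := by
    refine ciSup_le fun y => ?_
    have hn0 : (0:ℝ) ≤ n := by positivity
    by_cases hy : dist y x < δ
    · have := hδ' hy
      nlinarith [mul_nonneg hn0 (dist_nonneg (x := x) (y := y))]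
    · push Not at hy
      rw [dist_comm] at hy
      have hNn : (N:ℝ) ≤ n := by exact_mod_cast hn
      have h3 : M - g x < n * δ := by
        rw [div_lt_iff₀ hδ] at hN; nlinarith
      nlinarith [hM y, mul_le_mul_of_nonneg_left hy hn0]
  rw [Real.dist_eq, abs_lt]
  constructor <;> linarith

end LipEnv

lemma toCircle_coe (θ : ℝ) :
    ((AddCircle.toCircle (θ : AddCircle (2 * π)) : Circle) : ℂ) = circleMap 0 1 θ := by
  rw [AddCircle.toCircle_apply_mk, Circle.coe_exp, circleMap_zero]
  have hπ : (π : ℂ) ≠ 0 := by exact_mod_cast Real.pi_ne_zero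
  push_cast
  rw [one_mul]
  congr 1
  field_simp

/-- An upper semicontinuous function on the unit circle is majorised, up to a small error in the
mean, by the real part of an entire function. -/
lemma exists_entire_majorant {g : ℂ → ℝ} (hg : UpperSemicontinuous g) {m : ℝ}
    (hm : ∀ x, m ≤ g x) {δ : ℝ} (hδ : 0 < δ) :
    ∃ P : ℂ → ℂ, Differentiable ℂ P ∧ (∀ z ∈ sphere (0:ℂ) 1, g z ≤ (P z).re) ∧
      (P 0).re ≤ Real.circleAverage g 0 1 + δ := by
  let G : AddCircle (2 * π) → ℝ := fun x => g (AddCircle.toCircle x : Circle)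
  have hGθ : ∀ θ : ℝ, G θ = g (circleMap 0 1 θ) := fun θ => by simp only [G, toCircle_coe]
  have hGu : UpperSemicontinuous G := by
    have hc : Continuous fun x : AddCircle (2 * π) => ((AddCircle.toCircle x : Circle) : ℂ) :=
      continuous_subtype_val.comp AddCircle.continuous_toCircle
    exact fun x y hy => (hc.tendsto x).eventually (hg _ y hy)
  obtain ⟨M, hM⟩ := (hg.upperSemicontinuousOn (sphere (0:ℂ) 1)).bddAbove_of_isCompact
    (isCompact_sphere 0 1)
  have hGM : ∀ x, G x ≤ M := fun x => hM ⟨_, by rw [mem_sphere_zero_iff_norm]; exact Circle.norm_coe _, rfl⟩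
  have hlim : Tendsto (fun k : ℕ => ∫ θ in 0..2 * π, lipEnv G k (θ : AddCircle (2 * π))) atTop
      (𝓝 (∫ θ in 0..2 * π, g (circleMap 0 1 θ))) := by
    refine intervalIntegral.tendsto_integral_filter_of_dominated_convergence
      (fun _ => max |m| |M|) ?_ ?_ intervalIntegrable_const ?_
    · refine Eventually.of_forall fun k => ?_
      have := continuous_lipEnv hGM (k := k) (by positivity)
      exact (this.comp (AddCircle.continuous_mk' _)).aestronglyMeasurable
    · refine Eventually.of_forall fun k => Eventually.of_forall fun θ _ => ?_
      have h1 := le_lipEnv hGM (k := k) (by positivity) (θ : AddCircle (2 * π))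
      have h2 := lipEnv_le hGM (k := k) (by positivity) (θ : AddCircle (2 * π))
      have h3 : m ≤ G θ := hm _
      rw [Real.norm_eq_abs, abs_le]
      constructor
      · linarith [neg_abs_le m, le_max_left |m| |M|]
      · linarith [le_abs_self M, le_max_right |m| |M|]
    · refine Eventually.of_forall fun θ _ => ?_
      rw [← hGθ]
      exact tendsto_lipEnv hGM hGu _
  have hlim2 := hlim.const_mul (2 * π)⁻¹
  obtain ⟨k, hk⟩ := (hlim2.eventually_lt_const
    (show _ < Real.circleAverage g 0 1 + δ / 2 by
      rw [Real.circleAverage_def, smul_eq_mul]; linarith)).exists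
  have hfc := continuous_lipEnv hGM (k := k) (by positivity)
  obtain ⟨P, hP, hP'⟩ := exists_entire_approx hfc (ε := δ / 4) (by linarith)
  refine ⟨fun z => P z + (δ / 4 : ℝ), hP.add_const _, ?_, ?_⟩
  · intro z hz
    have hz' : z ∈ range (circleMap 0 1) := by rw [range_circleMap]; simpa using hz
    obtain ⟨θ, rfl⟩ := hz'
    have h1 := le_lipEnv hGM (k := k) (by positivity) (θ : AddCircle (2 * π))
    have h2 := (abs_lt.1 (hP' θ)).2
    rw [hGθ] at h1
    rw [Complex.add_re, Complex.ofReal_re]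
    linarith
  · have h1 : (P 0).re ≤ (2 * π)⁻¹ * ∫ θ in 0..2 * π, (lipEnv G k (θ : AddCircle (2 * π)) + δ / 4) := by
      rw [← circleAverage_re_of_differentiable hP 0 1, Real.circleAverage_def, smul_eq_mul]
      refine mul_le_mul_of_nonneg_left ?_ (by positivity)
      refine intervalIntegral.integral_mono_on (by positivity) ?_ ?_ ?_
      · have : Continuous fun θ => (P (circleMap 0 1 θ)).re :=
          Complex.continuous_re.comp (hP.continuous.comp (continuous_circleMap 0 1))
        exact this.intervalIntegrable _ _
      · have : Continuous fun θ : ℝ => lipEnv G k (θ : AddCircle (2 * π)) + δ / 4 :=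
          (hfc.comp (AddCircle.continuous_mk' _)).add_const _
        exact this.intervalIntegrable _ _
      · intro θ _
        linarith [(abs_lt.1 (hP' θ)).1]
    rw [intervalIntegral.integral_add _ intervalIntegrable_const,
      intervalIntegral.integral_const, mul_add] at h1
    · have h2 : (2 * π)⁻¹ * ((2 * π - 0) • (δ / 4)) = δ / 4 := by
        rw [smul_eq_mul, sub_zero, inv_mul_cancel_left₀ Real.two_pi_pos.ne']
      rw [h2] at h1
      rw [Complex.add_re, Complex.ofReal_re]
      linarith
    · exact (hfc.comp (AddCircle.continuous_mk' _)).intervalIntegrable _ _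

/-- Local submean inequalities imply the submean inequality on the unit disc. -/
lemma submean_of_local {g : ℂ → ℝ} (hg : UpperSemicontinuous g) {m : ℝ} (hm : ∀ x, m ≤ g x)
    (hloc : ∀ ζ, ∀ᶠ r in 𝓝[>] (0:ℝ), g ζ ≤ Real.circleAverage g ζ r) :
    g 0 ≤ Real.circleAverage g 0 1 := by
  refine le_of_forall_pos_le_add fun ε hε => ?_
  obtain ⟨P, hP, hPs, hP0⟩ := exists_entire_majorant hg hm (half_pos hε)
  let u : ℂ → ℝ := fun z => g z + (-(P z).re + ε / 2 * ‖z‖ ^ 2)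
  have hPc : Continuous fun z => -(P z).re + ε / 2 * ‖z‖ ^ 2 := by
    have := hP.continuous
    fun_prop
  have hu : UpperSemicontinuous u := hg.add hPc.upperSemicontinuous
  obtain ⟨ζ, hζ, hmax⟩ := (hu.upperSemicontinuousOn (closedBall (0:ℂ) 1)).exists_isMaxOn
    ⟨0, by simp⟩ (isCompact_closedBall 0 1)
  have h0 : u 0 ≤ u ζ := hmax (by simp)
  suffices u ζ ≤ ε / 2 by
    have : u 0 = g 0 - (P 0).re := by simp [u]; ring
    linarith
  by_cases hζ1 : ‖ζ‖ < 1
  · exfalso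
    have hr : ∀ᶠ r in 𝓝[>] (0:ℝ), r < 1 - ‖ζ‖ :=
      mem_nhdsWithin_of_mem_nhds (Iio_mem_nhds (by linarith))
    obtain ⟨r, hr1, hr2, hr3⟩ := ((hloc ζ).and (hr.and self_mem_nhdsWithin)).exists
    have hr3 : 0 < r := hr3
    have i1 := circleIntegrable_of_usc hg hm ζ r
    have i2 : CircleIntegrable (fun z => -(P z).re + ε / 2 * ‖z‖ ^ 2) ζ r :=
      hPc.continuousOn.circleIntegrable'
    have h1 : Real.circleAverage u ζ r ≤ u ζ := by
      refine Real.circleAverage_mono_on_of_le_circle (i1.add i2) fun x hx => hmax ?_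
      rw [abs_of_pos hr3, mem_sphere_iff_norm] at hx
      rw [mem_closedBall_zero_iff]
      calc ‖x‖ = ‖(x - ζ) + ζ‖ := by simp
        _ ≤ ‖x - ζ‖ + ‖ζ‖ := norm_add_le _ _
        _ ≤ 1 := by linarith
    have h2 : Real.circleAverage u ζ r = Real.circleAverage g ζ r +
        (-(P ζ).re + ε / 2 * (‖ζ‖ ^ 2 + r ^ 2)) := by
      have e1 := Real.circleAverage_fun_add i1 i2
      have c1 : CircleIntegrable (fun z => -(P z).re) ζ r := by
        have := hP.continuous
        exact (by fun_prop : Continuous fun z => -(P z).re).continuousOn.circleIntegrable'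
      have c2 : CircleIntegrable (fun z : ℂ => ε / 2 * ‖z‖ ^ 2) ζ r :=
        (by fun_prop : Continuous fun z : ℂ => ε / 2 * ‖z‖ ^ 2).continuousOn.circleIntegrable'
      have e2 := Real.circleAverage_fun_add c1 c2
      have e3 : Real.circleAverage (fun z : ℂ => ε / 2 * ‖z‖ ^ 2) ζ r
          = ε / 2 * (‖ζ‖ ^ 2 + r ^ 2) := by
        have := Real.circleAverage_fun_smul (a := ε / 2) (f := fun z : ℂ => ‖z‖ ^ 2) (c := ζ) (R := r)
        simp only [smul_eq_mul] at this
        rw [this, circleAverage_norm_sq]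
      have e4 : Real.circleAverage (fun z => -(P z).re) ζ r = -(P ζ).re := by
        have := circleAverage_re_of_differentiable hP.neg ζ r
        simpa using this
      rw [e2, e3, e4] at e1
      exact e1
    have h3 : u ζ = g ζ + (-(P ζ).re + ε / 2 * ‖ζ‖ ^ 2) := rfl
    nlinarith [mul_pos hε (pow_pos hr3 2)]
  · have hζ' : ‖ζ‖ = 1 := le_antisymm (by simpa using hζ) (not_lt.1 hζ1)
    have := hPs ζ (by simpa using hζ')
    simp only [u, hζ']
    linarith

/-- The squared Euclidean norm on `ℂⁿ`. -/
def nsq {n : ℕ} (z : Fin n → ℂ) : ℝ := ∑ i, ‖z i‖ ^ 2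

/-- The mean of `u` over the circle of centre `z` and radius vector `v`. -/
def cmean {n : ℕ} (u : (Fin n → ℂ) → ℝ) (z v : Fin n → ℂ) : ℝ :=
  Real.circleAverage (fun ζ : ℂ => u (z + ζ • v)) 0 1

/-- A fixed real lattice of full rank in `ℂⁿ`. -/
def lat (n : ℕ) : Submodule ℤ (Fin n → ℂ) :=
  Submodule.span ℤ (range (Module.finBasis ℝ (Fin n → ℂ)))

/-- A fundamental domain of `lat n`. -/
def cell (n : ℕ) : Set (Fin n → ℂ) := ZSpan.fundamentalDomain (Module.finBasis ℝ (Fin n → ℂ))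

/-- Periodicity with respect to `lat n`. -/
def Per {n : ℕ} {α : Type*} (u : (Fin n → ℂ) → α) : Prop := ∀ l ∈ lat n, ∀ z, u (z + l) = u z

/-- Bounded below, upper semicontinuous periodic functions `u` for which `u + nsq` is
plurisubharmonic. -/
structure QP {n : ℕ} (u : (Fin n → ℂ) → ℝ) : Prop where
  usc : UpperSemicontinuous u
  per : Per u
  lb : ∃ m, ∀ z, m ≤ u z
  sub : ∀ z v, u z ≤ cmean u z v + nsq v

variable {n : ℕ}

lemma nsq_nonneg (z : Fin n → ℂ) : 0 ≤ nsq z := Finset.sum_nonneg fun _ _ => by positivity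

lemma nsq_smul (c : ℂ) (z : Fin n → ℂ) : nsq (c • z) = ‖c‖ ^ 2 * nsq z := by
  simp [nsq, Finset.mul_sum, mul_pow]

lemma nsq_real_smul (c : ℝ) (z : Fin n → ℂ) : nsq (c • z) = c ^ 2 * nsq z := by
  simp [nsq, Finset.mul_sum, mul_pow]

lemma nsq_neg (z : Fin n → ℂ) : nsq (-z) = nsq z := by simp [nsq]

lemma contDiff_nsq : ContDiff ℝ ⊤ (nsq : (Fin n → ℂ) → ℝ) := by
  unfold nsq
  refine ContDiff.sum fun i _ => ?_
  exact (contDiff_norm_sq ℝ).comp (contDiff_apply ℝ ℂ i)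

lemma continuous_nsq : Continuous (nsq : (Fin n → ℂ) → ℝ) := contDiff_nsq.continuous

lemma norm_sq_le_nsq (z : Fin n → ℂ) : ‖z‖ ^ 2 ≤ nsq z := by
  rcases isEmpty_or_nonempty (Fin n) with h | h
  · have : z = 0 := Subsingleton.elim _ _
    simp [this, nsq]
  · obtain ⟨i, hi⟩ := Finite.exists_max fun i => ‖z i‖
    have : ‖z‖ = ‖z i‖ := le_antisymm ((pi_norm_le_iff_of_nonempty _).2 hi) (norm_le_pi_norm z i)
    rw [this]
    exact Finset.single_le_sum (f := fun i => ‖z i‖ ^ 2) (fun _ _ => by positivity) (Finset.mem_univ i)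

lemma nsq_le_norm_sq (z : Fin n → ℂ) : nsq z ≤ n * ‖z‖ ^ 2 := by
  have : nsq z ≤ ∑ _i : Fin n, ‖z‖ ^ 2 := Finset.sum_le_sum fun i _ => by
    gcongr; exact norm_le_pi_norm z i
  simpa using this

lemma nsq_eq_zero {z : Fin n → ℂ} (h : nsq z = 0) : z = 0 := by
  have := norm_sq_le_nsq z
  rw [h] at this
  have h2 : ‖z‖ = 0 := by nlinarith [norm_nonneg z]
  exact norm_eq_zero.1 h2

/-! ### The cell -/

lemma isAddFundamentalDomain_cell :
    IsAddFundamentalDomain (lat n) (cell n) (volume : Measure (Fin n → ℂ)) :=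
  ZSpan.isAddFundamentalDomain _ _

instance : VAddInvariantMeasure (lat n) (Fin n → ℂ) volume :=
  ⟨fun c s _ => measure_preimage_add volume (c : Fin n → ℂ) s⟩

instance : MeasurableConstVAdd (lat n) (Fin n → ℂ) :=
  ⟨fun c => measurable_const_add (c : Fin n → ℂ)⟩

instance : Countable (lat n) := by unfold lat; infer_instance

lemma measurableSet_cell : MeasurableSet (cell n) := ZSpan.fundamentalDomain_measurableSet _

lemma isBounded_cell : Bornology.IsBounded (cell n) := ZSpan.fundamentalDomain_isBounded _

lemma volume_cell_lt_top : volume (cell n) < ⊤ := isBounded_cell.measure_lt_top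

lemma volume_cell_pos : 0 < volume (cell n) :=
  pos_iff_ne_zero.2 (ZSpan.measure_fundamentalDomain_ne_zero _)

instance : IsFiniteMeasure (volume.restrict (cell n)) :=
  ⟨by simpa using volume_cell_lt_top⟩

lemma volReal_cell_pos : 0 < volume.real (cell n) :=
  ENNReal.toReal_pos volume_cell_pos.ne' volume_cell_lt_top.ne

lemma exists_lat_add_mem_cell (z : Fin n → ℂ) : ∃ l ∈ lat n, z + l ∈ cell n := by
  refine ⟨-(ZSpan.floor (Module.finBasis ℝ (Fin n → ℂ)) z : Fin n → ℂ), ?_, ?_⟩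
  · exact neg_mem (ZSpan.floor (Module.finBasis ℝ (Fin n → ℂ)) z).2
  · have := ZSpan.fract_mem_fundamentalDomain (Module.finBasis ℝ (Fin n → ℂ)) z
    rwa [ZSpan.fract, sub_eq_add_neg] at this

lemma Per.comp {α β : Type*} {u : (Fin n → ℂ) → α} (hu : Per u) (F : α → β) :
    Per (fun z => F (u z)) := fun l hl z => by simp only [hu l hl z]

lemma Per.comp₂ {α β γ : Type*} {u : (Fin n → ℂ) → α} {v : (Fin n → ℂ) → β} (hu : Per u)
    (hv : Per v) (F : α → β → γ) :
    Per (fun z => F (u z) (v z)) := fun l hl z => by simp only [hu l hl z, hv l hl z]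

lemma Per.translate {α : Type*} {u : (Fin n → ℂ) → α} (hu : Per u) (w : Fin n → ℂ) :
    Per (fun z => u (z + w)) := fun l hl z => by
  simp only [add_right_comm z l w]; exact hu l hl _

lemma Per.bddAbove {u : (Fin n → ℂ) → ℝ} (hu : Per u) (husc : UpperSemicontinuous u) :
    ∃ M, ∀ z, u z ≤ M := by
  obtain ⟨M, hM⟩ := (husc.upperSemicontinuousOn (closure (cell n))).bddAbove_of_isCompact
    isBounded_cell.isCompact_closure
  refine ⟨M, fun z => ?_⟩
  obtain ⟨l, hl, hz⟩ := exists_lat_add_mem_cell z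
  rw [← hu l hl z]
  exact hM (mem_image_of_mem _ (subset_closure hz))

lemma Per.exists_bound {u : (Fin n → ℂ) → ℝ} (hu : Per u) (hc : Continuous u) :
    ∃ M, ∀ z, |u z| ≤ M :=
  Per.bddAbove (u := fun z => |u z|) (hu.comp _) (continuous_abs.comp hc).upperSemicontinuous

/-- An almost everywhere statement for a periodic predicate can be checked on the cell. -/
lemma ae_of_ae_cell {p : (Fin n → ℂ) → Prop} (hp : Per p)
    (h : ∀ᵐ z ∂(volume.restrict (cell n)), p z) : ∀ᵐ z, p z := by
  rw [ae_restrict_iff' measurableSet_cell] at h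
  rw [ae_iff]
  refine isAddFundamentalDomain_cell.measure_zero_of_invariant _ (fun g => ?_) ?_
  · ext z
    rw [mem_vadd_set_iff_neg_vadd_mem]
    simp only [mem_ofPred_eq]
    have : -g +ᵥ z = z + (-g : lat n) := by
      rw [add_comm]; rfl
    rw [this, hp _ (-g).2]
  · rw [ae_iff] at h
    convert h using 2
    ext z
    simp [and_comm]

lemma setIntegral_cell_comp_add {E : Type*} [NormedAddCommGroup E] [NormedSpace ℝ E]
    {f : (Fin n → ℂ) → E} (hf : Per f) (v : Fin n → ℂ) :
    ∫ z in cell n, f (z + v) = ∫ z in cell n, f z := by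
  have h2 : IsAddFundamentalDomain (lat n) ((Equiv.addRight v) '' cell n)
      (volume : Measure (Fin n → ℂ)) := by
    refine isAddFundamentalDomain_cell.image_of_equiv (Equiv.addRight v) ?_ (Equiv.refl _) ?_
    · exact (measurePreserving_add_right volume (-v)).quasiMeasurePreserving
    · intro g x
      simp [vadd_eq_add, add_assoc, Submodule.vadd_def]
  have h3 := isAddFundamentalDomain_cell.setIntegral_eq h2 (f := f) (fun g x => by
    rw [show g +ᵥ x = x + (g : Fin n → ℂ) from add_comm _ _]
    exact hf _ g.2 x)
  rw [h3, Equiv.coe_addRight, (measurePreserving_add_right volume v).setIntegral_image_emb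
    (measurableEmbedding_addRight v)]

/-! ### Circle means -/

lemma circleIntegrable_slice {u : (Fin n → ℂ) → ℝ} (hu : UpperSemicontinuous u) {m : ℝ}
    (hm : ∀ z, m ≤ u z) (z v : Fin n → ℂ) :
    CircleIntegrable (fun ζ : ℂ => u (z + ζ • v)) 0 1 :=
  circleIntegrable_of_usc (hu.comp (by fun_prop)) (fun _ => hm _) 0 1

lemma cmean_mono {u U : (Fin n → ℂ) → ℝ} (hu : UpperSemicontinuous u) {m : ℝ}
    (hm : ∀ z, m ≤ u z) (hU : UpperSemicontinuous U) (h : ∀ z, u z ≤ U z) (z v : Fin n → ℂ) :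
    cmean u z v ≤ cmean U z v :=
  circleAverage_le_of_forall (circleIntegrable_slice hu hm z v)
    (circleIntegrable_slice hU (fun z => (hm z).trans (h z)) z v) fun _ => h _

lemma cmean_const (c : ℝ) (z v : Fin n → ℂ) : cmean (fun _ => c) z v = c :=
  Real.circleAverage_const _ _ _

lemma cmean_add {u w : (Fin n → ℂ) → ℝ} {z v : Fin n → ℂ}
    (hu : CircleIntegrable (fun ζ : ℂ => u (z + ζ • v)) 0 1)
    (hw : CircleIntegrable (fun ζ : ℂ => w (z + ζ • v)) 0 1) :
    cmean (fun x => u x + w x) z v = cmean u z v + cmean w z v :=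
  Real.circleAverage_fun_add hu hw

lemma cmean_add_const {u : (Fin n → ℂ) → ℝ} {z v : Fin n → ℂ}
    (hu : CircleIntegrable (fun ζ : ℂ => u (z + ζ • v)) 0 1) (c : ℝ) :
    cmean (fun x => u x + c) z v = cmean u z v + c := by
  rw [cmean_add hu (circleIntegrable_const _ _ _), cmean_const]

lemma cmean_const_mul {u : (Fin n → ℂ) → ℝ} (c : ℝ) {z v : Fin n → ℂ} :
    cmean (fun x => c * u x) z v = c * cmean u z v := by
  have := Real.circleAverage_fun_smul (a := c) (f := fun ζ : ℂ => u (z + ζ • v)) (c := 0) (R := 1)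
  simpa [cmean] using this

lemma QP.bddAbove {u : (Fin n → ℂ) → ℝ} (hu : QP u) : ∃ M, ∀ z, u z ≤ M :=
  hu.per.bddAbove hu.usc

lemma QP.const (c : ℝ) : QP (fun _ : Fin n → ℂ => c) where
  usc := upperSemicontinuous_const
  per := fun _ _ _ => rfl
  lb := ⟨c, fun _ => le_rfl⟩
  sub := fun z v => by rw [cmean_const]; linarith [nsq_nonneg v]

lemma QP.circleIntegrable {u : (Fin n → ℂ) → ℝ} (hu : QP u) (z v : Fin n → ℂ) :
    CircleIntegrable (fun ζ : ℂ => u (z + ζ • v)) 0 1 := by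
  obtain ⟨m, hm⟩ := hu.lb
  exact circleIntegrable_slice hu.usc hm z v

lemma QP.add_const {u : (Fin n → ℂ) → ℝ} (hu : QP u) (c : ℝ) : QP (fun z => u z + c) where
  usc := hu.usc.add upperSemicontinuous_const
  per := hu.per.comp (· + c)
  lb := hu.lb.imp' (· + c) fun _ h z => by linarith [h z]
  sub := fun z v => by
    rw [cmean_add_const (hu.circleIntegrable z v)]; linarith [hu.sub z v]

lemma upperSemicontinuous_const_mul {X : Type*} [TopologicalSpace X] {u : X → ℝ}
    (hu : UpperSemicontinuous u) {c : ℝ} (hc : 0 ≤ c) : UpperSemicontinuous (fun z => c * u z) := by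
  rcases hc.eq_or_lt with rfl | hc
  · simpa using upperSemicontinuous_const
  · intro z y hy
    have hyc : u z < y / c := by rw [lt_div_iff₀ hc]; rw [mul_comm]; exact hy
    filter_upwards [hu z (y / c) hyc] with x hx
    change c * u x < y
    have hx : u x < y / c := hx
    rw [lt_div_iff₀ hc] at hx
    linarith

lemma QP.half_sum {u w : (Fin n → ℂ) → ℝ} (hu : QP u) (hw : QP w) :
    QP (fun z => 1 / 2 * u z + 1 / 2 * w z) := by
  obtain ⟨m, hm⟩ := hu.lb
  obtain ⟨m', hm'⟩ := hw.lb
  refine ⟨(upperSemicontinuous_const_mul hu.usc (by norm_num)).add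
    (upperSemicontinuous_const_mul hw.usc (by norm_num)), hu.per.comp₂ hw.per (fun a b => 1 / 2 * a + 1 / 2 * b),
    ⟨1 / 2 * m + 1 / 2 * m', fun z => by linarith [hm z, hm' z]⟩, fun z v => ?_⟩
  rw [cmean_add, cmean_const_mul, cmean_const_mul]
  · linarith [hu.sub z v, hw.sub z v]
  · exact (hu.circleIntegrable z v).const_fun_smul (a := (1 / 2 : ℝ))
  · exact (hw.circleIntegrable z v).const_fun_smul (a := (1 / 2 : ℝ))

lemma QP.translate {u : (Fin n → ℂ) → ℝ} (hu : QP u) (w : Fin n → ℂ) :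
    QP (fun z => u (z + w)) where
  usc := hu.usc.comp (by fun_prop)
  per := hu.per.translate w
  lb := hu.lb.imp fun _ h z => h _
  sub := fun z v => by
    have := hu.sub (z + w) v
    simp only [cmean] at this ⊢
    simpa only [add_right_comm] using this

lemma cmean_smul_eq {u : (Fin n → ℂ) → ℝ} (z v : Fin n → ℂ) (c : ℂ) (r : ℝ) :
    Real.circleAverage (fun ζ : ℂ => u (z + ζ • v)) c r = cmean u (z + c • v) ((r : ℂ) • v) := by
  rw [Real.circleAverage_eq_circleAverage_zero_one, cmean]
  congr 1
  ext ζ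
  congr 1
  rw [add_smul, smul_smul, mul_comm ζ]
  abel

/-- Quasi-plurisubharmonicity is a local property. -/
lemma QP.of_local {u : (Fin n → ℂ) → ℝ} (husc : UpperSemicontinuous u) (hper : Per u) {m : ℝ}
    (hm : ∀ z, m ≤ u z)
    (h : ∀ z v, ∀ᶠ r : ℝ in 𝓝[>] (0 : ℝ), u z ≤ cmean u z ((r : ℂ) • v) + r ^ 2 * nsq v) : QP u := by
  refine ⟨husc, hper, ⟨m, hm⟩, fun z v => ?_⟩
  have hg : UpperSemicontinuous (fun ζ : ℂ => u (z + ζ • v) + ‖ζ‖ ^ 2 * nsq v) :=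
    (UpperSemicontinuous.comp husc (by fun_prop : Continuous fun ζ : ℂ => z + ζ • v)).add
      (Continuous.upperSemicontinuous (f := fun ζ : ℂ => ‖ζ‖ ^ 2 * nsq v) (by fun_prop))
  have hint : ∀ (c : ℂ) (r : ℝ), CircleIntegrable (fun ζ : ℂ => u (z + ζ • v)) c r := fun c r =>
    circleIntegrable_of_usc (husc.comp (by fun_prop)) (fun _ => hm _) c r
  have hint2 : ∀ (c : ℂ) (r : ℝ), CircleIntegrable (fun ζ : ℂ => ‖ζ‖ ^ 2 * nsq v) c r := fun c r =>
    ContinuousOn.circleIntegrable' (by fun_prop)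
  have hav : ∀ (c : ℂ) (r : ℝ), Real.circleAverage (fun ζ : ℂ => u (z + ζ • v) + ‖ζ‖ ^ 2 * nsq v) c r =
      cmean u (z + c • v) ((r : ℂ) • v) + (‖c‖ ^ 2 + r ^ 2) * nsq v := fun c r => by
    rw [Real.circleAverage_fun_add (hint c r) (hint2 c r), cmean_smul_eq, ← circleAverage_norm_sq]
    congr 1
    have := Real.circleAverage_fun_smul (a := nsq v) (f := fun ζ : ℂ => ‖ζ‖ ^ 2) (c := c) (R := r)
    simp only [smul_eq_mul] at this
    rw [mul_comm, ← this]
    congr 1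
    ext ζ
    ring
  have key := submean_of_local hg (m := m)
    (fun ζ => by nlinarith [hm (z + ζ • v), nsq_nonneg v, mul_nonneg (sq_nonneg ‖ζ‖) (nsq_nonneg v)])
    (fun ζ => by
      filter_upwards [h (z + ζ • v) v] with r hr
      rw [hav]
      linarith)
  rw [hav] at key
  simpa using key

lemma tendsto_circleAverage_of_bounded {g : ℕ → ℂ → ℝ} {f : ℂ → ℝ} {M : ℝ} {c : ℂ} {R : ℝ}
    (hg : ∀ k, Measurable (fun θ => g k (circleMap c R θ)))
    (hM : ∀ k x, |g k x| ≤ M) (hlim : ∀ x, Tendsto (fun k => g k x) atTop (𝓝 (f x))) :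
    Tendsto (fun k => Real.circleAverage (g k) c R) atTop (𝓝 (Real.circleAverage f c R)) := by
  simp only [Real.circleAverage_def]
  refine Tendsto.const_smul ?_ _
  refine intervalIntegral.tendsto_integral_filter_of_dominated_convergence (fun _ => M) ?_ ?_ ?_ ?_
  · exact .of_forall fun k => (hg k).aestronglyMeasurable
  · exact .of_forall fun k => .of_forall fun θ _ => hM k _
  · exact intervalIntegrable_const
  · exact .of_forall fun θ _ => hlim _

/-- The upper semicontinuous regularization. -/
def reg (h : (Fin n → ℂ) → ℝ) (z : Fin n → ℂ) : ℝ := limsup h (𝓝 z)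

section reg

variable {h : (Fin n → ℂ) → ℝ} {a b : ℝ} (ha : ∀ z, a ≤ h z) (hb : ∀ z, h z ≤ b)
include ha hb

omit ha in
lemma reg_isBoundedUnder (z : Fin n → ℂ) : IsBoundedUnder (· ≤ ·) (𝓝 z) h :=
  isBoundedUnder_of ⟨b, hb⟩

omit hb in
lemma reg_isCoboundedUnder (z : Fin n → ℂ) : IsCoboundedUnder (· ≤ ·) (𝓝 z) h :=
  (isBoundedUnder_of ⟨a, ha⟩ : IsBoundedUnder (· ≥ ·) (𝓝 z) h).isCoboundedUnder_le

omit ha in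
lemma le_reg (z : Fin n → ℂ) : h z ≤ reg h z := by
  refine le_of_forall_lt fun y hy => ?_
  have hfr : ∃ᶠ x in 𝓝 z, (y + h z) / 2 ≤ h x := by
    refine Filter.Frequently.filter_mono (f := pure z) ?_ (pure_le_nhds z)
    rw [Filter.frequently_pure]
    linarith
  have := le_limsup_of_frequently_le hfr (reg_isBoundedUnder hb z)
  change (y + h z) / 2 ≤ reg h z at this
  linarith

omit ha in
lemma eventually_lt_of_reg_lt {z : Fin n → ℂ} {y : ℝ} (hy : reg h z < y) : ∀ᶠ x in 𝓝 z, h x < y :=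
  eventually_lt_of_limsup_lt hy (reg_isBoundedUnder hb z)

omit hb in
lemma frequently_lt_of_lt_reg {z : Fin n → ℂ} {y : ℝ} (hy : y < reg h z) : ∃ᶠ x in 𝓝 z, y < h x :=
  frequently_lt_of_lt_limsup (reg_isCoboundedUnder ha z) hy

omit hb in
lemma reg_le_of_eventually {z : Fin n → ℂ} {y : ℝ} (hy : ∀ᶠ x in 𝓝 z, h x ≤ y) : reg h z ≤ y :=
  limsup_le_of_le (reg_isCoboundedUnder ha z) hy

lemma usc_reg : UpperSemicontinuous (reg h) := by
  intro z y hy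
  obtain ⟨y', hy1, hy2⟩ := exists_between hy
  have := eventually_lt_of_reg_lt hb hy1
  filter_upwards [this.eventually_nhds] with x hx
  exact (reg_le_of_eventually ha (hx.mono fun _ => le_of_lt)).trans_lt hy2

omit hb in
lemma reg_le_of_usc {U : (Fin n → ℂ) → ℝ} (hU : UpperSemicontinuous U) (hhU : ∀ z, h z ≤ U z)
    (z : Fin n → ℂ) : reg h z ≤ U z := by
  refine le_of_forall_gt fun y hy => ?_
  obtain ⟨y', hy1, hy2⟩ := exists_between hy
  exact (reg_le_of_eventually ha ((hU z y' hy1).mono fun x hx => (hhU x).trans hx.le)).trans_lt hy2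

omit ha hb in
lemma Per.reg (hper : Per h) : Per (reg h) := by
  intro l hl z
  unfold RelExt.reg
  have : 𝓝 (z + l) = Filter.map (fun x => x + l) (𝓝 z) :=
    ((Homeomorph.addRight l).map_nhds_eq z).symm
  rw [this, ← limsup_comp]
  congr 1
  ext x
  exact hper l hl x

lemma QP.reg (hper : Per h)
    (hsub : ∀ U : (Fin n → ℂ) → ℝ, Continuous U → (∀ z, h z ≤ U z) →
      ∀ z v, h z ≤ cmean U z v + nsq v) : QP (reg h) := by
  have hHa : ∀ z, a ≤ RelExt.reg h z := fun z => (ha z).trans (le_reg hb z)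
  have hHb : ∀ z, RelExt.reg h z ≤ b := fun z => reg_le_of_eventually ha (.of_forall hb)
  have husc := usc_reg ha hb
  refine ⟨husc, hper.reg, ⟨a, hHa⟩, fun z v => ?_⟩
  have hstep : ∀ k : ℕ, RelExt.reg h z ≤ cmean (lipEnv (RelExt.reg h) k) z v + nsq v := by
    intro k
    have hk : (0 : ℝ) ≤ k := Nat.cast_nonneg k
    have hcont := continuous_lipEnv (X := Fin n → ℂ) hHb hk
    refine le_of_forall_lt fun y hy => ?_
    obtain ⟨y', hy1, hy2⟩ := exists_between hy
    have hfr := frequently_lt_of_lt_reg ha hy2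
    have hev : ∀ᶠ x in 𝓝 z, k * dist x z < y' - y := by
      have hc : ContinuousAt (fun x => k * dist x z) z := by fun_prop
      have h0 : k * dist z z < y' - y := by simpa using hy1
      exact hc.eventually_lt continuousAt_const h0
    obtain ⟨x, hx1, hx2⟩ := (hfr.and_eventually hev).exists
    have h1 := hsub _ hcont (fun z => (le_reg hb z).trans (le_lipEnv hHb hk z)) x v
    have h2 : cmean (lipEnv (RelExt.reg h) k) x v ≤
        cmean (fun w => lipEnv (RelExt.reg h) k w + k * dist x z) z v := by
      unfold cmean
      refine circleAverage_le_of_forall ?_ ?_ fun ζ => ?_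
      · exact ContinuousOn.circleIntegrable' (by fun_prop)
      · exact ContinuousOn.circleIntegrable' (by fun_prop)
      · simpa using lipEnv_le_add (X := Fin n → ℂ) hHb hk (x + ζ • v) (z + ζ • v)
    rw [cmean_add_const (ContinuousOn.circleIntegrable' (by fun_prop))] at h2
    linarith
  have hlim : Tendsto (fun k : ℕ => cmean (lipEnv (RelExt.reg h) k) z v) atTop
      (𝓝 (cmean (RelExt.reg h) z v)) := by
    refine tendsto_circleAverage_of_bounded (M := Max.max |a| |b|) (fun k => ?_) (fun k x => ?_)
      (fun x => tendsto_lipEnv hHb husc _)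
    · have := continuous_lipEnv (X := Fin n → ℂ) hHb (Nat.cast_nonneg k)
      exact Continuous.measurable (by fun_prop)
    · exact abs_le_max_abs_abs ((hHa _).trans (le_lipEnv hHb (Nat.cast_nonneg k) _))
        (lipEnv_le hHb (Nat.cast_nonneg k) _)
  exact ge_of_tendsto' (hlim.add_const _) hstep

end reg

/-- The quasi-plurisubharmonic envelope. -/
def pEnv (ρ : (Fin n → ℂ) → ℝ) (z : Fin n → ℂ) : ℝ :=
  sSup ((fun u : (Fin n → ℂ) → ℝ => u z) '' {u | QP u ∧ ∀ x, u x ≤ ρ x})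

section pEnv

variable {ρ : (Fin n → ℂ) → ℝ} {a : ℝ} (ha : ∀ z, a ≤ ρ z)

lemma le_pEnv {u : (Fin n → ℂ) → ℝ} (hu : QP u) (h : ∀ x, u x ≤ ρ x) (z : Fin n → ℂ) :
    u z ≤ pEnv ρ z :=
  le_csSup ⟨ρ z, by rintro _ ⟨w, hw, rfl⟩; exact hw.2 z⟩ (mem_image_of_mem _ ⟨hu, h⟩)

include ha

lemma pEnv_le_of_forall {z : Fin n → ℂ} {y : ℝ} (h : ∀ u, QP u → (∀ x, u x ≤ ρ x) → u z ≤ y) :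
    pEnv ρ z ≤ y :=
  csSup_le (Nonempty.image _ ⟨fun _ => a, QP.const a, ha⟩) (by rintro _ ⟨w, hw, rfl⟩; exact h w hw.1 hw.2)

lemma pEnv_le (z : Fin n → ℂ) : pEnv ρ z ≤ ρ z := pEnv_le_of_forall ha fun _ _ h => h z

lemma const_le_pEnv (z : Fin n → ℂ) : a ≤ pEnv ρ z := le_pEnv (QP.const a) ha z

lemma pEnv_mono {σ : (Fin n → ℂ) → ℝ} (h : ∀ z, ρ z ≤ σ z) (z : Fin n → ℂ) :
    pEnv ρ z ≤ pEnv σ z :=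
  pEnv_le_of_forall ha fun _ hu hle => le_pEnv hu (fun x => (hle x).trans (h x)) z

omit ha in
lemma per_pEnv : Per (pEnv ρ) := by
  intro l hl z
  unfold RelExt.pEnv
  congr 1
  refine image_congr fun u hu => hu.1.per l hl z

lemma QP.pEnv (hper : Per ρ) (husc : UpperSemicontinuous ρ) : QP (pEnv ρ) := by
  obtain ⟨b, hb⟩ := hper.bddAbove husc
  have h1 : ∀ z, a ≤ RelExt.pEnv ρ z := const_le_pEnv ha
  have h2 : ∀ z, RelExt.pEnv ρ z ≤ b := fun z => (pEnv_le ha z).trans (hb z)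
  have hreg : QP (RelExt.reg (RelExt.pEnv ρ)) := by
    refine QP.reg h1 h2 per_pEnv fun U hU hle z v => ?_
    refine pEnv_le_of_forall ha fun u hu huρ => (hu.sub z v).trans ?_
    obtain ⟨m, hm⟩ := hu.lb
    gcongr
    exact cmean_mono hu.usc hm hU.upperSemicontinuous (fun x => (le_pEnv hu huρ x).trans (hle x)) z v
  have : RelExt.reg (RelExt.pEnv ρ) = RelExt.pEnv ρ := by
    ext z
    exact le_antisymm (le_pEnv hreg (reg_le_of_usc h1 husc (pEnv_le ha)) z) (le_reg h2 z)
  rwa [this] at hreg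

end pEnv

open scoped ContDiff

/-- Bounded measurable functions. -/
structure BM (u : (Fin n → ℂ) → ℝ) : Prop where
  meas : Measurable u
  bdd : ∃ M, ∀ z, |u z| ≤ M

lemma BM.of_usc {u : (Fin n → ℂ) → ℝ} (hu : UpperSemicontinuous u) {a b : ℝ} (ha : ∀ z, a ≤ u z)
    (hb : ∀ z, u z ≤ b) : BM u :=
  ⟨hu.measurable, _, fun z => abs_le_max_abs_abs (ha z) (hb z)⟩

lemma QP.bm {u : (Fin n → ℂ) → ℝ} (hu : QP u) : BM u := by
  obtain ⟨a, ha⟩ := hu.lb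
  obtain ⟨b, hb⟩ := hu.bddAbove
  exact BM.of_usc hu.usc ha hb

lemma Per.bm {u : (Fin n → ℂ) → ℝ} (hu : Per u) (hc : Continuous u) : BM u :=
  ⟨hc.measurable, hu.exists_bound hc⟩

lemma BM.add {u w : (Fin n → ℂ) → ℝ} (hu : BM u) (hw : BM w) : BM (fun z => u z + w z) := by
  obtain ⟨M, hM⟩ := hu.bdd
  obtain ⟨M', hM'⟩ := hw.bdd
  exact ⟨hu.meas.add hw.meas, M + M', fun z => (abs_add_le _ _).trans (add_le_add (hM z) (hM' z))⟩

lemma BM.const_mul {u : (Fin n → ℂ) → ℝ} (hu : BM u) (c : ℝ) : BM (fun z => c * u z) := by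
  obtain ⟨M, hM⟩ := hu.bdd
  exact ⟨hu.meas.const_mul c, |c| * M, fun z => by rw [abs_mul]; gcongr; exact hM z⟩

lemma BM.const (c : ℝ) : BM (fun _ : Fin n → ℂ => c) := ⟨measurable_const, |c|, fun _ => le_rfl⟩

lemma BM.sub {u w : (Fin n → ℂ) → ℝ} (hu : BM u) (hw : BM w) : BM (fun z => u z - w z) := by
  simpa [sub_eq_add_neg] using hu.add (hw.const_mul (-1))

lemma BM.comp {u : (Fin n → ℂ) → ℝ} (hu : BM u) {F : (Fin n → ℂ) → Fin n → ℂ} (hF : Measurable F) :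
    BM (fun z => u (F z)) :=
  ⟨hu.meas.comp hF, hu.bdd.imp fun _ h _ => h _⟩

lemma BM.integrableOn_cell {u : (Fin n → ℂ) → ℝ} (hu : BM u) : IntegrableOn u (cell n) := by
  obtain ⟨M, hM⟩ := hu.bdd
  exact Integrable.of_bound (C := M) hu.meas.aestronglyMeasurable (.of_forall hM)

lemma BM.integrable_mul {u : (Fin n → ℂ) → ℝ} (hu : BM u) {k : (Fin n → ℂ) → ℝ}
    (hk : Integrable k) : Integrable (fun y => k y * u y) := by
  obtain ⟨M, hM⟩ := hu.bdd
  exact hk.mul_bdd (c := M) hu.meas.aestronglyMeasurable (.of_forall hM)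

/-- Convolution of `u` with the kernel `k`. -/
def conv (k u : (Fin n → ℂ) → ℝ) (z : Fin n → ℂ) : ℝ := ∫ y, k y * u (z - y)

section conv

variable {k u w : (Fin n → ℂ) → ℝ}

lemma conv_integrable (hk : Integrable k) (hu : BM u) (z : Fin n → ℂ) :
    Integrable (fun y => k y * u (z - y)) :=
  BM.integrable_mul (hu.comp (F := fun y => z - y) (by fun_prop)) hk

lemma conv_add (hk : Integrable k) (hu : BM u) (hw : BM w) (z : Fin n → ℂ) :
    conv k (fun x => u x + w x) z = conv k u z + conv k w z := by
  unfold conv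
  rw [← integral_add (conv_integrable hk hu z) (conv_integrable hk hw z)]
  simp only [mul_add]

lemma conv_const_mul (c : ℝ) (z : Fin n → ℂ) :
    conv k (fun x => c * u x) z = c * conv k u z := by
  unfold conv
  rw [← integral_const_mul]
  congr 1 with y
  ring

lemma conv_sub (hk : Integrable k) (hu : BM u) (hw : BM w) (z : Fin n → ℂ) :
    conv k (fun x => u x - w x) z = conv k u z - conv k w z := by
  have := conv_add hk hu (hw.const_mul (-1)) z
  rw [conv_const_mul] at this
  simpa [sub_eq_add_neg] using this

lemma conv_const (c : ℝ) (z : Fin n → ℂ) :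
    conv k (fun _ => c) z = (∫ y, k y) * c := integral_mul_const _ _

lemma conv_mono (hk : Integrable k) (hk0 : ∀ y, 0 ≤ k y) (hu : BM u) (hw : BM w) {z : Fin n → ℂ}
    (h : ∀ y, k y ≠ 0 → u (z - y) ≤ w (z - y)) : conv k u z ≤ conv k w z := by
  refine integral_mono (conv_integrable hk hu z) (conv_integrable hk hw z) fun y => ?_
  by_cases hy : k y = 0
  · simp [hy]
  · exact mul_le_mul_of_nonneg_left (h y hy) (hk0 y)

lemma conv_translate (z w : Fin n → ℂ) : conv k u (z + w) = conv k (fun x => u (x + w)) z := by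
  unfold conv
  congr 1 with y
  simp only [sub_add_eq_add_sub]

lemma Per.conv (hu : Per u) : Per (conv k u) := fun l hl z => by
  rw [conv_translate]
  congr 1 with x
  exact hu l hl x

lemma BM.locallyIntegrable (hu : BM u) : LocallyIntegrable u := by
  obtain ⟨M, hM⟩ := hu.bdd
  refine (locallyIntegrable_const M).mono hu.meas.aestronglyMeasurable (.of_forall fun z => ?_)
  rw [Real.norm_eq_abs, Real.norm_eq_abs]
  exact (hM z).trans (le_abs_self M)

lemma conv_eq : conv k u = convolution k u (ContinuousLinearMap.mul ℝ ℝ) volume := rfl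

lemma contDiff_conv (hk : ContDiff ℝ ∞ k) (hkc : HasCompactSupport k) (hu : BM u) :
    ContDiff ℝ ∞ (conv k u) := by
  rw [conv_eq]
  exact hkc.contDiff_convolution_left _ hk hu.locallyIntegrable

lemma fderiv_conv (hk : ContDiff ℝ ∞ k) (hkc : HasCompactSupport k) (hu : BM u)
    (ξ z : Fin n → ℂ) :
    fderiv ℝ (conv k u) z ξ = conv (fun y => fderiv ℝ k y ξ) u z := by
  have h := hkc.hasFDerivAt_convolution_left (ContinuousLinearMap.mul ℝ ℝ)
    (hk.of_le (by exact_mod_cast le_top)) hu.locallyIntegrable z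
  rw [← conv_eq] at h
  rw [h.fderiv, convolution]
  have hint : Integrable (fun y => fderiv ℝ k y) := by
    refine Continuous.integrable_of_hasCompactSupport ?_ (hkc.fderiv ℝ)
    exact hk.continuous_fderiv (by simp)
  rw [ContinuousLinearMap.integral_apply]
  · simp [conv, ContinuousLinearMap.precompL_apply]
  · have hb := hu.comp (F := fun y => z - y) (by fun_prop)
    obtain ⟨M, hM⟩ := hb.bdd
    have h2 : Integrable (fun y => u (z - y) • fderiv ℝ k y) :=
      hint.bdd_smul M hb.meas.aestronglyMeasurable (.of_forall hM)
    refine h2.congr (.of_forall fun y => ?_)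
    ext x
    simp [ContinuousLinearMap.precompL_apply, mul_comm]

end conv

/-! ### The kernels -/

/-- The unnormalised bump. -/
def psi (y : Fin n → ℂ) : ℝ := expNegInvGlue (1 - nsq y)

/-- The normalised bump at scale `ε`. -/
def kr (ε : ℝ) (y : Fin n → ℂ) : ℝ :=
  (∫ x : Fin n → ℂ, psi (ε⁻¹ • x))⁻¹ * psi (ε⁻¹ • y)

lemma contDiff_psi : ContDiff ℝ ∞ (psi : (Fin n → ℂ) → ℝ) :=
  (expNegInvGlue.contDiff (n := ⊤)).comp (contDiff_const.sub (contDiff_nsq.of_le le_top))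

lemma psi_ne_zero {y : Fin n → ℂ} (h : psi y ≠ 0) : nsq y < 1 := by
  by_contra hn
  exact h (expNegInvGlue.zero_of_nonpos (by linarith))

lemma isCompact_nsq_le (c : ℝ) : IsCompact {y : Fin n → ℂ | nsq y ≤ c} := by
  refine Metric.isCompact_of_isClosed_isBounded (isClosed_le continuous_nsq continuous_const) ?_
  refine (Metric.isBounded_closedBall (x := (0 : Fin n → ℂ)) (r := Real.sqrt c)).subset fun y hy => ?_
  rw [mem_closedBall_zero_iff]
  exact Real.le_sqrt_of_sq_le ((norm_sq_le_nsq y).trans hy)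

section kr

variable {ε : ℝ} (hε : 0 < ε)
include hε

lemma psi_scale_ne_zero {y : Fin n → ℂ} (h : psi (ε⁻¹ • y) ≠ 0) : nsq y < ε ^ 2 := by
  have := psi_ne_zero h
  rw [nsq_real_smul, inv_pow, inv_mul_lt_one₀ (by positivity)] at this
  exact this

lemma kr_ne_zero {y : Fin n → ℂ} (h : kr ε y ≠ 0) : nsq y < ε ^ 2 :=
  psi_scale_ne_zero hε (right_ne_zero_of_mul h)

omit hε in
lemma contDiff_kr : ContDiff ℝ ∞ (kr ε : (Fin n → ℂ) → ℝ) :=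
  contDiff_const.mul (contDiff_psi.comp (contDiff_const_smul _))

lemma hasCompactSupport_psi_scale : HasCompactSupport (fun y : Fin n → ℂ => psi (ε⁻¹ • y)) :=
  HasCompactSupport.intro (isCompact_nsq_le (ε ^ 2)) fun y hy => by
    by_contra h
    exact hy (psi_scale_ne_zero hε h).le

lemma hasCompactSupport_kr : HasCompactSupport (kr ε : (Fin n → ℂ) → ℝ) :=
  HasCompactSupport.intro (isCompact_nsq_le (ε ^ 2)) fun y hy => by
    by_contra h
    exact hy (kr_ne_zero hε h).le

lemma integral_psi_pos : 0 < ∫ x : Fin n → ℂ, psi (ε⁻¹ • x) := by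
  refine Continuous.integral_pos_of_hasCompactSupport_nonneg_nonzero (x := 0) ?_
    (hasCompactSupport_psi_scale hε) (fun y => expNegInvGlue.nonneg _) ?_
  · exact contDiff_psi.continuous.comp (continuous_const_smul _)
  · simp [psi, nsq]

lemma integrable_kr : Integrable (kr ε : (Fin n → ℂ) → ℝ) :=
  contDiff_kr.continuous.integrable_of_hasCompactSupport (hasCompactSupport_kr hε)

lemma kr_nonneg (y : Fin n → ℂ) : 0 ≤ kr ε y :=
  mul_nonneg (inv_nonneg.2 (integral_psi_pos hε).le) (expNegInvGlue.nonneg _)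

lemma integral_kr : ∫ y : Fin n → ℂ, kr ε y = 1 := by
  unfold kr
  rw [integral_const_mul, inv_mul_cancel₀ (integral_psi_pos hε).ne']

omit hε in
lemma kr_smul {c : ℂ} (hc : ‖c‖ = 1) (y : Fin n → ℂ) : kr ε (c • y) = kr ε y := by
  unfold kr psi
  rw [smul_comm, nsq_smul, hc]
  simp

end kr

lemma measurePreserving_unit_smul {c : ℂ} (hc : ‖c‖ = 1) :
    MeasurePreserving (fun y : Fin n → ℂ => c • y) := by
  have h1 : MeasurePreserving (fun w : ℂ => c * w) := by
    have := (rotation ⟨c, by simpa [Submonoid.unitSphere] using hc⟩).measurePreserving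
    exact this
  exact volume_preserving_pi (fun _ : Fin n => h1)

lemma conv_eq_unit_smul {k u : (Fin n → ℂ) → ℝ} {c : ℂ} (hc : ‖c‖ = 1)
    (hk : ∀ y, k (c • y) = k y) (z : Fin n → ℂ) : conv k u z = ∫ y, k y * u (z - c • y) := by
  have hc0 : c ≠ 0 := by rintro rfl; simp at hc
  have hemb : MeasurableEmbedding (fun y : Fin n → ℂ => c • y) :=
    (Homeomorph.smulOfNeZero c hc0).measurableEmbedding
  rw [conv, ← (measurePreserving_unit_smul hc).integral_comp hemb]
  simp only [hk]

lemma circleAverage_integral {k : (Fin n → ℂ) → ℝ} (hk : Integrable k) {F : ℂ → (Fin n → ℂ) → ℝ}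
    (hF : Measurable (Function.uncurry F)) {M : ℝ} (hM : ∀ ζ y, |F ζ y| ≤ M) :
    Real.circleAverage (fun ζ => ∫ y, k y * F ζ y) 0 1 =
      ∫ y, k y * Real.circleAverage (fun ζ => F ζ y) 0 1 := by
  simp only [Real.circleAverage_def, smul_eq_mul]
  have h2 : (0 : ℝ) ≤ 2 * π := by positivity
  simp only [intervalIntegral.integral_of_le h2]
  rw [integral_integral_swap, ← integral_const_mul]
  · congr 1 with y
    rw [integral_const_mul]
    ring
  · have hk2 : Integrable (fun p : ℝ × (Fin n → ℂ) => k p.2)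
        ((volume.restrict (Ioc 0 (2 * π))).prod volume) := hk.comp_snd _
    refine hk2.mul_bdd (c := M) ?_ (.of_forall fun p => hM _ _)
    refine Measurable.aestronglyMeasurable ?_
    exact hF.comp (((continuous_circleMap 0 1).measurable.comp measurable_fst).prodMk measurable_snd)

lemma conv_eq_cmean {k u : (Fin n → ℂ) → ℝ} (hk : Integrable k) (hu : BM u)
    (hinv : ∀ c : ℂ, ‖c‖ = 1 → ∀ y, k (c • y) = k y) (z : Fin n → ℂ) :
    conv k u z = ∫ y, k y * cmean u z y := by
  obtain ⟨M, hM⟩ := hu.bdd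
  unfold cmean
  rw [← circleAverage_integral hk (F := fun ζ y => u (z + ζ • y)) ?_ (fun _ _ => hM _)]
  · rw [← Real.circleAverage_const (conv k u z) 0 1]
    refine Real.circleAverage_congr_sphere fun ζ hζ => ?_
    have hζ' : ‖-ζ‖ = 1 := by simpa using hζ
    rw [conv_eq_unit_smul hζ' (hinv _ hζ')]
    simp
  · exact hu.meas.comp (by fun_prop)

section moll

variable {u : (Fin n → ℂ) → ℝ} {ε : ℝ}

lemma QP.le_conv_kr (hu : QP u) (hε : 0 < ε) (z : Fin n → ℂ) :
    u z ≤ conv (kr ε) u z + ε ^ 2 := by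
  have hk := integrable_kr (n := n) hε
  rw [conv_eq_cmean hk hu.bm (fun c hc => kr_smul hc)]
  have h1 : ∫ y : Fin n → ℂ, kr ε y * (u z - ε ^ 2) = u z - ε ^ 2 := by
    rw [integral_mul_const, integral_kr hε, one_mul]
  have h2 : ∫ y : Fin n → ℂ, kr ε y * (u z - ε ^ 2) ≤ ∫ y, kr ε y * cmean u z y := by
    obtain ⟨M, hM⟩ := hu.bm.bdd
    refine integral_mono (hk.mul_const _) ?_ fun y => ?_
    · refine hk.mul_bdd (c := M) ?_ (.of_forall fun y => ?_)
      · unfold cmean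
        simp only [Real.circleAverage_def]
        have hm : Measurable (fun p : (Fin n → ℂ) × ℝ => u (z + circleMap 0 1 p.2 • p.1)) := by
          refine hu.bm.meas.comp (Continuous.measurable ?_)
          have := continuous_circleMap (0 : ℂ) 1
          fun_prop
        simp only [intervalIntegral.integral_of_le Real.two_pi_pos.le]
        exact (hm.stronglyMeasurable.integral_prod_right'
            (ν := volume.restrict (Ioc 0 (2 * π)))).aestronglyMeasurable.const_smul (2 * π)⁻¹
      · have := hu.circleIntegrable z y
        rw [Real.norm_eq_abs, abs_le]
        constructor
        · rw [← cmean_const (-M) z y]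
          exact circleAverage_le_of_forall (circleIntegrable_const _ _ _) this
            fun ζ => (abs_le.1 (hM _)).1
        · rw [← cmean_const M z y]
          exact circleAverage_le_of_forall this (circleIntegrable_const _ _ _)
            fun ζ => (abs_le.1 (hM _)).2
    · by_cases hy : kr ε y = 0
      · simp [hy]
      · refine mul_le_mul_of_nonneg_left ?_ (kr_nonneg hε y)
        linarith [hu.sub z y, kr_ne_zero hε hy]
  linarith

lemma contDiff_conv_kr (hε : 0 < ε) (hu : BM u) : ContDiff ℝ ∞ (conv (kr ε) u) :=
  contDiff_conv contDiff_kr (hasCompactSupport_kr hε) hu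

lemma conv_kr_le_of_forall (hε : 0 < ε) (hu : BM u) {z : Fin n → ℂ} {b : ℝ}
    (h : ∀ y, nsq y < ε ^ 2 → u (z - y) ≤ b) : conv (kr ε) u z ≤ b := by
  have := conv_mono (integrable_kr hε) (kr_nonneg hε) hu (BM.const b) (z := z)
    fun y hy => h y (kr_ne_zero hε hy)
  rwa [conv_const, integral_kr hε, one_mul] at this

lemma le_conv_kr_of_forall (hε : 0 < ε) (hu : BM u) {z : Fin n → ℂ} {b : ℝ}
    (h : ∀ y, nsq y < ε ^ 2 → b ≤ u (z - y)) : b ≤ conv (kr ε) u z := by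
  have := conv_mono (integrable_kr hε) (kr_nonneg hε) (BM.const b) hu (z := z)
    fun y hy => h y (kr_ne_zero hε hy)
  rwa [conv_const, integral_kr hε, one_mul] at this

lemma QP.conv_kr (hu : QP u) (hε : 0 < ε) : QP (conv (kr ε) u) := by
  obtain ⟨a, ha⟩ := hu.lb
  obtain ⟨M, hM⟩ := hu.bm.bdd
  refine ⟨(contDiff_conv_kr hε hu.bm).continuous.upperSemicontinuous, hu.per.conv,
    ⟨a, fun z => le_conv_kr_of_forall hε hu.bm fun y _ => ha _⟩, fun z v => ?_⟩
  have hk := integrable_kr (n := n) hε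
  have h1 : cmean (conv (kr ε) u) z v = ∫ y, kr ε y * cmean u (z - y) v := by
    unfold cmean
    rw [← circleAverage_integral hk (F := fun ζ y => u (z - y + ζ • v))
      (hu.bm.meas.comp (by fun_prop)) (fun _ _ => hM _)]
    congr 1 with ζ
    unfold conv
    congr 1 with y
    rw [sub_add_eq_add_sub]
  have hadd : conv (kr ε) (fun x => u x - nsq v) z = conv (kr ε) u z - nsq v := by
    rw [conv_sub hk hu.bm (BM.const _), conv_const, integral_kr hε, one_mul]
  rw [h1, ← sub_le_iff_le_add, ← hadd]
  refine integral_mono (conv_integrable hk (hu.bm.sub (BM.const _)) z) ?_ fun y => ?_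
  · refine hk.mul_bdd (c := M) ?_ (.of_forall fun y => ?_)
    · unfold cmean
      simp only [Real.circleAverage_def]
      have hm : Measurable (fun p : (Fin n → ℂ) × ℝ => u (z - p.1 + circleMap 0 1 p.2 • v)) := by
        refine hu.bm.meas.comp (Continuous.measurable ?_)
        have := continuous_circleMap (0 : ℂ) 1
        fun_prop
      simp only [intervalIntegral.integral_of_le Real.two_pi_pos.le]
      exact (hm.stronglyMeasurable.integral_prod_right'
            (ν := volume.restrict (Ioc 0 (2 * π)))).aestronglyMeasurable.const_smul (2 * π)⁻¹
    · have := hu.circleIntegrable (z - y) v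
      rw [Real.norm_eq_abs, abs_le]
      constructor
      · rw [← cmean_const (-M) (z - y) v]
        exact circleAverage_le_of_forall (circleIntegrable_const _ _ _) this
          fun ζ => (abs_le.1 (hM _)).1
      · rw [← cmean_const M (z - y) v]
        exact circleAverage_le_of_forall this (circleIntegrable_const _ _ _)
          fun ζ => (abs_le.1 (hM _)).2
  · exact mul_le_mul_of_nonneg_left (by linarith [hu.sub (z - y) v]) (kr_nonneg hε y)

lemma exists_forall_nsq_lt {p : (Fin n → ℂ) → Prop} {z : Fin n → ℂ} (h : ∀ᶠ x in 𝓝 z, p x) :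
    ∃ ε₀ > 0, ∀ ε, 0 < ε → ε < ε₀ → ∀ y : Fin n → ℂ, nsq y < ε ^ 2 → p (z - y) := by
  obtain ⟨r, hr, hb⟩ := Metric.eventually_nhds_iff.1 h
  refine ⟨r, hr, fun ε hε hεr y hy => hb ?_⟩
  rw [dist_eq_norm, sub_sub_cancel_left, norm_neg]
  have := (norm_sq_le_nsq y).trans_lt hy
  exact (lt_of_pow_lt_pow_left₀ 2 hε.le this).trans hεr

lemma conv_kr_eventually_le (hu : BM u) (husc : UpperSemicontinuous u) {z : Fin n → ℂ} {y : ℝ}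
    (hy : u z < y) : ∃ ε₀ > 0, ∀ ε, 0 < ε → ε < ε₀ → conv (kr ε) u z ≤ y := by
  obtain ⟨ε₀, h0, h⟩ := exists_forall_nsq_lt (husc z y hy)
  exact ⟨ε₀, h0, fun ε hε hlt => conv_kr_le_of_forall hε hu fun x hx => (h ε hε hlt x hx).le⟩

lemma QP.le_of_ae_le (hu : QP u) {H : (Fin n → ℂ) → ℝ} (hH : BM H) (hHu : UpperSemicontinuous H)
    (h : ∀ᵐ z, u z ≤ H z) (z : Fin n → ℂ) : u z ≤ H z := by
  refine le_of_forall_gt fun y hy => ?_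
  obtain ⟨y', hy1, hy2⟩ := exists_between hy
  obtain ⟨ε₀, h0, hb⟩ := conv_kr_eventually_le hH hHu hy1
  obtain ⟨ε, hε, hε1, hε2⟩ : ∃ ε : ℝ, 0 < ε ∧ ε < ε₀ ∧ ε ^ 2 < y - y' := by
    have h1 : ∀ᶠ ε : ℝ in 𝓝[>] 0, ε < ε₀ := nhdsWithin_le_nhds (gt_mem_nhds h0)
    have h2 : ∀ᶠ ε : ℝ in 𝓝[>] 0, ε ^ 2 < y - y' := by
      refine nhdsWithin_le_nhds ?_
      have : Tendsto (fun ε : ℝ => ε ^ 2) (𝓝 0) (𝓝 0) := by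
        simpa using (continuous_pow 2 : Continuous fun ε : ℝ => ε ^ 2).tendsto 0
      exact this.eventually_lt_const (by linarith)
    obtain ⟨ε, h3, h4, h5⟩ := (h1.and (h2.and self_mem_nhdsWithin)).exists
    exact ⟨ε, h5, h3, h4⟩
  have hle : conv (kr ε) u z ≤ conv (kr ε) H z := by
    refine integral_mono_ae (conv_integrable (integrable_kr hε) hu.bm z)
      (conv_integrable (integrable_kr hε) hH z) ?_
    have h' := (Measure.measurePreserving_sub_left volume z).quasiMeasurePreserving.ae h
    filter_upwards [h'] with y hy
    exact mul_le_mul_of_nonneg_left hy (kr_nonneg hε y)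
  linarith [hu.le_conv_kr hε z, hb ε hε hε1]

/-- Uniform approximation of continuous periodic functions by their mollifications. -/
lemma exists_conv_kr_close (hu : Per u) (hc : Continuous u) {η : ℝ} (hη : 0 < η) :
    ∃ ε₀ > 0, ∀ ε, 0 < ε → ε < ε₀ → ∀ z, |conv (kr ε) u z - u z| ≤ η := by
  have hbm := hu.bm hc
  obtain ⟨r, hr, hb⟩ : ∃ r > 0, ∀ x ∈ cell n, ∀ y, dist x y < r → dist (u x) (u y) < η := by
    obtain ⟨R, hR⟩ := (isBounded_cell (n := n)).subset_closedBall 0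
    have hK := isCompact_closedBall (0 : Fin n → ℂ) (R + 1)
    obtain ⟨r, hr, hu⟩ := Metric.uniformContinuousOn_iff.1
      (hK.uniformContinuousOn_of_continuous hc.continuousOn) η hη
    refine ⟨min r 1, by positivity, fun x hx y hxy => ?_⟩
    have h1 := mem_closedBall_zero_iff.1 (hR hx)
    refine hu x (mem_closedBall_zero_iff.2 (by linarith)) y (mem_closedBall_zero_iff.2 ?_)
      (hxy.trans_le (min_le_left _ _))
    have h2 := hxy.trans_le (min_le_right _ _)
    rw [dist_eq_norm'] at h2
    calc ‖y‖ = ‖x + (y - x)‖ := by congr 1; abel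
      _ ≤ ‖x‖ + ‖y - x‖ := norm_add_le _ _
      _ ≤ R + 1 := by linarith
  have hb' : ∀ x y, dist x y < r → dist (u x) (u y) < η := by
    intro x y hxy
    obtain ⟨l, hl, hx⟩ := exists_lat_add_mem_cell x
    rw [← hu l hl x, ← hu l hl y]
    exact hb _ hx _ (by simpa using hxy)
  refine ⟨r, hr, fun ε hε hεr z => ?_⟩
  have hy : ∀ y, nsq y < ε ^ 2 → |u (z - y) - u z| < η := fun y hy => by
    refine hb' _ _ ?_
    rw [dist_eq_norm, sub_sub_cancel_left, norm_neg]
    exact (lt_of_pow_lt_pow_left₀ 2 hε.le ((norm_sq_le_nsq y).trans_lt hy)).trans hεr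
  rw [abs_le]
  constructor
  · have := le_conv_kr_of_forall hε hbm (z := z) (b := u z - η)
      fun y h => by linarith [(abs_lt.1 (hy y h)).1]
    linarith
  · have := conv_kr_le_of_forall hε hbm (z := z) (b := u z + η)
      fun y h => by linarith [(abs_lt.1 (hy y h)).2]
    linarith

lemma integral_cell_conv {k : (Fin n → ℂ) → ℝ} (hk : Integrable k) (hu : Per u) (hbm : BM u) :
    ∫ z in cell n, conv k u z = (∫ y, k y) * ∫ z in cell n, u z := by
  obtain ⟨M, hM⟩ := hbm.bdd
  unfold conv
  rw [integral_integral_swap]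
  · rw [← integral_mul_const]
    congr 1 with y
    rw [integral_const_mul]
    simp only [sub_eq_add_neg]
    rw [setIntegral_cell_comp_add hu]
  · have hk2 : Integrable (fun p : (Fin n → ℂ) × (Fin n → ℂ) => k p.2)
        ((volume.restrict (cell n)).prod volume) := hk.comp_snd _
    refine hk2.mul_bdd (c := M) ?_ (.of_forall fun p => hM _)
    exact (hbm.meas.comp (by fun_prop)).aestronglyMeasurable

end moll

/-- The supremum of an increasing sequence of quasi-plurisubharmonic functions coincides almost
everywhere with its regularization, which is quasi-plurisubharmonic. -/
lemma exists_QP_limit {u : ℕ → (Fin n → ℂ) → ℝ} (hu : ∀ k, QP (u k)) (hmono : ∀ z, Monotone fun k => u k z)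
    {b : ℝ} (hb : ∀ k z, u k z ≤ b) :
    ∃ H, QP H ∧ (∀ k z, u k z ≤ H z) ∧ (∀ z, H z ≤ b) ∧
      ∀ᵐ z, Tendsto (fun k => u k z) atTop (𝓝 (H z)) := by
  obtain ⟨a, ha⟩ := (hu 0).lb
  have hbd : ∀ z, BddAbove (range fun k => u k z) := fun z => ⟨b, by rintro _ ⟨k, rfl⟩; exact hb k z⟩
  set h : (Fin n → ℂ) → ℝ := fun z => ⨆ k, u k z with hh
  have hle : ∀ k z, u k z ≤ h z := fun k z => le_ciSup (hbd z) k
  have hha : ∀ z, a ≤ h z := fun z => (ha z).trans (hle 0 z)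
  have hhb : ∀ z, h z ≤ b := fun z => ciSup_le fun k => hb k z
  have hper : Per h := fun l hl z => by simp only [hh, (hu _).per l hl z]
  have hmeas : Measurable h := Measurable.iSup fun k => (hu k).bm.meas
  have hbm : BM h := ⟨hmeas, _, fun z => abs_le_max_abs_abs (hha z) (hhb z)⟩
  have hQ : QP (reg h) := QP.reg hha hhb hper fun U hU hUh z v => ciSup_le fun k =>
    ((hu k).sub z v).trans (by
      obtain ⟨m, hm⟩ := (hu k).lb
      gcongr
      exact cmean_mono (hu k).usc hm hU.upperSemicontinuous (fun x => (hle k x).trans (hUh x)) z v)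
  have hreg : ∀ z, h z ≤ reg h z := le_reg hhb
  have hmoll : ∀ ε : ℝ, 0 < ε → ∀ z, reg h z ≤ conv (kr ε) h z + ε ^ 2 := fun ε hε =>
    reg_le_of_usc hha ((contDiff_conv_kr hε hbm).continuous.add continuous_const).upperSemicontinuous
      fun z => ciSup_le fun k => ((hu k).le_conv_kr hε z).trans (by
        gcongr
        exact conv_mono (integrable_kr hε) (kr_nonneg hε) (hu k).bm hbm fun y _ => hle k _)
  have hint : ∫ z in cell n, (reg h z - h z) ≤ 0 := by
    rw [integral_sub hQ.bm.integrableOn_cell hbm.integrableOn_cell, sub_nonpos]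
    have hlim : Tendsto (fun ε : ℝ => (∫ z in cell n, h z) + volume.real (cell n) * ε ^ 2) (𝓝[>] 0)
        (𝓝 (∫ z in cell n, h z)) := by
      refine tendsto_nhdsWithin_of_tendsto_nhds ?_
      have : Continuous (fun ε : ℝ => (∫ z in cell n, h z) + volume.real (cell n) * ε ^ 2) := by
        fun_prop
      simpa using this.tendsto 0
    refine ge_of_tendsto hlim ?_
    filter_upwards [self_mem_nhdsWithin] with ε (hε : 0 < ε)
    have hb1 : BM (conv (kr ε) h) :=
      (Per.conv hper).bm (contDiff_conv_kr hε hbm).continuous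
    have h1 : ∫ z in cell n, reg h z ≤ ∫ z in cell n, (conv (kr ε) h z + ε ^ 2) :=
      integral_mono hQ.bm.integrableOn_cell (hb1.add (BM.const _)).integrableOn_cell (hmoll ε hε)
    rw [integral_add hb1.integrableOn_cell (BM.const _).integrableOn_cell,
      integral_cell_conv (integrable_kr hε) hper hbm, integral_kr hε, one_mul] at h1
    simpa using h1
  have hae : ∀ᵐ z, reg h z - h z = 0 := by
    refine ae_of_ae_cell (hQ.per.comp₂ hper (fun a b => a - b = 0)) ?_
    have h0 : 0 ≤ᵐ[volume.restrict (cell n)] fun z => reg h z - h z :=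
      .of_forall fun z => sub_nonneg.2 (hreg z)
    exact (integral_eq_zero_iff_of_nonneg_ae h0 (hQ.bm.sub hbm).integrableOn_cell).1
      (le_antisymm hint (integral_nonneg_of_ae h0))
  refine ⟨reg h, hQ, fun k z => (hle k z).trans (hreg z),
    fun z => reg_le_of_eventually hha (.of_forall hhb), ?_⟩
  filter_upwards [hae] with z hz
  rw [sub_eq_zero.1 hz]
  exact tendsto_atTop_ciSup (hmono z) (hbd z)

/-- Second order Taylor expansion at a point where the derivative is differentiable. -/
lemma isLittleO_taylor_two {E : Type*} [NormedAddCommGroup E] [NormedSpace ℝ E]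
    {f : E → ℝ} {L : E → E →L[ℝ] ℝ} {z : E} {Q : E →L[ℝ] E →L[ℝ] ℝ}
    (hf : ∀ x, HasFDerivAt f (L x) x) (hL : HasFDerivAt L Q z) :
    (fun y => f (z + y) - f z - L z y - 1 / 2 * Q y y) =o[𝓝 0] fun y => ‖y‖ ^ 2 := by
  rw [Asymptotics.isLittleO_iff]
  intro δ hδ
  have h1 := (hasFDerivAt_iff_isLittleO_nhds_zero.1 hL).def hδ
  obtain ⟨r, hr, hb⟩ := Metric.eventually_nhds_iff.1 h1
  filter_upwards [Metric.ball_mem_nhds (0 : E) hr] with y hy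
  rw [mem_ball] at hy
  have hder : ∀ t ∈ Icc (0 : ℝ) 1, HasDerivWithinAt
      (fun t : ℝ => f (z + t • y) - t * L z y - t ^ 2 * (1 / 2 * Q y y))
      (L (z + t • y) y - L z y - t * Q y y) (Icc 0 1) t := by
    intro t _
    have e1 : HasDerivAt (fun t : ℝ => z + t • y) y t := by
      simpa using ((hasDerivAt_id t).smul_const y).const_add z
    have e2 : HasDerivAt (fun t : ℝ => f (z + t • y)) (L (z + t • y) y) t :=
      (hf (z + t • y)).comp_hasDerivAt t e1
    have e3 := (e2.sub ((hasDerivAt_id t).mul_const (L z y))).sub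
      ((hasDerivAt_pow 2 t).mul_const (1 / 2 * Q y y))
    refine (e3.congr_deriv ?_).hasDerivWithinAt
    simp
    ring
  have hbound : ∀ t ∈ Ico (0 : ℝ) 1, ‖L (z + t • y) y - L z y - t * Q y y‖ ≤ δ * ‖y‖ ^ 2 := by
    intro t ht
    have hty : ‖t • y‖ ≤ ‖y‖ := by
      rw [norm_smul, Real.norm_eq_abs, abs_of_nonneg ht.1]
      exact mul_le_of_le_one_left (norm_nonneg y) ht.2.le
    have h2 := hb (y := t • y) (by rw [dist_zero_right] at hy ⊢; exact hty.trans_lt hy)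
    have h3 : L (z + t • y) y - L z y - t * Q y y = (L (z + t • y) - L z - Q (t • y)) y := by
      simp
    rw [h3]
    calc _ ≤ ‖L (z + t • y) - L z - Q (t • y)‖ * ‖y‖ := ContinuousLinearMap.le_opNorm _ _
      _ ≤ δ * ‖t • y‖ * ‖y‖ := by gcongr
      _ ≤ δ * ‖y‖ * ‖y‖ := by gcongr
      _ = δ * ‖y‖ ^ 2 := by ring
  have := norm_image_sub_le_of_norm_deriv_le_segment_01' hder hbound
  simp only [one_smul, one_mul, one_pow, zero_smul, add_zero, zero_mul, sub_zero, ne_eq,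
    OfNat.ofNat_ne_zero, not_false_eq_true, zero_pow] at this
  rw [Real.norm_of_nonneg (by positivity : (0 : ℝ) ≤ ‖y‖ ^ 2)]
  have e : f (z + y) - f z - L z y - 1 / 2 * Q y y =
      f (z + y) - L z y - 1 / 2 * Q y y - f z := by ring
  rw [e]
  exact this

/-- The Levi form of a real quadratic form. -/
def lev (Q : (Fin n → ℂ) →L[ℝ] (Fin n → ℂ) →L[ℝ] ℝ) (v : Fin n → ℂ) : ℝ :=
  1 / 4 * (Q v v + Q (I • v) (I • v))

lemma circleMap_smul_eq (θ : ℝ) (v : Fin n → ℂ) :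
    circleMap 0 1 θ • v = Real.cos θ • v + Real.sin θ • (I • v) := by
  ext i
  simp [circleMap, Complex.exp_mul_I]
  ring

lemma circleAverage_quadratic (ℓ : (Fin n → ℂ) →L[ℝ] ℝ) (Q : (Fin n → ℂ) →L[ℝ] (Fin n → ℂ) →L[ℝ] ℝ)
    (a : ℝ) (v : Fin n → ℂ) :
    Real.circleAverage (fun ζ : ℂ => a + ℓ (ζ • v) + 1 / 2 * Q (ζ • v) (ζ • v)) 0 1 =
      a + lev Q v := by
  simp only [Real.circleAverage_def, circleMap_smul_eq, map_add, map_smul,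
    add_apply, smul_apply, smul_eq_mul]
  have h : ∀ θ : ℝ, a + (Real.cos θ * ℓ v + Real.sin θ * ℓ (I • v)) +
      1 / 2 * (Real.cos θ * (Real.cos θ * Q v v + Real.sin θ * Q (I • v) v) +
        Real.sin θ * (Real.cos θ * Q v (I • v) + Real.sin θ * Q (I • v) (I • v))) =
      a + Real.cos θ * ℓ v + Real.sin θ * ℓ (I • v) + Real.cos θ ^ 2 * (1 / 2 * Q v v) +
        Real.sin θ ^ 2 * (1 / 2 * Q (I • v) (I • v)) +
        (Real.sin θ * Real.cos θ) * (1 / 2 * (Q (I • v) v + Q v (I • v))) := fun θ => by ring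
  simp only [h]
  have hi : ∀ {f : ℝ → ℝ}, Continuous f → IntervalIntegrable f volume 0 (2 * π) :=
    fun hf => hf.intervalIntegrable _ _
  rw [intervalIntegral.integral_add (hi (by fun_prop)) (hi (by fun_prop)),
    intervalIntegral.integral_add (hi (by fun_prop)) (hi (by fun_prop)),
    intervalIntegral.integral_add (hi (by fun_prop)) (hi (by fun_prop)),
    intervalIntegral.integral_add (hi (by fun_prop)) (hi (by fun_prop)),
    intervalIntegral.integral_add (hi (by fun_prop)) (hi (by fun_prop))]
  simp only [intervalIntegral.integral_mul_const, intervalIntegral.integral_const, integral_cos,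
    integral_sin, integral_cos_sq, integral_sin_sq, integral_sin_mul_cos₁]
  have hπ : (π : ℝ) ≠ 0 := Real.pi_ne_zero
  simp [lev]
  field_simp
  ring

lemma tendsto_cmean_quotient {u : (Fin n → ℂ) → ℝ} {z : Fin n → ℂ}
    {ℓ : (Fin n → ℂ) →L[ℝ] ℝ} {Q : (Fin n → ℂ) →L[ℝ] (Fin n → ℂ) →L[ℝ] ℝ}
    (hexp : (fun y => u (z + y) - u z - ℓ y - 1 / 2 * Q y y) =o[𝓝 0] fun y => ‖y‖ ^ 2)
    {v : Fin n → ℂ}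
    (hint : ∀ᶠ r : ℝ in 𝓝[>] 0, CircleIntegrable (fun ζ : ℂ => u (z + ζ • (r : ℂ) • v)) 0 1) :
    Tendsto (fun r : ℝ => (cmean u z ((r : ℂ) • v) - u z) / r ^ 2) (𝓝[>] 0) (𝓝 (lev Q v)) := by
  rw [Metric.tendsto_nhds]
  intro η hη
  have hδ : 0 < η / 2 / (‖v‖ ^ 2 + 1) := by positivity
  have h1 := hexp.def hδ
  obtain ⟨s, hs, hb⟩ := Metric.eventually_nhds_iff.1 h1
  have hev : ∀ᶠ r : ℝ in 𝓝[>] 0, r * ‖v‖ < s := by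
    refine nhdsWithin_le_nhds ?_
    have : Tendsto (fun r : ℝ => r * ‖v‖) (𝓝 0) (𝓝 0) := by
      simpa using (by fun_prop : Continuous fun r : ℝ => r * ‖v‖).tendsto 0
    exact this.eventually_lt_const hs
  filter_upwards [hint, hev, self_mem_nhdsWithin] with r hr hrs (hr0 : 0 < r)
  have hq := circleAverage_quadratic ℓ Q (u z) ((r : ℂ) • v)
  have hqi : CircleIntegrable (fun ζ : ℂ => u z + ℓ (ζ • (r : ℂ) • v) +
      1 / 2 * Q (ζ • (r : ℂ) • v) (ζ • (r : ℂ) • v)) 0 1 :=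
    ContinuousOn.circleIntegrable' (by fun_prop)
  have hlevr : lev Q ((r : ℂ) • v) = r ^ 2 * lev Q v := by
    have e1 : (r : ℂ) • v = r • v := rfl
    have e2 : I • r • v = r • I • v := smul_comm _ _ _
    simp only [lev, e1, e2, map_smul, smul_apply, smul_eq_mul]
    ring
  have hdiff : |cmean u z ((r : ℂ) • v) - (u z + r ^ 2 * lev Q v)| ≤ η / 2 * r ^ 2 := by
    rw [← hlevr, ← hq, cmean, ← Real.circleAverage_fun_sub hr hqi]
    refine (Real.abs_circleAverage_le_circleAverage_abs).trans ?_
    refine Real.circleAverage_mono_on_of_le_circle (hr.sub hqi).abs fun ζ hζ => ?_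
    have hζ1 : ‖ζ‖ = 1 := by simpa using hζ
    have hy : ‖ζ • (r : ℂ) • v‖ = r * ‖v‖ := by
      rw [norm_smul, norm_smul, hζ1, one_mul, Complex.norm_of_nonneg hr0.le]
    have hb1 := hb (y := ζ • (r : ℂ) • v) (by rw [dist_zero_right, hy]; exact hrs)
    rw [Real.norm_eq_abs, Real.norm_of_nonneg (by positivity), hy] at hb1
    have e : u (z + ζ • (r : ℂ) • v) - (u z + ℓ (ζ • (r : ℂ) • v) +
        1 / 2 * Q (ζ • (r : ℂ) • v) (ζ • (r : ℂ) • v)) = u (z + ζ • (r : ℂ) • v) - u z -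
        ℓ (ζ • (r : ℂ) • v) - 1 / 2 * Q (ζ • (r : ℂ) • v) (ζ • (r : ℂ) • v) := by ring
    show |u (z + ζ • (r : ℂ) • v) - (u z + ℓ (ζ • (r : ℂ) • v) +
        1 / 2 * Q (ζ • (r : ℂ) • v) (ζ • (r : ℂ) • v))| ≤ η / 2 * r ^ 2
    rw [e]
    refine hb1.trans ?_
    have h3 : η / 2 / (‖v‖ ^ 2 + 1) * (r * ‖v‖) ^ 2 =
        η / 2 * r ^ 2 * (‖v‖ ^ 2 / (‖v‖ ^ 2 + 1)) := by field_simp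
    rw [h3]
    refine mul_le_of_le_one_right (by positivity) ?_
    rw [div_le_one (by positivity)]
    linarith
  rw [Real.dist_eq]
  have hr2 : 0 < r ^ 2 := by positivity
  have : (cmean u z ((r : ℂ) • v) - u z) / r ^ 2 - lev Q v =
      (cmean u z ((r : ℂ) • v) - (u z + r ^ 2 * lev Q v)) / r ^ 2 := by
    field_simp; ring
  rw [this, abs_div, abs_of_pos hr2, div_lt_iff₀ hr2]
  nlinarith

lemma QP.lev_nonneg {u : (Fin n → ℂ) → ℝ} (hu : QP u) {z : Fin n → ℂ}
    {ℓ : (Fin n → ℂ) →L[ℝ] ℝ} {Q : (Fin n → ℂ) →L[ℝ] (Fin n → ℂ) →L[ℝ] ℝ}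
    (hexp : (fun y => u (z + y) - u z - ℓ y - 1 / 2 * Q y y) =o[𝓝 0] fun y => ‖y‖ ^ 2)
    (v : Fin n → ℂ) : 0 ≤ lev Q v + nsq v := by
  obtain ⟨m, hm⟩ := hu.lb
  have h := tendsto_cmean_quotient hexp (v := v)
    (Eventually.of_forall fun r => circleIntegrable_slice hu.usc hm z _)
  have : -nsq v ≤ lev Q v := by
    refine ge_of_tendsto h ?_
    filter_upwards [self_mem_nhdsWithin] with r (hr : 0 < r)
    rw [le_div_iff₀ (by positivity)]
    have := hu.sub z ((r : ℂ) • v)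
    rw [nsq_smul, Complex.norm_of_nonneg hr.le] at this
    linarith
  linarith

lemma eventually_le_cmean {u : (Fin n → ℂ) → ℝ} {z : Fin n → ℂ}
    {ℓ : (Fin n → ℂ) →L[ℝ] ℝ} {Q : (Fin n → ℂ) →L[ℝ] (Fin n → ℂ) →L[ℝ] ℝ}
    (hexp : (fun y => u (z + y) - u z - ℓ y - 1 / 2 * Q y y) =o[𝓝 0] fun y => ‖y‖ ^ 2)
    {v : Fin n → ℂ}
    (hint : ∀ᶠ r : ℝ in 𝓝[>] 0, CircleIntegrable (fun ζ : ℂ => u (z + ζ • (r : ℂ) • v)) 0 1)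
    (hpos : v ≠ 0 → 0 < lev Q v + nsq v) :
    ∀ᶠ r : ℝ in 𝓝[>] 0, u z ≤ cmean u z ((r : ℂ) • v) + r ^ 2 * nsq v := by
  by_cases hv : v = 0
  · subst hv
    refine Eventually.of_forall fun r => ?_
    have : cmean u z ((r : ℂ) • 0) = u z := by simp [cmean, Real.circleAverage_const]
    rw [this]
    have := nsq_nonneg (0 : Fin n → ℂ)
    nlinarith [sq_nonneg r]
  · have h := (tendsto_cmean_quotient hexp hint).eventually_const_lt
      (show -nsq v < lev Q v by linarith [hpos hv])
    filter_upwards [h, self_mem_nhdsWithin] with r hr (hr0 : 0 < r)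
    rw [lt_div_iff₀ (by positivity)] at hr
    linarith

/-- The second derivative of a function. -/
abbrev hess (f : (Fin n → ℂ) → ℝ) (z : Fin n → ℂ) : (Fin n → ℂ) →L[ℝ] (Fin n → ℂ) →L[ℝ] ℝ :=
  fderiv ℝ (fderiv ℝ f) z

lemma isLittleO_hess {f : (Fin n → ℂ) → ℝ} (hf : ContDiff ℝ ∞ f) (z : Fin n → ℂ) :
    (fun y => f (z + y) - f z - fderiv ℝ f z y - 1 / 2 * hess f z y y) =o[𝓝 0]
      fun y => ‖y‖ ^ 2 :=
  isLittleO_taylor_two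
    (fun x => (hf.differentiable (by simp) x).hasFDerivAt)
    (((hf.fderiv_right (m := ∞) (by simp)).differentiable (by simp) z).hasFDerivAt)

lemma QP.of_contDiff {f : (Fin n → ℂ) → ℝ} (hf : ContDiff ℝ ∞ f) (hper : Per f)
    (h : ∀ z v, v ≠ 0 → 0 < lev (hess f z) v + nsq v) : QP f := by
  obtain ⟨M, hM⟩ := hper.exists_bound hf.continuous
  have hm : ∀ z, -M ≤ f z := fun z => (abs_le.1 (hM z)).1
  exact QP.of_local hf.continuous.upperSemicontinuous hper hm fun z v =>
    eventually_le_cmean (isLittleO_hess hf z) (Eventually.of_forall fun r =>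
      circleIntegrable_slice hf.continuous.upperSemicontinuous hm z _) (h z v)

lemma exists_lat_sep (n : ℕ) : ∃ ρ > 0, ∀ l ∈ lat n, nsq l < ρ → l = 0 := by
  have hd : DiscreteTopology (lat n) := by unfold lat; infer_instance
  have h : ({0} : Set (lat n)) ∈ 𝓝 (0 : lat n) := by
    rw [nhds_discrete]; exact rfl
  obtain ⟨r, hr, hb⟩ := Metric.mem_nhds_iff.1 h
  refine ⟨r ^ 2, by positivity, fun l hl hlr => ?_⟩
  have h1 : ‖l‖ < r := lt_of_pow_lt_pow_left₀ 2 hr.le ((norm_sq_le_nsq l).trans_lt hlr)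
  have h2 : (⟨l, hl⟩ : lat n) ∈ Metric.ball (0 : lat n) r := by
    rw [mem_ball_zero_iff]; exact h1
  simpa using congrArg Subtype.val (hb h2)

lemma isClosed_lat (n : ℕ) : IsClosed (lat n : Set (Fin n → ℂ)) := by
  have hd : DiscreteTopology (lat n).toAddSubgroup := by
    unfold lat
    exact inferInstanceAs (DiscreteTopology
      (Submodule.span ℤ (range (Module.finBasis ℝ (Fin n → ℂ)))))
  exact AddSubgroup.isClosed_of_discrete (H := (lat n).toAddSubgroup)

lemma nsq_add_le (x y : Fin n → ℂ) : nsq (x + y) ≤ 2 * nsq x + 2 * nsq y := by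
  simp only [nsq, Finset.mul_sum, ← Finset.sum_add_distrib]
  refine Finset.sum_le_sum fun i _ => ?_
  have := norm_add_le (x i) (y i)
  have h2 : ‖x i + y i‖ ^ 2 ≤ (‖x i‖ + ‖y i‖) ^ 2 := by gcongr
  simp only [Pi.add_apply]
  nlinarith [sq_nonneg (‖x i‖ - ‖y i‖)]

/-- A radius such that the lattice translates of balls of this squared radius are disjoint. -/
def sepRad (n : ℕ) : ℝ := (exists_lat_sep n).choose / 4

lemma sepRad_pos : 0 < sepRad n := by
  have := (exists_lat_sep n).choose_spec.1
  unfold sepRad; linarith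

lemma lat_eq_of_near {z z₀ l l' : Fin n → ℂ} (hl : l ∈ lat n) (hl' : l' ∈ lat n) {r : ℝ}
    (hr : r ≤ sepRad n) (h : nsq (z + l - z₀) < r) (h' : nsq (z + l' - z₀) < r) : l = l' := by
  have h1 := nsq_add_le (z + l - z₀) (-(z + l' - z₀))
  rw [nsq_neg] at h1
  have h2 : z + l - z₀ + -(z + l' - z₀) = l - l' := by abel
  rw [h2] at h1
  exact sub_eq_zero.1 ((exists_lat_sep n).choose_spec.2 _ (sub_mem hl hl') (by
    unfold sepRad at hr; linarith))

open Classical in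
/-- The maximum of a periodic function `v` and of the periodization of a function `W` given on
a ball. -/
def glue (z₀ : Fin n → ℂ) (r : ℝ) (v W : (Fin n → ℂ) → ℝ) (z : Fin n → ℂ) : ℝ :=
  if h : ∃ l ∈ lat n, nsq (z + l - z₀) < r then max (v z) (W (z + h.choose)) else v z

lemma glue_of_mem {z₀ z : Fin n → ℂ} {r : ℝ} (hr : r ≤ sepRad n) (v W : (Fin n → ℂ) → ℝ)
    (hz : nsq (z - z₀) < r) : glue z₀ r v W z = max (v z) (W z) := by
  have h : ∃ l ∈ lat n, nsq (z + l - z₀) < r := ⟨0, zero_mem _, by simpa using hz⟩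
  have e : h.choose = 0 :=
    lat_eq_of_near h.choose_spec.1 (zero_mem _) hr h.choose_spec.2 (by simpa using hz)
  rw [glue, dif_pos h, e, add_zero]

lemma le_glue (z₀ : Fin n → ℂ) (r : ℝ) (v W : (Fin n → ℂ) → ℝ) (z : Fin n → ℂ) :
    v z ≤ glue z₀ r v W z := by
  unfold glue
  split_ifs
  · exact le_max_left _ _
  · exact le_rfl

lemma glue_of_forall {z₀ z : Fin n → ℂ} {r : ℝ} (v W : (Fin n → ℂ) → ℝ)
    (hz : ∀ l ∈ lat n, r ≤ nsq (z + l - z₀)) : glue z₀ r v W z = v z := by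
  rw [glue, dif_neg]
  push Not
  exact hz

lemma per_glue {z₀ : Fin n → ℂ} {r : ℝ} (hr : r ≤ sepRad n) {v : (Fin n → ℂ) → ℝ}
    (hv : Per v) (W : (Fin n → ℂ) → ℝ) : Per (glue z₀ r v W) := by
  intro l hl z
  by_cases h : ∃ l ∈ lat n, nsq (z + l - z₀) < r
  · have h' : ∃ l' ∈ lat n, nsq (z + l + l' - z₀) < r := by
      obtain ⟨m, hm, h⟩ := h
      exact ⟨m - l, sub_mem hm hl, by rwa [show z + l + (m - l) - z₀ = z + m - z₀ by abel]⟩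
    rw [glue, dif_pos h', glue, dif_pos h, hv l hl]
    congr 2
    have h2 := h'.choose_spec.2
    rw [add_assoc] at h2
    have := lat_eq_of_near (add_mem hl h'.choose_spec.1) h.choose_spec.1 hr h2 h.choose_spec.2
    rw [add_assoc, this]
  · have h' : ¬ ∃ l' ∈ lat n, nsq (z + l + l' - z₀) < r := by
      rintro ⟨m, hm, h'⟩
      exact h ⟨l + m, add_mem hl hm, by rwa [← add_assoc]⟩
    rw [glue, dif_neg h', glue, dif_neg h, hv l hl]

lemma isClosed_core (z₀ : Fin n → ℂ) (s : ℝ) :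
    IsClosed {z : Fin n → ℂ | ∃ l ∈ lat n, nsq (z + l - z₀) ≤ s} := by
  have hc : IsCompact {y : Fin n → ℂ | nsq (y - z₀) ≤ s} := by
    have := (isCompact_nsq_le (n := n) s).image (f := fun y => y + z₀) (by fun_prop)
    convert this using 1
    ext y
    simp only [mem_image]
    constructor
    · intro h; exact ⟨y - z₀, h, sub_add_cancel _ _⟩
    · rintro ⟨x, hx, rfl⟩; simpa using hx
  have := (isClosed_lat n).add_right_of_isCompact hc
  convert this using 1
  ext z
  constructor
  · rintro ⟨l, hl, h⟩
    exact ⟨-l, neg_mem hl, z + l, h, by simp⟩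
  · rintro ⟨l, hl, y, hy, rfl⟩
    exact ⟨-l, neg_mem hl, by simpa [add_comm l y] using hy⟩

lemma usc_at_congr {f g : (Fin n → ℂ) → ℝ} {z : Fin n → ℂ} (h : f =ᶠ[𝓝 z] g)
    (hg : UpperSemicontinuousAt g z) : UpperSemicontinuousAt f z := by
  intro y hy
  rw [h.eq_of_nhds] at hy
  filter_upwards [h, hg y hy] with x h1 h2
  rwa [h1]

/-- A function on a ball that is dominated near the boundary of the ball by a function in `QP` can
be glued to it. -/
lemma QP.glue {v W : (Fin n → ℂ) → ℝ} (hv : QP v) {z₀ : Fin n → ℂ} {r : ℝ} (hr0 : 0 < r)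
    (hr : r ≤ sepRad n)
    (hWusc : UpperSemicontinuousOn W {z | nsq (z - z₀) < r})
    (hW : ∀ z, nsq (z - z₀) < r → ∀ w, ∀ᶠ s : ℝ in 𝓝[>] 0,
      CircleIntegrable (fun ζ : ℂ => W (z + ζ • (s : ℂ) • w)) 0 1 ∧
        W z ≤ cmean W z ((s : ℂ) • w) + s ^ 2 * nsq w)
    (hWv : ∀ z, nsq (z - z₀) < r → r / 4 ≤ nsq (z - z₀) → W z ≤ v z) :
    QP (glue z₀ r v W) := by
  set g := RelExt.glue z₀ r v W with hg
  have hper : Per g := per_glue hr hv.per W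
  have hopen : IsOpen {z : Fin n → ℂ | nsq (z - z₀) < r} :=
    isOpen_lt (continuous_nsq.comp (by fun_prop)) continuous_const
  have hnear : ∀ z, nsq (z - z₀) < r → g =ᶠ[𝓝 z] fun y => Max.max (v y) (W y) := fun z hz => by
    filter_upwards [hopen.mem_nhds hz] with y hy using glue_of_mem hr v W hy
  have hfar : ∀ z, (¬ ∃ l ∈ lat n, nsq (z + l - z₀) < r) → g =ᶠ[𝓝 z] v := fun z hz => by
    have : z ∈ {z : Fin n → ℂ | ∃ l ∈ lat n, nsq (z + l - z₀) ≤ r / 4}ᶜ := by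
      rintro ⟨l, hl, h⟩
      exact hz ⟨l, hl, by linarith⟩
    filter_upwards [(isClosed_core z₀ (r / 4)).isOpen_compl.mem_nhds this] with y hy
    by_cases h : ∃ l ∈ lat n, nsq (y + l - z₀) < r
    · obtain ⟨l, hl, h⟩ := h
      have hy' : r / 4 ≤ nsq (y + l - z₀) := by
        by_contra h3
        exact hy ⟨l, hl, (not_le.1 h3).le⟩
      rw [← hper l hl, ← hv.per l hl, hg, glue_of_mem hr v W h]
      exact max_eq_left (hWv _ h hy')
    · push Not at h
      exact glue_of_forall v W h
  obtain ⟨m, hm⟩ := hv.lb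
  have hgm : ∀ z, m ≤ g z := fun z => (hm z).trans (le_glue z₀ r v W z)
  have husc : UpperSemicontinuous g := by
    intro z
    by_cases h : ∃ l ∈ lat n, nsq (z + l - z₀) < r
    · obtain ⟨l, hl, h⟩ := h
      have h1 : UpperSemicontinuousAt g (z + l) := by
        refine usc_at_congr (hnear _ h) ?_
        have hW1 : UpperSemicontinuousAt W (z + l) := fun y hy => by
          have := hWusc (z + l) h y hy
          rwa [hopen.nhdsWithin_eq h] at this
        exact UpperSemicontinuousAt.sup (hv.usc _) hW1
      intro y hy
      have h2 := h1 y (show g (z + l) < y by rwa [hper l hl])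
      have h3 : Tendsto (fun x : Fin n → ℂ => x + l) (𝓝 z) (𝓝 (z + l)) :=
        (by fun_prop : Continuous fun x : Fin n → ℂ => x + l).tendsto z
      filter_upwards [h3.eventually h2] with x hx
      show g x < y
      rw [← hper l hl]
      exact hx
    · exact usc_at_congr (hfar z h) (hv.usc z)
  have hint : ∀ z w, CircleIntegrable (fun ζ : ℂ => g (z + ζ • w)) 0 1 := fun z w =>
    circleIntegrable_slice husc hgm z w
  have hvle : ∀ z w (s : ℝ), v z ≤ cmean g z ((s : ℂ) • w) + s ^ 2 * nsq w := fun z w s => by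
    have h1 := hv.sub z ((s : ℂ) • w)
    rw [nsq_smul, Complex.norm_real, Real.norm_eq_abs, sq_abs] at h1
    have h2 := cmean_mono hv.usc hm husc (le_glue z₀ r v W) z ((s : ℂ) • w)
    linarith
  refine QP.of_local husc hper hgm fun z w => ?_
  by_cases h : ∃ l ∈ lat n, nsq (z + l - z₀) < r
  · obtain ⟨l, hl, h⟩ := h
    have hball : ∀ᶠ s : ℝ in 𝓝[>] 0, ∀ ζ ∈ sphere (0 : ℂ) |1|,
        nsq (z + l + ζ • (s : ℂ) • w - z₀) < r := by
      obtain ⟨δ, hδ, hb⟩ := Metric.isOpen_iff.1 hopen (z + l) h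
      have : Tendsto (fun s : ℝ => s * ‖w‖) (𝓝 0) (𝓝 0) := by
        simpa using (by fun_prop : Continuous fun s : ℝ => s * ‖w‖).tendsto 0
      filter_upwards [nhdsWithin_le_nhds (this.eventually_lt_const hδ), self_mem_nhdsWithin]
        with s hs (hs0 : 0 < s) ζ hζ
      have hζ1 : ‖ζ‖ = 1 := by simpa using hζ
      refine hb ?_
      rw [mem_ball, dist_eq_norm]
      simpa [norm_smul, hζ1, abs_of_pos hs0] using hs
    filter_upwards [hW _ h w, hball] with s hs hsb
    have hc : cmean g z ((s : ℂ) • w) = cmean g (z + l) ((s : ℂ) • w) := by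
      unfold cmean
      congr 1
      ext ζ
      rw [← hper l hl, add_right_comm]
    rw [← hper l hl, hg, glue_of_mem hr v W h, ← hg]
    refine max_le ?_ ?_
    · rw [hv.per l hl]; exact hvle z w s
    · rw [hc]
      have h5 : cmean W (z + l) ((s : ℂ) • w) ≤ cmean g (z + l) ((s : ℂ) • w) := by
        refine Real.circleAverage_mono hs.1 (hint _ _) fun ζ hζ => ?_
        show W _ ≤ g _
        rw [hg, glue_of_mem hr v W (hsb ζ hζ)]
        exact le_max_right _ _
      linarith [hs.2]
  · push Not at h
    rw [hg, glue_of_forall v W h, ← hg]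
    exact Eventually.of_forall fun s => hvle z w s

section MixedDiscriminant

variable {R : Type*} [CommRing R]

/-- The sign of a permutation in a commutative ring. -/
def sg (σ : Equiv.Perm (Fin n)) : R := ((Equiv.Perm.sign σ : ℤ) : R)

lemma sg_mul (σ τ : Equiv.Perm (Fin n)) : (sg (σ * τ) : R) = sg σ * sg τ := by
  simp [sg]

lemma sg_mul_self (σ : Equiv.Perm (Fin n)) : (sg σ : R) * sg σ = 1 := by
  rw [sg, ← Int.cast_mul, ← Units.val_mul, Int.units_mul_self]
  simp

/-- The mixed discriminant of matrices, up to normalization. -/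
def Md (M : Fin n → Matrix (Fin n) (Fin n) R) : R :=
  ∑ σ : Equiv.Perm (Fin n), ∑ τ : Equiv.Perm (Fin n), sg σ * sg τ * ∏ k, M k (σ k) (τ k)

lemma Md_map {S : Type*} [CommRing S] (φ : R →+* S) (M : Fin n → Matrix (Fin n) (Fin n) R) :
    φ (Md M) = Md fun k => (M k).map φ := by
  simp [Md, map_sum, map_mul, map_prod, sg]

lemma Md_transpose (M : Fin n → Matrix (Fin n) (Fin n) R) :
    Md (fun k => (M k).transpose) = Md M := by
  unfold Md
  rw [Finset.sum_comm]
  refine Finset.sum_congr rfl fun σ _ => Finset.sum_congr rfl fun τ _ => ?_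
  simp only [Matrix.transpose_apply]
  ring

lemma Md_perm (M : Fin n → Matrix (Fin n) (Fin n) R) (ϖ : Equiv.Perm (Fin n)) :
    Md (fun k => M (ϖ k)) = Md M := by
  unfold Md
  rw [← Equiv.sum_comp (Equiv.mulRight ϖ)]
  refine Finset.sum_congr rfl fun σ _ => ?_
  rw [← Equiv.sum_comp (Equiv.mulRight ϖ)]
  refine Finset.sum_congr rfl fun τ _ => ?_
  simp only [Equiv.coe_mulRight, sg_mul, Equiv.Perm.mul_apply]
  rw [Equiv.prod_comp ϖ fun k => M k (σ k) (τ k)]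
  linear_combination (sg σ * sg τ * ∏ k, M k (σ k) (τ k)) * sg_mul_self (R := R) ϖ

lemma Md_const (A : Matrix (Fin n) (Fin n) R) : Md (fun _ => A) = n.factorial * A.det := by
  unfold Md
  rw [Finset.sum_comm]
  have : ∀ τ : Equiv.Perm (Fin n), ∑ σ : Equiv.Perm (Fin n),
      (sg σ : R) * sg τ * ∏ k, A (σ k) (τ k) = A.det := fun τ => by
    rw [← Equiv.sum_comp (Equiv.mulRight τ), Matrix.det_apply']
    refine Finset.sum_congr rfl fun σ _ => ?_
    simp only [Equiv.coe_mulRight, sg_mul, Equiv.Perm.mul_apply]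
    rw [Equiv.prod_comp τ fun k => A (σ k) k, mul_assoc (sg σ : R), sg_mul_self, mul_one]
    rfl
  simp only [this, Finset.sum_const, Finset.card_univ, Fintype.card_perm, Fintype.card_fin,
    nsmul_eq_mul]

lemma Md_update (M : Fin n → Matrix (Fin n) (Fin n) R) (i : Fin n)
    (A : Matrix (Fin n) (Fin n) R) :
    Md (Function.update M i A) = ∑ σ : Equiv.Perm (Fin n), ∑ τ : Equiv.Perm (Fin n),
      sg σ * sg τ * (A (σ i) (τ i) * ∏ k ∈ Finset.univ.erase i, M k (σ k) (τ k)) := by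
  unfold Md
  refine Finset.sum_congr rfl fun σ _ => Finset.sum_congr rfl fun τ _ => ?_
  rw [← Finset.mul_prod_erase _ _ (Finset.mem_univ i)]
  congr 2
  · simp
  · refine Finset.prod_congr rfl fun k hk => ?_
    rw [Function.update_of_ne (Finset.ne_of_mem_erase hk)]

lemma Md_update_add (M : Fin n → Matrix (Fin n) (Fin n) R) (i : Fin n)
    (A B : Matrix (Fin n) (Fin n) R) :
    Md (Function.update M i (A + B)) = Md (Function.update M i A) + Md (Function.update M i B) := by
  simp only [Md_update, ← Finset.sum_add_distrib, Matrix.add_apply]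
  refine Finset.sum_congr rfl fun σ _ => Finset.sum_congr rfl fun τ _ => ?_
  ring

end MixedDiscriminant

open scoped ComplexOrder MatrixOrder in
lemma Md_re_nonneg {M : Fin n → Matrix (Fin n) (Fin n) ℂ} (hM : ∀ k, (M k).PosSemidef) :
    0 ≤ (Md M).re := by
  have h : ∀ k, ∃ B : Matrix (Fin n) (Fin n) ℂ, M k = B.conjTranspose * B := fun k =>
    CStarAlgebra.nonneg_iff_eq_star_mul_self.1 (hM k).nonneg
  choose B hB using h
  have key : Md M = ∑ L : Fin n → Fin n,
      (starRingEnd ℂ) (∑ σ : Equiv.Perm (Fin n), sg σ * ∏ k, B k (L k) (σ k)) *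
        ∑ σ : Equiv.Perm (Fin n), sg σ * ∏ k, B k (L k) (σ k) := by
    have e : ∀ σ τ : Equiv.Perm (Fin n), ∏ k, M k (σ k) (τ k) = ∑ L : Fin n → Fin n,
        ∏ k, (starRingEnd ℂ (B k (L k) (σ k)) * B k (L k) (τ k)) := fun σ τ => by
      have e1 : ∀ k, M k (σ k) (τ k) =
          ∑ l : Fin n, starRingEnd ℂ (B k l (σ k)) * B k l (τ k) := fun k => by
        rw [hB k, Matrix.mul_apply]
        rfl
      rw [Finset.prod_congr rfl fun k _ => e1 k, Finset.prod_univ_sum, Fintype.piFinset_univ]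
    conv_lhs => simp only [Md, e, Finset.mul_sum]
    rw [Finset.sum_congr rfl fun σ _ => Finset.sum_comm, Finset.sum_comm]
    refine Finset.sum_congr rfl fun L _ => ?_
    rw [map_sum, Finset.sum_mul]
    refine Finset.sum_congr rfl fun σ _ => ?_
    rw [Finset.mul_sum]
    refine Finset.sum_congr rfl fun τ _ => ?_
    rw [map_mul, map_prod, Finset.prod_mul_distrib, sg, sg, map_intCast]
    ring
  rw [key, Complex.re_sum]
  refine Finset.sum_nonneg fun L _ => ?_
  rw [mul_comm, Complex.mul_conj]
  exact_mod_cast Complex.normSq_nonneg _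

/-- The algebra of smooth periodic complex valued functions. -/
def SP (n : ℕ) : Subalgebra ℂ ((Fin n → ℂ) → ℂ) where
  carrier := {g | ContDiff ℝ ∞ g ∧ Per g}
  mul_mem' ha hb := ⟨ha.1.mul hb.1, fun l hl z => by
    simp only [Pi.mul_apply, ha.2 l hl, hb.2 l hl]⟩
  add_mem' ha hb := ⟨ha.1.add hb.1, fun l hl z => by
    simp only [Pi.add_apply, ha.2 l hl, hb.2 l hl]⟩
  algebraMap_mem' c := ⟨contDiff_const, fun _ _ _ => rfl⟩

lemma sp_differentiable (g : SP n) : Differentiable ℝ (g : (Fin n → ℂ) → ℂ) :=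
  g.2.1.differentiable (by simp)

lemma sp_continuous (g : SP n) : Continuous (g : (Fin n → ℂ) → ℂ) := g.2.1.continuous

lemma sp_exists_bound (g : SP n) : ∃ M, ∀ z, ‖(g : (Fin n → ℂ) → ℂ) z‖ ≤ M := by
  obtain ⟨M, hM⟩ := Per.exists_bound (u := fun z => ‖(g : (Fin n → ℂ) → ℂ) z‖) (g.2.2.comp _)
    (sp_continuous g).norm
  exact ⟨M, fun z => by simpa using hM z⟩

lemma SP.fderiv_mem (ξ : Fin n → ℂ) (g : SP n) :
    (fun x => fderiv ℝ (g : (Fin n → ℂ) → ℂ) x ξ) ∈ SP n := by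
  refine ⟨(g.2.1.fderiv_right (m := ∞) (by simp)).clm_apply contDiff_const, fun l hl z => ?_⟩
  have h : (fun x => (g : (Fin n → ℂ) → ℂ) (x + l)) = g := funext fun x => g.2.2 l hl x
  show fderiv ℝ _ (z + l) ξ = _
  rw [← fderiv_comp_add_right, h]

/-- The derivative in a real direction as a derivation. -/
def ddD (ξ : Fin n → ℂ) : Derivation ℂ (SP n) (SP n) :=
  Derivation.mk'
    { toFun := fun g => ⟨fun x => fderiv ℝ (g : (Fin n → ℂ) → ℂ) x ξ, SP.fderiv_mem ξ g⟩
      map_add' := fun g h => by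
        ext x
        show fderiv ℝ ((g : (Fin n → ℂ) → ℂ) + (h : (Fin n → ℂ) → ℂ)) x ξ = _
        rw [fderiv_add ((sp_differentiable g) x) ((sp_differentiable h) x)]
        rfl
      map_smul' := fun c g => by
        ext x
        show fderiv ℝ (c • (g : (Fin n → ℂ) → ℂ)) x ξ = _
        rw [fderiv_const_smul ((sp_differentiable g) x)]
        rfl }
    fun g h => by
      ext x
      show fderiv ℝ ((g : (Fin n → ℂ) → ℂ) * (h : (Fin n → ℂ) → ℂ)) x ξ = _
      rw [fderiv_mul ((sp_differentiable g) x) ((sp_differentiable h) x)]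
      rfl

lemma ddD_apply (ξ : Fin n → ℂ) (g : SP n) (x : Fin n → ℂ) :
    (ddD ξ g : (Fin n → ℂ) → ℂ) x = fderiv ℝ (g : (Fin n → ℂ) → ℂ) x ξ := rfl

lemma ddD_ddD_apply (ξ η : Fin n → ℂ) (g : SP n) (x : Fin n → ℂ) :
    (ddD ξ (ddD η g) : (Fin n → ℂ) → ℂ) x =
      fderiv ℝ (fderiv ℝ (g : (Fin n → ℂ) → ℂ)) x ξ η := by
  have h : DifferentiableAt ℝ (fderiv ℝ (g : (Fin n → ℂ) → ℂ)) x :=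
    (g.2.1.fderiv_right (m := ∞) (by simp)).differentiable (by simp) x
  rw [ddD_apply]
  show fderiv ℝ (fun y => fderiv ℝ (g : (Fin n → ℂ) → ℂ) y η) x ξ = _
  rw [fderiv_clm_apply h (differentiableAt_const η)]
  simp

lemma ddD_comm (ξ η : Fin n → ℂ) (g : SP n) : ddD ξ (ddD η g) = ddD η (ddD ξ g) := by
  ext x
  rw [ddD_ddD_apply, ddD_ddD_apply]
  exact (g.2.1.contDiffAt.isSymmSndFDerivAt (by rw [minSmoothness_of_isRCLikeNormedField]; exact WithTop.coe_le_coe.2 le_top)) ξ η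

lemma sp_integrable (g : SP n) : Integrable (g : (Fin n → ℂ) → ℂ) (volume.restrict (cell n)) := by
  obtain ⟨M, hM⟩ := (sp_exists_bound g)
  exact Integrable.of_bound (sp_continuous g).aestronglyMeasurable M (Eventually.of_forall hM)

/-- Integration over the fundamental domain. -/
def J (n : ℕ) : SP n →ₗ[ℂ] ℂ where
  toFun g := ∫ x in cell n, (g : (Fin n → ℂ) → ℂ) x
  map_add' g h := integral_add (sp_integrable g) (sp_integrable h)
  map_smul' c _ := integral_const_mul c _

lemma J_apply (g : SP n) : J n g = ∫ x in cell n, (g : (Fin n → ℂ) → ℂ) x := rfl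

lemma J_ddD (ξ : Fin n → ℂ) (g : SP n) : J n (ddD ξ g) = 0 := by
  obtain ⟨M, hM⟩ := (sp_exists_bound (ddD ξ g))
  have hF : ∀ t : ℝ, Continuous fun x => (g : (Fin n → ℂ) → ℂ) (x + t • ξ) := fun t =>
    (sp_continuous g).comp (by fun_prop)
  have h := hasDerivAt_integral_of_dominated_loc_of_deriv_le (μ := volume.restrict (cell n))
    (F := fun (t : ℝ) x => (g : (Fin n → ℂ) → ℂ) (x + t • ξ))
    (F' := fun t x => (ddD ξ g : (Fin n → ℂ) → ℂ) (x + t • ξ)) (x₀ := 0) (bound := fun _ => M)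
    univ_mem
    (Eventually.of_forall fun t => (hF t).aestronglyMeasurable)
    (by simpa using (sp_integrable g))
    (by simpa using (sp_integrable (ddD ξ g)).aestronglyMeasurable)
    (Eventually.of_forall fun x t _ => hM _) (integrable_const M)
    (Eventually.of_forall fun x t _ => by
      have e1 : HasDerivAt (fun t : ℝ => x + t • ξ) ξ t := by
        simpa using ((hasDerivAt_id t).smul_const ξ).const_add x
      exact ((sp_differentiable g) (x + t • ξ)).hasFDerivAt.comp_hasDerivAt t e1)
  have h2 := h.2
  simp only [setIntegral_cell_comp_add g.2.2] at h2
  have h3 := h2.unique (hasDerivAt_const _ _)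
  rw [J_apply]
  simpa using h3

/-- The standard basis vectors. -/
abbrev ev (a : Fin n) : Fin n → ℂ := Pi.single a 1

/-- The operator `∂/∂zₐ`. -/
def dz (a : Fin n) : Derivation ℂ (SP n) (SP n) :=
  (1 / 2 : ℂ) • (ddD (ev a) - I • ddD (I • ev a))

/-- The operator `∂/∂z̄ₐ`. -/
def dzb (a : Fin n) : Derivation ℂ (SP n) (SP n) :=
  (1 / 2 : ℂ) • (ddD (ev a) + I • ddD (I • ev a))

lemma J_dz (a : Fin n) (g : SP n) : J n (dz a g) = 0 := by
  simp [dz, J_ddD]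

lemma dz_comm (a b : Fin n) (g : SP n) : dz a (dz b g) = dz b (dz a g) := by
  simp only [dz, Derivation.smul_apply, Derivation.sub_apply, Derivation.map_smul, Derivation.map_sub,
    ddD_comm (ev a) (ev b), ddD_comm (ev a) (I • ev b), ddD_comm (I • ev a) (ev b),
    ddD_comm (I • ev a) (I • ev b)]
  module

lemma derivation_prod (D : Derivation ℂ (SP n) (SP n)) {ι : Type*} [DecidableEq ι] (s : Finset ι)
    (f : ι → SP n) : D (∏ k ∈ s, f k) = ∑ j ∈ s, (∏ k ∈ s.erase j, f k) * D (f j) := by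
  induction s using Finset.induction_on with
  | empty => simp
  | insert a s ha ih =>
    rw [Finset.prod_insert ha, Derivation.leibniz, ih, Finset.sum_insert ha,
      Finset.erase_insert ha, smul_eq_mul, smul_eq_mul, Finset.mul_sum, add_comm]
    congr 1
    refine Finset.sum_congr rfl fun j hj => ?_
    have hja : a ≠ j := fun h => ha (h ▸ hj)
    rw [Finset.erase_insert_of_ne hja, Finset.prod_insert (fun h => ha (Finset.mem_of_mem_erase h))]
    ring

/-- The complex Hessian of a smooth periodic function. -/
def HM (u : SP n) : Matrix (Fin n) (Fin n) (SP n) :=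
  Matrix.of fun a b => dz a (dzb b u)

/-- The matrix `∂ₐw ∂̄_b u`. -/
def GM (w u : SP n) : Matrix (Fin n) (Fin n) (SP n) :=
  Matrix.of fun a b => dz a w * dzb b u

lemma HM_apply (u : SP n) (a b : Fin n) : HM u a b = dz a (dzb b u) := rfl

lemma GM_apply (w u : SP n) (a b : Fin n) : GM w u a b = dz a w * dzb b u := rfl

lemma sum_sg_mul_dz_prod (T : Fin n → SP n) (i : Fin n) (τ : Equiv.Perm (Fin n)) :
    ∑ σ : Equiv.Perm (Fin n), (sg σ : SP n) *
      dz (σ i) (∏ k ∈ Finset.univ.erase i, (1 + HM (T k)) (σ k) (τ k)) = 0 := by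
  have hA : ∀ (a b c : Fin n) (u : SP n), dz c ((1 + HM u) a b) = dz c (dz a (dzb b u)) := by
    intro a b c u
    rw [Matrix.add_apply, map_add, Matrix.one_apply]
    have : dz c (if a = b then (1 : SP n) else 0) = 0 := by split_ifs <;> simp
    rw [this, zero_add]
    rfl
  simp only [derivation_prod, hA, Finset.mul_sum]
  rw [Finset.sum_comm]
  refine Finset.sum_eq_zero fun j hj => ?_
  have hji : j ≠ i := Finset.ne_of_mem_erase hj
  refine Finset.sum_involution (fun σ _ => σ * Equiv.swap i j) ?_ ?_ (fun _ _ => Finset.mem_univ _)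
    ?_
  · intro σ _
    have h1 : (sg (σ * Equiv.swap i j) : SP n) = -sg σ := by
      rw [sg_mul]
      simp [sg, Equiv.Perm.sign_swap hji.symm, -mul_neg]
      ring
    have h2 : ∏ k ∈ (Finset.univ.erase i).erase j, (1 + HM (T k)) ((σ * Equiv.swap i j) k) (τ k) =
        ∏ k ∈ (Finset.univ.erase i).erase j, (1 + HM (T k)) (σ k) (τ k) := by
      refine Finset.prod_congr rfl fun k hk => ?_
      have hkj := Finset.ne_of_mem_erase hk
      have hki := Finset.ne_of_mem_erase (Finset.mem_of_mem_erase hk)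
      rw [Equiv.Perm.mul_apply, Equiv.swap_apply_of_ne_of_ne hki hkj]
    rw [h1, h2]
    simp only [Equiv.Perm.mul_apply, Equiv.swap_apply_left, Equiv.swap_apply_right]
    rw [dz_comm (σ j) (σ i)]
    ring
  · intro σ _ _ h
    have := congrArg (fun ρ => (σ⁻¹ * ρ) i) h
    simp at this
    exact hji this
  · intro σ _
    simp [mul_assoc]

/-- Integration by parts. -/
lemma J_mul_Md_update_HM (w u : SP n) (T : Fin n → SP n) (i : Fin n) :
    J n (w * Md (Function.update (fun k => 1 + HM (T k)) i (HM u))) =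
      -J n (Md (Function.update (fun k => 1 + HM (T k)) i (GM w u))) := by
  rw [eq_neg_iff_add_eq_zero, ← map_add]
  have key : w * Md (Function.update (fun k => 1 + HM (T k)) i (HM u)) +
      Md (Function.update (fun k => 1 + HM (T k)) i (GM w u)) =
      ∑ σ : Equiv.Perm (Fin n), ∑ τ : Equiv.Perm (Fin n), (sg σ : SP n) * sg τ *
        dz (σ i) (w * dzb (τ i) u * ∏ k ∈ Finset.univ.erase i, (1 + HM (T k)) (σ k) (τ k)) := by
    have h0 : ∑ σ : Equiv.Perm (Fin n), ∑ τ : Equiv.Perm (Fin n), (sg σ : SP n) * sg τ *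
        (w * dzb (τ i) u * dz (σ i) (∏ k ∈ Finset.univ.erase i, (1 + HM (T k)) (σ k) (τ k))) =
        0 := by
      rw [Finset.sum_comm]
      refine Finset.sum_eq_zero fun τ _ => ?_
      have := sum_sg_mul_dz_prod T i τ
      calc _ = ∑ σ : Equiv.Perm (Fin n), sg τ * (w * dzb (τ i) u) * ((sg σ : SP n) *
            dz (σ i) (∏ k ∈ Finset.univ.erase i, (1 + HM (T k)) (σ k) (τ k))) :=
            Finset.sum_congr rfl fun σ _ => by ring
        _ = 0 := by rw [← Finset.mul_sum, this, mul_zero]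
    rw [Md_update, Md_update, Finset.mul_sum, ← Finset.sum_add_distrib,
      ← add_zero (Finset.sum _ _), ← h0, ← Finset.sum_add_distrib]
    refine Finset.sum_congr rfl fun σ _ => ?_
    rw [Finset.mul_sum, ← Finset.sum_add_distrib, ← Finset.sum_add_distrib]
    refine Finset.sum_congr rfl fun τ _ => ?_
    rw [Derivation.leibniz, Derivation.leibniz, HM_apply, GM_apply]
    simp only [smul_eq_mul]
    ring
  rw [key, map_sum]
  refine Finset.sum_eq_zero fun σ _ => ?_
  rw [map_sum]
  refine Finset.sum_eq_zero fun τ _ => ?_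
  have : ∀ g : SP n, (sg σ : SP n) * sg τ * g = ((sg σ : ℂ) * sg τ) • g := by
    intro g
    rw [Algebra.smul_def]
    simp [sg]
  rw [this, map_smul, J_dz, smul_zero]

/-- The sesquilinear form attached to a real bilinear form. -/
def hf (Q : (Fin n → ℂ) →L[ℝ] (Fin n → ℂ) →L[ℝ] ℝ) (v w : Fin n → ℂ) : ℂ :=
  1 / 4 * (Q v w + Q (I • v) (I • w) + I * (Q v (I • w) - Q (I • v) w))

lemma hf_smul (Q : (Fin n → ℂ) →L[ℝ] (Fin n → ℂ) →L[ℝ] ℝ) (c : ℂ) (v w : Fin n → ℂ) :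
    hf Q (c • v) w = c * hf Q v w := by
  have e1 : c • v = c.re • v + c.im • (I • v) := by
    ext i
    simp only [Pi.add_apply, Pi.smul_apply, real_smul, smul_eq_mul]
    linear_combination -(v i) * Complex.re_add_im c
  have e2 : I • I • v = -v := by rw [smul_smul, I_mul_I, neg_one_smul]
  have e3 : I • c • v = c.re • (I • v) - c.im • v := by
    rw [e1, smul_add, smul_comm I c.re, smul_comm I c.im, e2, smul_neg, sub_eq_add_neg]
  rw [hf, e3, e1]
  simp only [hf, map_add, map_sub, map_smul, add_apply, sub_apply, smul_apply, smul_eq_mul,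
    ofReal_add, ofReal_sub, ofReal_mul]
  conv_rhs => rw [← Complex.re_add_im c]
  linear_combination (-1 / 4 * c.im * ((Q v (I • w) : ℂ) - Q (I • v) w)) * I_mul_I

lemma hf_add (Q : (Fin n → ℂ) →L[ℝ] (Fin n → ℂ) →L[ℝ] ℝ) (v v' w : Fin n → ℂ) :
    hf Q (v + v') w = hf Q v w + hf Q v' w := by
  simp only [hf, smul_add, map_add, add_apply, ofReal_add]
  ring

lemma conj_hf {Q : (Fin n → ℂ) →L[ℝ] (Fin n → ℂ) →L[ℝ] ℝ} (hQ : ∀ v w, Q v w = Q w v)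
    (v w : Fin n → ℂ) : (starRingEnd ℂ) (hf Q v w) = hf Q w v := by
  simp only [hf, map_mul, map_add, map_sub, conj_ofReal, conj_I, map_div₀, map_one, map_ofNat]
  rw [hQ w v, hQ (I • w) (I • v), hQ w (I • v), hQ (I • w) v]
  ring

lemma hf_self {Q : (Fin n → ℂ) →L[ℝ] (Fin n → ℂ) →L[ℝ] ℝ} (hQ : ∀ v w, Q v w = Q w v)
    (v : Fin n → ℂ) : hf Q v v = lev Q v := by
  simp [hf, lev, hQ (I • v) v]

lemma hf_eq_sum (Q : (Fin n → ℂ) →L[ℝ] (Fin n → ℂ) →L[ℝ] ℝ) (v w : Fin n → ℂ) :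
    hf Q v w = ∑ a, v a * hf Q (ev a) w := by
  have := LinearMap.pi_apply_eq_sum_univ
    ({ toFun := fun v => hf Q v w
       map_add' := fun v v' => hf_add Q v v' w
       map_smul' := fun c v => hf_smul Q c v w } : (Fin n → ℂ) →ₗ[ℂ] ℂ) v
  simp only [LinearMap.coe_mk, AddHom.coe_mk, smul_eq_mul] at this
  rw [this]
  refine Finset.sum_congr rfl fun a _ => ?_
  congr 2
  ext i
  simp [Pi.single_apply, eq_comm]

/-- The complex matrix of a real bilinear form. -/
def cmat (Q : (Fin n → ℂ) →L[ℝ] (Fin n → ℂ) →L[ℝ] ℝ) : Matrix (Fin n) (Fin n) ℂ :=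
  Matrix.of fun a b => hf Q (ev a) (ev b)

lemma dotProduct_cmat {Q : (Fin n → ℂ) →L[ℝ] (Fin n → ℂ) →L[ℝ] ℝ} (hQ : ∀ v w, Q v w = Q w v)
    (ξ : Fin n → ℂ) : star ξ ⬝ᵥ ((1 + cmat Q).mulVec ξ) = ((lev Q (star ξ) + nsq (star ξ) : ℝ) : ℂ) := by
  rw [Matrix.add_mulVec, Matrix.one_mulVec, dotProduct_add, ofReal_add, ← hf_self hQ, add_comm]
  congr 1
  · rw [hf_eq_sum, dotProduct]
    refine Finset.sum_congr rfl fun a _ => ?_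
    congr 1
    rw [← conj_hf hQ, hf_eq_sum, map_sum, Matrix.mulVec, dotProduct]
    refine Finset.sum_congr rfl fun b _ => ?_
    rw [map_mul, conj_hf hQ, mul_comm]
    simp [cmat]
  · rw [dotProduct, nsq, ofReal_sum]
    refine Finset.sum_congr rfl fun a _ => ?_
    simp [Complex.conj_mul']

open scoped ComplexOrder in
lemma posSemidef_cmat {Q : (Fin n → ℂ) →L[ℝ] (Fin n → ℂ) →L[ℝ] ℝ} (hQ : ∀ v w, Q v w = Q w v)
    (h : ∀ v, 0 ≤ lev Q v + nsq v) : (1 + cmat Q).PosSemidef := by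
  refine Matrix.PosSemidef.of_dotProduct_mulVec_nonneg ?_ fun ξ => ?_
  · refine Matrix.isHermitian_one.add ?_
    ext a b
    exact conj_hf hQ _ _
  · rw [dotProduct_cmat hQ]
    exact_mod_cast h (star ξ)

lemma det_cmat_eq_zero {Q : (Fin n → ℂ) →L[ℝ] (Fin n → ℂ) →L[ℝ] ℝ} (hQ : ∀ v w, Q v w = Q w v)
    (h : ∀ v, 0 ≤ lev Q v + nsq v) {v : Fin n → ℂ} (hv : v ≠ 0) (hv0 : lev Q v + nsq v ≤ 0) :
    (1 + cmat Q).det = 0 := by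
  have h1 : star (star v) ⬝ᵥ ((1 + cmat Q).mulVec (star v)) = 0 := by
    rw [dotProduct_cmat hQ, star_star, le_antisymm hv0 (h v), ofReal_zero]
  have h2 := ((posSemidef_cmat hQ h).dotProduct_mulVec_zero_iff (star v)).1 h1
  exact Matrix.exists_mulVec_eq_zero_iff.1 ⟨star v, star_ne_zero.2 hv, h2⟩

/-- Evaluation at a point. -/
def evAt (x : Fin n → ℂ) : SP n →+* ℂ := (Pi.evalRingHom _ x).comp (SP n).val.toRingHom

lemma evAt_apply (x : Fin n → ℂ) (g : SP n) : evAt x g = (g : (Fin n → ℂ) → ℂ) x := rfl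

/-- A real smooth periodic function as an element of `SP n`. -/
def toSP (f : (Fin n → ℂ) → ℝ) (hf : ContDiff ℝ ∞ f) (hper : Per f) : SP n :=
  ⟨fun x => (f x : ℂ), Complex.ofRealCLM.contDiff.comp hf, hper.comp _⟩

lemma ddD_toSP {f : (Fin n → ℂ) → ℝ} (hf : ContDiff ℝ ∞ f) (hper : Per f) (ξ x : Fin n → ℂ) :
    (ddD ξ (toSP f hf hper) : (Fin n → ℂ) → ℂ) x = ((fderiv ℝ f x ξ : ℝ) : ℂ) := by
  rw [ddD_apply]
  have h := Complex.ofRealCLM.hasFDerivAt.comp x (hf.differentiable (by simp) x).hasFDerivAt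
  exact DFunLike.congr_fun h.fderiv ξ

lemma hess_eq {f : (Fin n → ℂ) → ℝ} (hf : ContDiff ℝ ∞ f) (ξ η x : Fin n → ℂ) :
    hess f x ξ η = fderiv ℝ (fun y => fderiv ℝ f y η) x ξ := by
  have h : DifferentiableAt ℝ (fderiv ℝ f) x :=
    (hf.fderiv_right (m := ∞) (by simp)).differentiable (by simp) x
  rw [fderiv_clm_apply h (differentiableAt_const η)]
  simp

lemma hess_symm {f : (Fin n → ℂ) → ℝ} (hf : ContDiff ℝ ∞ f) (x ξ η : Fin n → ℂ) :
    hess f x ξ η = hess f x η ξ :=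
  (hf.contDiffAt.isSymmSndFDerivAt (by
    rw [minSmoothness_of_isRCLikeNormedField]; exact WithTop.coe_le_coe.2 le_top)) ξ η

lemma ddD_ddD_toSP {f : (Fin n → ℂ) → ℝ} (hf : ContDiff ℝ ∞ f) (hper : Per f)
    (ξ η x : Fin n → ℂ) :
    (ddD ξ (ddD η (toSP f hf hper)) : (Fin n → ℂ) → ℂ) x = ((hess f x ξ η : ℝ) : ℂ) := by
  have h1 : ContDiff ℝ ∞ fun y => fderiv ℝ f y η :=
    (hf.fderiv_right (m := ∞) (by simp)).clm_apply contDiff_const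
  rw [hess_eq hf, ddD_apply]
  have h2 : (ddD η (toSP f hf hper) : (Fin n → ℂ) → ℂ) = fun y => ((fderiv ℝ f y η : ℝ) : ℂ) :=
    funext fun y => ddD_toSP hf hper η y
  rw [h2]
  have h := Complex.ofRealCLM.hasFDerivAt.comp x (h1.differentiable (by simp) x).hasFDerivAt
  exact DFunLike.congr_fun h.fderiv ξ

lemma evAt_HM {f : (Fin n → ℂ) → ℝ} (hf : ContDiff ℝ ∞ f) (hper : Per f) (x : Fin n → ℂ) :
    (1 + HM (toSP f hf hper)).map (evAt x) = 1 + cmat (hess f x) := by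
  rw [Matrix.map_add _ (map_add _), Matrix.map_one _ (map_zero _) (map_one _)]
  congr 1
  ext a b
  simp only [Matrix.map_apply, HM_apply, cmat, Matrix.of_apply, RelExt.hf, evAt_apply,
    ← ddD_ddD_toSP hf hper, dz, dzb, Derivation.smul_apply, Derivation.sub_apply,
    Derivation.add_apply, Derivation.map_smul, Derivation.map_add, Subalgebra.coe_smul,
    Subalgebra.coe_sub, Subalgebra.coe_add, Pi.smul_apply, Pi.add_apply, Pi.sub_apply, smul_eq_mul]
  linear_combination (-1 / 4 * (ddD (I • ev a) (ddD (I • ev b) (toSP f hf hper)) : (Fin n → ℂ) → ℂ) x)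
    * I_mul_I

/-- Smooth functions in the class `QP`. -/
structure GF (n : ℕ) where
  /-- the underlying function -/
  toFun : (Fin n → ℂ) → ℝ
  smooth : ContDiff ℝ ∞ toFun
  qp : QP toFun

instance : CoeFun (GF n) fun _ => (Fin n → ℂ) → ℝ := ⟨GF.toFun⟩

/-- Constant functions. -/
def GF.const (n : ℕ) (c : ℝ) : GF n := ⟨fun _ => c, contDiff_const, QP.const c⟩

instance : Zero (GF n) := ⟨GF.const n 0⟩

lemma GF.zero_apply (x : Fin n → ℂ) : (0 : GF n) x = 0 := rfl

lemma GF.const_apply (c : ℝ) (x : Fin n → ℂ) : GF.const n c x = c := rfl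

/-- A member of `GF n` as an element of the algebra `SP n`. -/
def GF.sp (f : GF n) : SP n := toSP f f.smooth f.qp.per

lemma GF.lev_nonneg (f : GF n) (x v : Fin n → ℂ) : 0 ≤ lev (hess f x) v + nsq v :=
  QP.lev_nonneg f.qp (isLittleO_hess f.smooth x) v

open scoped ComplexOrder in
lemma GF.posSemidef (f : GF n) (x : Fin n → ℂ) : ((1 + HM f.sp).map (evAt x)).PosSemidef := by
  rw [GF.sp, evAt_HM]
  exact posSemidef_cmat (hess_symm f.smooth x) (f.lev_nonneg x)

lemma GF.isHermitian (f : GF n) (x : Fin n → ℂ) : ((1 + HM f.sp).map (evAt x)).IsHermitian := by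
  open scoped ComplexOrder in exact (f.posSemidef x).isHermitian

lemma HM_sub (a b : SP n) : HM (a - b) = HM a - HM b := by
  ext i j
  simp [HM_apply]

/-- Elements of `SP n` with real derivatives. -/
def RD (w : SP n) : Prop :=
  ∀ ξ x, (starRingEnd ℂ) ((ddD ξ w : (Fin n → ℂ) → ℂ) x) = (ddD ξ w : (Fin n → ℂ) → ℂ) x

lemma GF.rd (f : GF n) : RD f.sp := fun ξ x => by
  rw [GF.sp, ddD_toSP, conj_ofReal]

lemma RD.add {a b : SP n} (ha : RD a) (hb : RD b) : RD (a + b) := fun ξ x => by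
  rw [map_add, Subalgebra.coe_add, Pi.add_apply, map_add, ha, hb]

lemma RD.sub {a b : SP n} (ha : RD a) (hb : RD b) : RD (a - b) := fun ξ x => by
  rw [map_sub, AddSubgroupClass.coe_sub, Pi.sub_apply, map_sub, ha, hb]

lemma RD.smul {a : SP n} (ha : RD a) (t : ℝ) : RD ((t : ℂ) • a) := fun ξ x => by
  rw [Derivation.map_smul, Subalgebra.coe_smul, Pi.smul_apply, smul_eq_mul, map_mul, ha, conj_ofReal]
lemma evAt_dzb {w : SP n} (hw : RD w) (a : Fin n) (x : Fin n → ℂ) :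
    evAt x (dzb a w) = (starRingEnd ℂ) (evAt x (dz a w)) := by
  have h1 : evAt x (dzb a w) = 1 / 2 * ((ddD (ev a) w : (Fin n → ℂ) → ℂ) x +
    I * (ddD (I • ev a) w : (Fin n → ℂ) → ℂ) x) := rfl
  have h2 : evAt x (dz a w) = 1 / 2 * ((ddD (ev a) w : (Fin n → ℂ) → ℂ) x -
    I * (ddD (I • ev a) w : (Fin n → ℂ) → ℂ) x) := rfl
  rw [h1, h2]
  have e1 := hw (ev a) x
  have e2 := hw (I • ev a) x
  simp only [map_mul, map_sub, e1, e2, conj_I, map_div₀, map_one, map_ofNat]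
  ring

/-- The polarized Dirichlet form `∫ w ddᶜu ∧ T`. -/
def SF (T : Fin n → GF n) (i : Fin n) (w u : SP n) : ℝ :=
  (J n (w * Md (Function.update (fun k => 1 + HM (T k).sp) i (HM u)))).re

lemma SF_eq (T : Fin n → GF n) (i : Fin n) (w u : SP n) :
    SF T i w u = -∫ x in cell n, (Md (Function.update
      (fun k => (1 + HM (T k).sp).map (evAt x)) i ((GM w u).map (evAt x)))).re := by
  have h1 : ∀ x, (Md (Function.update (fun k => (1 + HM (T k).sp).map (evAt x)) i
      ((GM w u).map (evAt x)))) = evAt x (Md (Function.update (fun k => 1 + HM (T k).sp) i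
        (GM w u))) := by
    intro x
    rw [Md_map]
    congr 1
    ext1 k
    by_cases hk : k = i
    · subst hk; simp
    · simp [hk]
  unfold SF
  rw [J_mul_Md_update_HM w u (fun k => (T k).sp) i, neg_re, J_apply]
  simp only [h1]
  congr 1
  exact (integral_re (𝕜 := ℂ) (sp_integrable (Md (Function.update
    (fun k => 1 + HM (T k).sp) i (GM w u))))).symm

lemma SF_symm (T : Fin n → GF n) (i : Fin n) {w u : SP n} (hw : RD w) (hu : RD u) :
    SF T i w u = SF T i u w := by
  rw [SF_eq, SF_eq]
  congr 2
  ext x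
  rw [← Md_transpose, ← conj_re, Md_map (starRingEnd ℂ)]
  congr 2
  ext1 k
  by_cases hk : k = i
  · subst hk
    simp only [Function.update_self]
    ext a b
    simp only [Matrix.map_apply, Matrix.transpose_apply, GM_apply, map_mul, evAt_dzb hw,
      evAt_dzb hu, conj_conj]
    ring
  · simp only [Function.update_of_ne hk]
    have := (T k).isHermitian x
    ext a b
    have h2 := congrFun (congrFun this a) b
    simpa using h2

open scoped ComplexOrder in
lemma SF_self_nonpos (T : Fin n → GF n) (i : Fin n) {w : SP n} (hw : RD w) :
    SF T i w w ≤ 0 := by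
  rw [SF_eq, neg_nonpos]
  refine integral_nonneg fun x => Md_re_nonneg fun k => ?_
  by_cases hk : k = i
  · subst hk
    simp only [Function.update_self]
    have : (GM w w).map (evAt x) = Matrix.vecMulVec (fun a => evAt x (dz a w))
        (star fun a => evAt x (dz a w)) := by
      ext a b
      simp [GM_apply, Matrix.vecMulVec_apply, evAt_dzb hw]
    rw [this]
    exact Matrix.posSemidef_vecMulVec_self_star _
  · simp only [Function.update_of_ne hk]
    exact (T k).posSemidef x

lemma SF_add_left (T : Fin n → GF n) (i : Fin n) (a b u : SP n) :
    SF T i (a + b) u = SF T i a u + SF T i b u := by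
  simp only [SF, add_mul, map_add, add_re]

lemma SF_smul_left (T : Fin n → GF n) (i : Fin n) (t : ℝ) (a u : SP n) :
    SF T i ((t : ℂ) • a) u = t * SF T i a u := by
  simp only [SF, smul_mul_assoc, map_smul, smul_eq_mul, re_ofReal_mul]

/-- The Cauchy-Schwarz inequality for the Dirichlet form. -/
lemma SF_sq_le (T : Fin n → GF n) (i : Fin n) {a b : SP n} (ha : RD a) (hb : RD b) :
    SF T i a b ^ 2 ≤ SF T i a a * SF T i b b := by
  have hR : ∀ t : ℝ, RD ((t : ℂ) • a + b) := fun t => (ha.smul t).add hb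
  have key : ∀ t : ℝ, 0 ≤ (-SF T i a a) * (t * t) + (-2 * SF T i a b) * t + (-SF T i b b) := by
    intro t
    have h := SF_self_nonpos T i (hR t)
    rw [SF_add_left, SF_smul_left, SF_symm T i ha (hR t), SF_symm T i hb (hR t), SF_add_left,
      SF_add_left, SF_smul_left, SF_smul_left, SF_symm T i hb ha] at h
    linarith
  have := discrim_le_zero key
  rw [discrim] at this
  linarith

/-- The family indexed by `Fin n` given by a list. -/
def fam (l : List (GF n)) (k : Fin n) : GF n := l.getD k 0

/-- The mixed Monge-Ampère density of a list as an element of `SP n`. -/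
def MAs (l : List (GF n)) : SP n := Md fun k => 1 + HM (fam l k).sp

/-- The mixed Monge-Ampère density of a list. -/
def MA (l : List (GF n)) (x : Fin n → ℂ) : ℝ := ((MAs l : (Fin n → ℂ) → ℂ) x).re

/-- Integration against the mixed Monge-Ampère measure. -/
def pr (w : (Fin n → ℂ) → ℝ) (l : List (GF n)) : ℝ := ∫ x in cell n, w x * MA l x

lemma continuous_MA (l : List (GF n)) : Continuous (MA l) :=
  continuous_re.comp (sp_continuous (MAs l))

lemma per_MA (l : List (GF n)) : Per (MA l) := (MAs l).2.2.comp _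

open scoped ComplexOrder in
lemma MA_nonneg (l : List (GF n)) (x : Fin n → ℂ) : 0 ≤ MA l x := by
  show 0 ≤ (evAt x (MAs l)).re
  rw [MAs, Md_map]
  exact Md_re_nonneg fun k => (fam l k).posSemidef x

lemma exists_perm_comp_eq {α : Type*} {f g : Fin n → α}
    (h : Multiset.map f Finset.univ.val = Multiset.map g Finset.univ.val) :
    ∃ σ : Equiv.Perm (Fin n), ∀ k, g (σ k) = f k := by
  classical
  have hc : ∀ c, Nonempty ({k // f k = c} ≃ {k // g k = c}) := by
    intro c
    rw [← Fintype.card_eq, Fintype.card_subtype, Fintype.card_subtype]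
    have := congrArg (Multiset.count c) h
    rw [Multiset.count_map, Multiset.count_map] at this
    simpa [Finset.card_def, eq_comm] using this
  exact ⟨Equiv.ofFiberEquiv fun c => (hc c).some, fun k => Equiv.ofFiberEquiv_map _ k⟩

lemma MAs_perm {l l' : List (GF n)} (h : l.Perm l') (hl : l.length = n) : MAs l = MAs l' := by
  have key : ∀ l : List (GF n), l.length = n → List.ofFn (fam l) = l := by
    intro l hl
    refine List.ext_getElem (by simp [hl]) fun i h1 h2 => ?_
    simp [fam, h2]
  have h2 : Multiset.map (fam l) Finset.univ.val = Multiset.map (fam l') Finset.univ.val := by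
    rw [Fin.univ_val_map, Fin.univ_val_map, key l hl, key l' (h.length_eq ▸ hl)]
    exact Multiset.coe_eq_coe.2 h
  obtain ⟨σ, hσ⟩ := exists_perm_comp_eq h2
  unfold MAs
  rw [← Md_perm (fun k => 1 + HM (fam l' k).sp) σ]
  simp only [hσ]

lemma pr_perm (w : (Fin n → ℂ) → ℝ) {l l' : List (GF n)} (h : l.Perm l') (hl : l.length = n) :
    pr w l = pr w l' := by
  unfold pr MA
  rw [MAs_perm h hl]

lemma MA_replicate (f : GF n) (x : Fin n → ℂ) :
    MA (List.replicate n f) x = n.factorial * ((1 + cmat (hess f x)).det).re := by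
  have h : MAs (List.replicate n f) = Md fun _ => 1 + HM f.sp := by
    unfold MAs
    congr 1
    ext1 k
    simp [fam]
  show (evAt x (MAs (List.replicate n f))).re = _
  rw [h, Md_map, Md_const, GF.sp, evAt_HM]
  rw [← ofReal_natCast, re_ofReal_mul]

lemma HM_const (c : ℝ) : HM (GF.const n c).sp = 0 := by
  ext a b : 2
  have : (GF.const n c).sp = algebraMap ℂ (SP n) c := rfl
  rw [HM_apply, this, Derivation.map_algebraMap, map_zero]
  rfl

lemma MA_replicate_zero (x : Fin n → ℂ) : MA (List.replicate n 0) x = n.factorial := by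
  have h : MAs (List.replicate n 0) = Md fun _ : Fin n => (1 : Matrix (Fin n) (Fin n) (SP n)) := by
    unfold MAs
    congr 1
    ext1 k
    have : fam (List.replicate n 0) k = GF.const n 0 := by simp [fam]; rfl
    rw [this, HM_const, add_zero]
  show (evAt x (MAs (List.replicate n 0))).re = _
  rw [h, Md_const, Matrix.det_one, mul_one, map_natCast, natCast_re]

lemma integrable_mul_MA {w : (Fin n → ℂ) → ℝ} (hw : BM w) (l : List (GF n)) :
    IntegrableOn (fun x => w x * MA l x) (cell n) := by
  obtain ⟨M, hM⟩ := (per_MA l).exists_bound (continuous_MA l)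
  exact (hw.integrableOn_cell).mul_bdd (c := M) (continuous_MA l).aestronglyMeasurable
    (.of_forall hM)

lemma pr_add {w w' : (Fin n → ℂ) → ℝ} (hw : BM w) (hw' : BM w') (l : List (GF n)) :
    pr (fun x => w x + w' x) l = pr w l + pr w' l := by
  unfold pr
  rw [← integral_add (integrable_mul_MA hw l) (integrable_mul_MA hw' l)]
  simp only [add_mul]

lemma pr_sub {w w' : (Fin n → ℂ) → ℝ} (hw : BM w) (hw' : BM w') (l : List (GF n)) :
    pr (fun x => w x - w' x) l = pr w l - pr w' l := by
  unfold pr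
  rw [← integral_sub (integrable_mul_MA hw l) (integrable_mul_MA hw' l)]
  simp only [sub_mul]

lemma pr_const_mul (c : ℝ) (w : (Fin n → ℂ) → ℝ) (l : List (GF n)) :
    pr (fun x => c * w x) l = c * pr w l := by
  unfold pr
  rw [← integral_const_mul]
  simp only [mul_assoc]

lemma pr_mono {w w' : (Fin n → ℂ) → ℝ} (hw : BM w) (hw' : BM w') (h : ∀ x, w x ≤ w' x)
    (l : List (GF n)) : pr w l ≤ pr w' l :=
  integral_mono (integrable_mul_MA hw l) (integrable_mul_MA hw' l) fun x =>
    mul_le_mul_of_nonneg_right (h x) (MA_nonneg l x)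

lemma GF.bm (f : GF n) : BM f := f.qp.bm

lemma fam_cons (f : GF n) (P : List (GF n)) (hn : 0 < n) :
    (fun k => 1 + HM (fam (f :: P) k).sp) =
      Function.update (fun k => 1 + HM (fam (0 :: P) k).sp) ⟨0, hn⟩ (1 + HM f.sp) := by
  ext1 k
  rcases k with ⟨k, hk⟩
  rcases k with _ | k
  · rw [Function.update_self]; rfl
  · rw [Function.update_of_ne (by simp)]; rfl

lemma pr_cons_sub_pr_cons (hn : 0 < n) (u v f g : GF n) (P : List (GF n)) :
    pr (fun x => u x - v x) (f :: P) - pr (fun x => u x - v x) (g :: P) =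
      SF (fam (0 :: P)) ⟨0, hn⟩ (u.sp - v.sp) (f.sp - g.sp) := by
  have h1 : ∀ l : List (GF n), pr (fun x => u x - v x) l = (J n ((u.sp - v.sp) * MAs l)).re := by
    intro l
    have h2 := integral_re (𝕜 := ℂ) (sp_integrable ((u.sp - v.sp) * MAs l))
    rw [J_apply]
    refine Eq.trans ?_ h2
    unfold pr
    congr 1
    ext x
    have : ((((u.sp - v.sp) * MAs l : SP n)) : (Fin n → ℂ) → ℂ) x =
      ((u x - v x : ℝ) : ℂ) * (MAs l : (Fin n → ℂ) → ℂ) x := by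
      rw [ofReal_sub]; rfl
    rw [this]
    exact (re_ofReal_mul _ _).symm
  have h3 : MAs (f :: P) - MAs (g :: P) = Md (Function.update
      (fun k => 1 + HM (fam (0 :: P) k).sp) ⟨0, hn⟩ (HM (f.sp - g.sp))) := by
    unfold MAs
    rw [fam_cons f P hn, fam_cons g P hn, sub_eq_iff_eq_add, ← Md_update_add, HM_sub]
    congr 2
    abel
  rw [h1, h1, ← sub_re, ← map_sub, ← mul_sub, h3]
  rfl

/-- Symmetry of the mixed Monge-Ampère pairing. -/
lemma pr_swap (hn : 0 < n) (u v f g : GF n) (P : List (GF n)) :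
    pr (fun x => u x - v x) (f :: P) - pr (fun x => u x - v x) (g :: P) =
      pr (fun x => f x - g x) (u :: P) - pr (fun x => f x - g x) (v :: P) := by
  rw [pr_cons_sub_pr_cons hn, pr_cons_sub_pr_cons hn, SF_symm _ _ (u.rd.sub v.rd) (f.rd.sub g.rd)]

lemma MAs_const_cons (hn : 0 < n) (c : ℝ) (P : List (GF n)) :
    MAs (GF.const n c :: P) = MAs (0 :: P) := by
  unfold MAs
  have h0 : HM (0 : GF n).sp = 0 := HM_const 0
  rw [fam_cons (GF.const n c) P hn, fam_cons 0 P hn, HM_const, h0, Function.update_idem]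

lemma pr_one_cons (hn : 0 < n) (f : GF n) (P : List (GF n)) :
    pr (fun _ => 1) (f :: P) = pr (fun _ => 1) (0 :: P) := by
  have h := pr_swap hn (GF.const n 1) 0 f 0 P
  simp only [GF.const_apply, GF.zero_apply, sub_zero] at h
  have h2 : pr (fun x => f x) (GF.const n 1 :: P) = pr (fun x => f x) (0 :: P) := by
    unfold pr MA
    rw [MAs_const_cons hn]
  linarith

/-- The total mass of the mixed Monge-Ampère measures. -/
def mass (n : ℕ) : ℝ := pr (fun _ : Fin n → ℂ => 1) (List.replicate n 0)

lemma mass_eq : mass n = n.factorial * volume.real (cell n) := by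
  unfold mass pr
  simp only [MA_replicate_zero, one_mul]
  rw [setIntegral_const, smul_eq_mul, mul_comm]

lemma mass_pos : 0 < mass n := by
  rw [mass_eq]
  exact mul_pos (by exact_mod_cast n.factorial_pos) volReal_cell_pos

lemma pr_one {l : List (GF n)} (hl : l.length = n) : pr (fun _ => 1) l = mass n := by
  have key : ∀ k : ℕ, ∀ l : List (GF n), l.length + k = n →
      pr (fun _ => 1) (l ++ List.replicate k 0) = mass n := by
    intro k l
    induction l generalizing k with
    | nil => intro h; simp only [List.length_nil, zero_add] at h; subst h; rfl
    | cons f l ih =>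
      intro h
      rw [List.length_cons] at h
      rw [List.cons_append, pr_one_cons (by omega)]
      rw [← ih (k + 1) (by omega)]
      refine pr_perm _ ?_ (by simp; omega)
      rw [List.replicate_succ]
      exact (List.perm_middle).symm
  have := key 0 l hl
  simpa using this

lemma pr_const {l : List (GF n)} (hl : l.length = n) (c : ℝ) : pr (fun _ => c) l = c * mass n := by
  rw [← pr_one hl, ← pr_const_mul]
  simp

lemma pr_replicate_zero (w : (Fin n → ℂ) → ℝ) :
    pr w (List.replicate n 0) = n.factorial * ∫ x in cell n, w x := by
  unfold pr
  simp only [MA_replicate_zero]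
  rw [integral_mul_const, mul_comm]

lemma le_pr {l : List (GF n)} (hl : l.length = n) {w : (Fin n → ℂ) → ℝ} (hw : BM w) {c : ℝ}
    (h : ∀ x, c ≤ w x) : c * mass n ≤ pr w l := by
  rw [← pr_const hl]
  exact pr_mono (BM.const c) hw h l

lemma pr_le {l : List (GF n)} (hl : l.length = n) {w : (Fin n → ℂ) → ℝ} (hw : BM w) {c : ℝ}
    (h : ∀ x, w x ≤ c) : pr w l ≤ c * mass n := by
  rw [← pr_const hl]
  exact pr_mono hw (BM.const c) h l

/-- Smallness of `∫ (f - g) MA(g, …, g)` propagates to all mixed Monge-Ampère measures. -/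
lemma exists_pr_sub_le (M : ℝ) (i : ℕ) : i ≤ n → ∀ ε > 0, ∃ δ > 0, ∀ f g : GF n,
    (∀ x, |f x| ≤ M) → (∀ x, |g x| ≤ M) → (∀ x, g x - δ ≤ f x) →
    pr (fun x => f x - g x) (List.replicate n g) ≤ δ → ∀ p : List (GF n), p.length = i →
    (∀ q ∈ p, ∀ x, |q x| ≤ M) →
    pr (fun x => f x - g x) (p ++ List.replicate (n - i) g) ≤ ε := by
  induction i with
  | zero =>
    intro _ ε hε
    refine ⟨ε, hε, fun f g _ _ _ h p hp _ => ?_⟩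
    obtain rfl := List.length_eq_zero_iff.1 hp
    simpa using h
  | succ i ih =>
    intro hi ε hε
    have hm := mass_pos (n := n)
    set K : ℝ := 4 * |M| * mass n + 1 with hK
    have hK0 : 0 < K := by positivity
    set c : ℝ := (ε / 2) ^ 2 / K with hc
    have hc0 : 0 < c := by positivity
    obtain ⟨δ₁, hδ₁, H⟩ := ih (by omega) (min (ε / 2) (c / 2)) (by positivity)
    refine ⟨min δ₁ (c / 2 / mass n), by positivity, fun f g hf hg hfg h p hp hq => ?_⟩
    set δ := min δ₁ (c / 2 / mass n)
    have hδm : δ * mass n ≤ c / 2 := (le_div_iff₀ hm).1 (min_le_right _ _)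
    obtain ⟨q, p', rfl⟩ := List.exists_cons_of_length_eq_add_one hp
    rw [List.length_cons] at hp
    have hn : 0 < n := by omega
    set P := p' ++ List.replicate (n - (i + 1)) g with hP
    have hPl : ∀ a : GF n, (a :: P).length = n := fun a => by simp [hP]; omega
    have hX := H f g hf hg (fun x => (by have := hfg x; have := min_le_left δ₁ (c / 2 / mass n); linarith))
      (h.trans (min_le_left _ _)) p' (by omega) fun a ha => hq a (List.mem_cons_of_mem _ ha)
    have hperm : (p' ++ List.replicate (n - i) g).Perm (g :: P) := by
      rw [show n - i = (n - (i + 1)) + 1 by omega, List.replicate_succ]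
      exact List.perm_middle
    rw [pr_perm _ hperm (by simp; omega)] at hX
    have e1 := pr_cons_sub_pr_cons hn f g q g P
    have e2 := pr_cons_sub_pr_cons hn f g f g P
    have e3 := pr_cons_sub_pr_cons hn q g q g P
    have hqM : ∀ x, |q x| ≤ M := hq q List.mem_cons_self
    have b1 := le_pr (hPl f) (f.bm.sub g.bm) (c := -δ) (fun x => by linarith [hfg x])
    have b2 := pr_le (hPl g) (q.bm.sub g.bm) (c := 2 * |M|) (fun x => by
      linarith [abs_le.1 (hqM x), abs_le.1 (hg x), le_abs_self M])
    have b3 := le_pr (hPl q) (q.bm.sub g.bm) (c := -(2 * |M|)) (fun x => by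
      linarith [abs_le.1 (hqM x), abs_le.1 (hg x), le_abs_self M])
    have hCS := SF_sq_le (fam (0 :: P)) ⟨0, hn⟩ (f.rd.sub g.rd) (q.rd.sub g.rd)
    have n1 := SF_self_nonpos (fam (0 :: P)) ⟨0, hn⟩ (f.rd.sub g.rd)
    have n2 := SF_self_nonpos (fam (0 :: P)) ⟨0, hn⟩ (q.rd.sub g.rd)
    rw [List.cons_append]
    set s11 := SF (fam (0 :: P)) ⟨0, hn⟩ (f.sp - g.sp) (f.sp - g.sp)
    set s22 := SF (fam (0 :: P)) ⟨0, hn⟩ (q.sp - g.sp) (q.sp - g.sp)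
    set s12 := SF (fam (0 :: P)) ⟨0, hn⟩ (f.sp - g.sp) (q.sp - g.sp)
    have m1 : pr (fun x => f x - g x) (g :: P) ≤ ε / 2 := hX.trans (min_le_left _ _)
    have m2 : pr (fun x => f x - g x) (g :: P) ≤ c / 2 := hX.trans (min_le_right _ _)
    have u1 : -s11 ≤ c := by linarith
    have u2 : -s22 ≤ K := by linarith
    have u3 : s12 ^ 2 ≤ (ε / 2) ^ 2 := by
      calc s12 ^ 2 ≤ (-s11) * (-s22) := by linarith
        _ ≤ c * K := mul_le_mul u1 u2 (by linarith) hc0.le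
        _ = (ε / 2) ^ 2 := div_mul_cancel₀ _ hK0.ne'
    have u4 : s12 ≤ ε / 2 := abs_le_of_sq_le_sq' u3 (by positivity) |>.2
    linarith

lemma exists_pr_sub_le_of_length_eq (M : ℝ) {ε : ℝ} (hε : 0 < ε) : ∃ δ > 0, ∀ f g : GF n,
    (∀ x, |f x| ≤ M) → (∀ x, |g x| ≤ M) → (∀ x, g x - δ ≤ f x) →
    pr (fun x => f x - g x) (List.replicate n g) ≤ δ → ∀ p : List (GF n), p.length = n →
    (∀ q ∈ p, ∀ x, |q x| ≤ M) → pr (fun x => f x - g x) p ≤ ε := by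
  obtain ⟨δ, hδ, H⟩ := exists_pr_sub_le (n := n) M n le_rfl ε hε
  refine ⟨δ, hδ, fun f g hf hg hfg h p hp hq => ?_⟩
  simpa using H f g hf hg hfg h p hp hq

/-- The polarized Monge-Ampère energy, normalized by `z` leading zeros. -/
def En : ℕ → List (GF n) → ℝ
  | _, [] => 0
  | z, f :: l => pr f (List.replicate z 0 ++ l) + En (z + 1) l

lemma En_perm {l l' : List (GF n)} (h : l.Perm l') :
    ∀ z, z + l.length = n + 1 → En z l = En z l' := by
  induction h with
  | nil => intro z _; rfl
  | @cons f l l' h ih =>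
    intro z hz
    rw [List.length_cons] at hz
    rw [En, En, ih (z + 1) (by omega), pr_perm _ (h.append_left _) (by simp; omega)]
  | swap f g l =>
    intro z hz
    simp only [List.length_cons] at hz
    have hn : 0 < n := by omega
    have key := pr_swap hn f 0 g 0 (List.replicate z 0 ++ l)
    simp only [GF.zero_apply, sub_zero] at key
    have hp : ∀ (w : (Fin n → ℂ) → ℝ) (a : GF n), pr w (List.replicate z 0 ++ a :: l) =
        pr w (a :: (List.replicate z 0 ++ l)) := fun w a =>
      pr_perm w List.perm_middle (by simp; omega)
    simp only [En]
    rw [hp, hp, List.replicate_succ, List.cons_append]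
    linarith
  | trans h1 _ ih1 ih2 =>
    intro z hz
    rw [ih1 z hz, ih2 z (h1.length_eq ▸ hz)]

lemma abs_En_le {M : ℝ} (l : List (GF n)) (hl : ∀ f ∈ l, ∀ x, |f x| ≤ M) :
    ∀ z, z + l.length = n + 1 → |En z l| ≤ l.length * (M * mass n) := by
  induction l with
  | nil => intro z _; simp [En]
  | cons f l ih =>
    intro z hz
    rw [List.length_cons] at hz
    have h1 := ih (fun g hg => hl g (List.mem_cons_of_mem _ hg)) (z + 1) (by omega)
    have hlen : (List.replicate z 0 ++ l : List (GF n)).length = n := by simp; omega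
    have hf := hl f List.mem_cons_self
    have h2 := pr_le hlen f.bm (fun x => (abs_le.1 (hf x)).2)
    have h3 := le_pr hlen f.bm (fun x => (abs_le.1 (hf x)).1)
    have h4 : |pr f (List.replicate z 0 ++ l)| ≤ M * mass n := abs_le.2 ⟨by linarith, h2⟩
    rw [En, List.length_cons]
    push_cast
    calc _ ≤ _ := abs_add_le _ _
      _ ≤ _ := add_le_add h4 h1
      _ = _ := by ring

lemma En_cons_sub (f g : GF n) (l : List (GF n)) (z : ℕ) :
    En z (f :: l) - En z (g :: l) = pr (fun x => f x - g x) (List.replicate z 0 ++ l) := by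
  rw [En, En, pr_sub f.bm g.bm]
  ring

/-- The Monge-Ampère energy. -/
def energy (f : GF n) : ℝ := En 0 (List.replicate (n + 1) f)

lemma energy_sub (f g : GF n) : energy f - energy g = ∑ i ∈ Finset.range (n + 1),
    pr (fun x => f x - g x) (List.replicate i f ++ List.replicate (n - i) g) := by
  have h := Finset.sum_range_sub
    (fun i => En 0 (List.replicate i f ++ List.replicate (n + 1 - i) g)) (n + 1)
  simp only [List.replicate_zero, List.nil_append, Nat.sub_self, List.append_nil, Nat.sub_zero] at h
  rw [energy, energy, ← h]
  refine Finset.sum_congr rfl fun i hi => ?_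
  have hi : i ≤ n := by simpa [Nat.lt_succ_iff] using hi
  rw [show n + 1 - i = (n - i) + 1 by omega, show n + 1 - (i + 1) = n - i by omega]
  have e1 : En 0 (List.replicate i f ++ List.replicate (n - i + 1) g) =
      En 0 (g :: (List.replicate i f ++ List.replicate (n - i) g)) := by
    refine En_perm ?_ 0 (by simp; omega)
    rw [List.replicate_succ]
    exact List.perm_middle
  rw [e1, List.replicate_succ, List.cons_append, En_cons_sub]
  simp

lemma abs_energy_le {M : ℝ} {f : GF n} (hf : ∀ x, |f x| ≤ M) :
    |energy f| ≤ (n + 1 : ℕ) * (M * mass n) := by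
  have := abs_En_le (List.replicate (n + 1) f) (M := M)
    (fun g hg => by rw [List.eq_of_mem_replicate hg]; exact hf) 0 (by simp)
  simpa [energy] using this

lemma exists_sub_le_of_almost_mono {a η : ℕ → ℝ} {B : ℝ} (hB : ∀ k, a k ≤ B)
    (hη : Tendsto η atTop (𝓝 0)) (h : ∀ k j, k ≤ j → -η k ≤ a j - a k) {ε : ℝ} (hε : 0 < ε) :
    ∃ K, ∀ k j, K ≤ k → k ≤ j → a j - a k ≤ ε := by
  obtain ⟨K₀, hK₀⟩ := eventually_atTop.1 (hη.eventually_lt_const (show (0 : ℝ) < ε / 2 by positivity))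
  set S := sSup (a '' Ici K₀)
  have hbd : BddAbove (a '' Ici K₀) := ⟨B, by rintro _ ⟨k, _, rfl⟩; exact hB k⟩
  obtain ⟨_, ⟨K, hK, rfl⟩, hKS⟩ := exists_lt_of_lt_csSup (s := a '' Ici K₀) (b := S - ε / 2)
    ⟨_, K₀, self_mem_Ici, rfl⟩ (by linarith)
  refine ⟨K, fun k j hk hj => ?_⟩
  have h1 := le_csSup hbd ⟨j, hK.trans (hk.trans hj), rfl⟩
  have h2 := h K k hk
  have h3 := hK₀ K hK
  linarith

lemma exists_pr_le_of_almost_increasing {M : ℝ} {v : ℕ → GF n} {η : ℕ → ℝ}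
    (hM : ∀ k x, |v k x| ≤ M) (hη : Tendsto η atTop (𝓝 0))
    (h : ∀ k j, k ≤ j → ∀ T : List (GF n), T.length = n → (∀ q ∈ T, ∀ x, |q x| ≤ M) →
      -η k ≤ pr (fun x => v j x - v k x) T)
    {ε : ℝ} (hε : 0 < ε) : ∃ K, ∀ k j, K ≤ k → k ≤ j →
      pr (fun x => v j x - v k x) (List.replicate n (v k)) ≤ ε := by
  have hlen : ∀ k j i, i ∈ Finset.range (n + 1) →
      (List.replicate i (v j) ++ List.replicate (n - i) (v k)).length = n := by
    intro k j i hi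
    have := Finset.mem_range.1 hi
    simp
    omega
  have hbd : ∀ k j i, ∀ q ∈ List.replicate i (v j) ++ List.replicate (n - i) (v k),
      ∀ x, |q x| ≤ M := by
    intro k j i q hq
    rcases List.mem_append.1 hq with hq | hq
    · rw [List.eq_of_mem_replicate hq]; exact hM j
    · rw [List.eq_of_mem_replicate hq]; exact hM k
  have hη' : Tendsto (fun k => (n + 1 : ℕ) * η k) atTop (𝓝 0) := by
    simpa using hη.const_mul ((n + 1 : ℕ) : ℝ)
  have hη'' : Tendsto (fun k => (n : ℕ) * η k) atTop (𝓝 0) := by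
    simpa using hη.const_mul ((n : ℕ) : ℝ)
  obtain ⟨K₁, hK₁⟩ := exists_sub_le_of_almost_mono (a := fun k => energy (v k))
    (fun k => (le_abs_self _).trans (abs_energy_le (hM k))) hη' (fun k j hkj => by
      rw [energy_sub]
      have := Finset.sum_le_sum (f := fun _ => -η k) fun i hi => h k j hkj _ (hlen k j i hi) (hbd k j i)
      simp only [Finset.sum_const, Finset.card_range, nsmul_eq_mul] at this
      linarith) (half_pos hε)
  obtain ⟨K₂, hK₂⟩ := eventually_atTop.1 (hη''.eventually_lt_const (half_pos hε))
  refine ⟨Max.max K₁ K₂, fun k j hk hkj => ?_⟩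
  have h1 := hK₁ k j ((le_max_left _ _).trans hk) hkj
  have h2 := hK₂ k ((le_max_right _ _).trans hk)
  rw [energy_sub, Finset.sum_range_succ'] at h1
  simp only [List.replicate_zero, List.nil_append, Nat.sub_zero] at h1
  have h3 := Finset.sum_le_sum (s := Finset.range n) (f := fun _ => -η k) fun i hi =>
    h k j hkj _ (hlen k j (i + 1) (by simpa using hi)) (hbd k j (i + 1))
  simp only [Finset.sum_const, Finset.card_range, nsmul_eq_mul] at h3
  linarith

lemma exists_pr_le_of_almost_decreasing {M : ℝ} {v : ℕ → GF n} {η : ℕ → ℝ}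
    (hM : ∀ k x, |v k x| ≤ M) (hη : Tendsto η atTop (𝓝 0))
    (h : ∀ k j, k ≤ j → ∀ x, v j x ≤ v k x + η k) {ε : ℝ} (hε : 0 < ε) :
    ∃ K, ∀ k j, K ≤ k → k ≤ j → ∀ T : List (GF n), T.length = n →
      (∀ q ∈ T, ∀ x, |q x| ≤ M) → pr (fun x => v k x - v j x) T ≤ ε := by
  have hlen : ∀ k j i, i ∈ Finset.range (n + 1) →
      (List.replicate i (v j) ++ List.replicate (n - i) (v k)).length = n := by
    intro k j i hi
    have := Finset.mem_range.1 hi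
    simp
    omega
  have h' : ∀ k j, k ≤ j → ∀ T : List (GF n), T.length = n →
      pr (fun x => v j x - v k x) T ≤ η k * mass n := fun k j hkj T hT =>
    pr_le hT ((v j).bm.sub (v k).bm) fun x => by linarith [h k j hkj x]
  obtain ⟨δ, hδ, H⟩ := exists_pr_sub_le_of_length_eq (n := n) M hε
  have hη' : Tendsto (fun k => (n + 1 : ℕ) * (η k * mass n)) atTop (𝓝 0) := by
    simpa using (hη.mul_const (mass n)).const_mul ((n + 1 : ℕ) : ℝ)
  have hη'' : Tendsto (fun k => (n : ℕ) * (η k * mass n)) atTop (𝓝 0) := by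
    simpa using (hη.mul_const (mass n)).const_mul ((n : ℕ) : ℝ)
  obtain ⟨K₁, hK₁⟩ := exists_sub_le_of_almost_mono (a := fun k => -energy (v k))
    (fun k => (neg_le_abs _).trans (abs_energy_le (hM k))) hη' (fun k j hkj => by
      have e : -energy (v j) - -energy (v k) = -(energy (v j) - energy (v k)) := by ring
      rw [e, energy_sub]
      have := Finset.sum_le_sum (g := fun _ => η k * mass n) fun i hi =>
        h' k j hkj _ (hlen k j i hi)
      simp only [Finset.sum_const, Finset.card_range, nsmul_eq_mul] at this
      linarith) (half_pos hδ)
  obtain ⟨K₂, hK₂⟩ := eventually_atTop.1 (hη''.eventually_lt_const (half_pos hδ))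
  obtain ⟨K₃, hK₃⟩ := eventually_atTop.1 (hη.eventually_lt_const hδ)
  refine ⟨Max.max (Max.max K₁ K₂) K₃, fun k j hk hkj => H (v k) (v j) (hM k) (hM j) ?_ ?_⟩
  · intro x
    linarith [h k j hkj x, hK₃ k ((le_max_right _ _).trans hk)]
  · have hk' := (le_max_left _ _).trans hk
    have h1 := hK₁ k j ((le_max_left _ _).trans hk') hkj
    have h2 := hK₂ k ((le_max_right _ _).trans hk')
    have e : -energy (v j) - -energy (v k) = -(energy (v j) - energy (v k)) := by ring
    simp only [e] at h1
    rw [energy_sub, Finset.sum_range_succ] at h1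
    have h3 := Finset.sum_le_sum (s := Finset.range n) (g := fun _ => η k * mass n) fun i hi =>
      h' k j hkj _ (hlen k j i (by have := Finset.mem_range.1 hi; simp; omega))
    simp only [Finset.sum_const, Finset.card_range, nsmul_eq_mul] at h3
    simp only [Nat.sub_self, List.replicate_zero, List.append_nil] at h1
    rw [pr_sub (v j).bm (v k).bm] at h1
    rw [pr_sub (v k).bm (v j).bm]
    linarith

lemma quadratic_bound {E : Type*} [NormedAddCommGroup E] [NormedSpace ℝ E] {f : E → ℝ}
    {L : E → E →L[ℝ] ℝ} {C : ℝ} (hf : ∀ x, HasFDerivAt f (L x) x)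
    (hL : ∀ x y, ‖L x - L y‖ ≤ C * ‖x - y‖) (z y : E) :
    |f (z + y) - f z - L z y| ≤ C * ‖y‖ ^ 2 := by
  have h := (convex_segment (𝕜 := ℝ) z (z + y)).norm_image_sub_le_of_norm_hasFDerivWithin_le'
    (f := f) (f' := L) (φ := L z) (C := C * ‖y‖) (x := z) (y := z + y)
    (fun x _ => (hf x).hasFDerivWithinAt) (fun x hx => by
      refine (hL x z).trans ?_
      rcases eq_or_ne z x with rfl | hne
      · simp only [sub_self, norm_zero, mul_zero]
        have h2 := (norm_nonneg _).trans (hL (z + y) z)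
        rwa [add_sub_cancel_left] at h2
      · have hC : 0 ≤ C := by
          have h1 := (norm_nonneg _).trans (hL x z)
          have h2 : 0 < ‖x - z‖ := norm_pos_iff.2 (sub_ne_zero.2 hne.symm)
          exact nonneg_of_mul_nonneg_left h1 h2
        gcongr
        have := norm_sub_le_of_mem_segment hx
        simpa using this)
    (left_mem_segment _ _ _) (right_mem_segment _ _ _)
  rw [add_sub_cancel_left, Real.norm_eq_abs] at h
  linarith

/-- Semiconcavity. -/
def SC (C : ℝ) (u : (Fin n → ℂ) → ℝ) : Prop :=
  ∀ z ξ, u (z + ξ) + u (z - ξ) - 2 * u z ≤ C * nsq ξ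

lemma norm_hess_bound {f : (Fin n → ℂ) → ℝ} (hf : ContDiff ℝ ∞ f) (hper : Per f) :
    ∃ C, ∀ x, ‖hess f x‖ ≤ C := by
  have hp : ∀ l ∈ lat n, (fun x => f (x + l)) = f := fun l hl => funext fun x => hper l hl x
  have h1 : ∀ l ∈ lat n, ∀ z, fderiv ℝ f (z + l) = fderiv ℝ f z := fun l hl z => by
    rw [← fderiv_comp_add_right, hp l hl]
  have h2 : Per (hess f) := fun l hl z => by
    show fderiv ℝ (fderiv ℝ f) (z + l) = _
    rw [← fderiv_comp_add_right]
    congr 1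
    exact funext fun x => h1 l hl x
  have hc : Continuous (hess f) :=
    ((hf.fderiv_right (m := ∞) (by simp)).fderiv_right (m := ∞) (by simp)).continuous
  have hcn : Continuous fun x => ‖hess f x‖ :=
    (continuous_norm (E := (Fin n → ℂ) →L[ℝ] (Fin n → ℂ) →L[ℝ] ℝ)).comp hc
  obtain ⟨M, hM⟩ := Per.exists_bound (h2.comp norm) hcn
  exact ⟨M, fun x => (le_abs_self _).trans (hM x)⟩

lemma lipschitz_fderiv {f : (Fin n → ℂ) → ℝ} (hf : ContDiff ℝ ∞ f) {C : ℝ}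
    (hC : ∀ x, ‖hess f x‖ ≤ C) (x y : Fin n → ℂ) :
    ‖fderiv ℝ f x - fderiv ℝ f y‖ ≤ C * ‖x - y‖ :=
  convex_univ.norm_image_sub_le_of_norm_fderiv_le (𝕜 := ℝ)
    (fun z _ => (hf.fderiv_right (m := ∞) (by simp)).differentiable (by simp) z)
    (fun z _ => hC z) (mem_univ _) (mem_univ _)

lemma exists_SC {f : (Fin n → ℂ) → ℝ} (hf : ContDiff ℝ ∞ f) (hper : Per f) :
    ∃ C, 0 ≤ C ∧ SC C f := by
  obtain ⟨C, hC⟩ := norm_hess_bound hf hper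
  have hC0 : 0 ≤ C := (norm_nonneg (hess f 0)).trans (hC 0)
  refine ⟨2 * C, by positivity, fun z ξ => ?_⟩
  have h := quadratic_bound (fun x => (hf.differentiable (by simp) x).hasFDerivAt)
    (lipschitz_fderiv hf hC) z
  have h1 := (abs_le.1 (h ξ)).2
  have h2 := (abs_le.1 (h (-ξ))).2
  rw [map_neg, norm_neg, ← sub_eq_add_neg] at h2
  have h3 := mul_le_mul_of_nonneg_left (norm_sq_le_nsq ξ) hC0
  linarith

lemma SC.pEnv {φ : (Fin n → ℂ) → ℝ} {C : ℝ} (h : SC C φ) (husc : UpperSemicontinuous φ)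
    (hper : Per φ) {a : ℝ} (ha : ∀ z, a ≤ φ z) : SC C (pEnv φ) := by
  intro z ξ
  have hv := QP.pEnv ha hper husc
  have hle := pEnv_le ha
  have hw := ((hv.translate ξ).half_sum (hv.translate (-ξ))).add_const (-(1 / 2 * (C * nsq ξ)))
  have := le_pEnv (ρ := φ) hw (fun x => by
    have := h x ξ
    have h1 := hle (x + ξ)
    have h2 := hle (x + -ξ)
    rw [← sub_eq_add_neg] at h2
    rw [← sub_eq_add_neg x ξ]
    linarith) z
  rw [← sub_eq_add_neg z ξ] at this
  linarith

lemma SC.conv_kr {u : (Fin n → ℂ) → ℝ} {C : ℝ} (h : SC C u) (hu : BM u) {ε : ℝ} (hε : 0 < ε) :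
    SC C (conv (kr ε) u) := by
  intro z ξ
  have hk := integrable_kr (n := n) hε
  have b1 : BM fun x => u (x + ξ) := hu.comp (by fun_prop)
  have b2 : BM fun x => u (x + -ξ) := hu.comp (by fun_prop)
  rw [sub_eq_add_neg z ξ, conv_translate, conv_translate, ← conv_add hk b1 b2, ← conv_const_mul,
    ← conv_sub hk (b1.add b2) (hu.const_mul 2)]
  refine conv_kr_le_of_forall hε ((b1.add b2).sub (hu.const_mul 2)) fun y _ => ?_
  have := h (z - y) ξ
  rwa [sub_eq_add_neg (z - y) ξ] at this

lemma SC.hess_le {f : (Fin n → ℂ) → ℝ} {C : ℝ} (h : SC C f) (hf : ContDiff ℝ ∞ f)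
    (z ξ : Fin n → ℂ) : hess f z ξ ξ ≤ C * nsq ξ := by
  refine le_of_forall_pos_le_add fun δ hδ => ?_
  set δ' := δ / (2 * (‖ξ‖ ^ 2 + 1))
  have hδ' : 0 < δ' := by positivity
  have ho := (Asymptotics.isLittleO_iff.1 (isLittleO_hess hf z)) hδ'
  have t1 : Tendsto (fun t : ℝ => t • ξ) (𝓝[>] 0) (𝓝 0) := by
    have : Tendsto (fun t : ℝ => t • ξ) (𝓝 0) (𝓝 ((0 : ℝ) • ξ)) :=
      (continuous_id.smul continuous_const).tendsto 0
    rw [zero_smul] at this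
    exact this.mono_left nhdsWithin_le_nhds
  have t2 : Tendsto (fun t : ℝ => -(t • ξ)) (𝓝[>] 0) (𝓝 0) := by simpa using t1.neg
  obtain ⟨t, ⟨h1, h2⟩, ht⟩ := (((t1.eventually ho).and (t2.eventually ho)).and
    self_mem_nhdsWithin).exists
  have ht : 0 < t := ht
  have h3 := h z (t • ξ)
  have n1 : ‖‖t • ξ‖ ^ 2‖ = t ^ 2 * ‖ξ‖ ^ 2 := by
    rw [Real.norm_of_nonneg (by positivity), norm_smul, Real.norm_of_nonneg ht.le, mul_pow]
  rw [norm_neg, n1, Real.norm_eq_abs, ← sub_eq_add_neg] at h2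
  rw [n1, Real.norm_eq_abs] at h1
  have h1 := (abs_le.1 h1).1
  have h2 := (abs_le.1 h2).1
  simp only [map_neg, map_smul, neg_apply, smul_apply, smul_eq_mul] at h1 h2
  rw [nsq_real_smul] at h3
  have h4 : δ' * (2 * ‖ξ‖ ^ 2) ≤ δ := by
    have : δ' * (2 * (‖ξ‖ ^ 2 + 1)) = δ := div_mul_cancel₀ _ (by positivity)
    nlinarith
  have h5 : t ^ 2 * (hess f z ξ ξ) ≤ t ^ 2 * (C * nsq ξ + δ) := by
    nlinarith [mul_le_mul_of_nonneg_left h4 (sq_nonneg t)]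
  exact le_of_mul_le_mul_left h5 (by positivity)

lemma SC.norm_hess_le {f : GF n} {C : ℝ} (hC : 0 ≤ C) (h : SC C f) (z : Fin n → ℂ) :
    ‖hess f z‖ ≤ 2 * ((4 + C) * n) := by
  have hK : 0 ≤ (4 + C) * n := by positivity
  have hd : ∀ ξ, |hess f z ξ ξ| ≤ (4 + C) * n * ‖ξ‖ ^ 2 := by
    intro ξ
    have h1 := h.hess_le f.smooth z ξ
    have h2 := h.hess_le f.smooth z (I • ξ)
    have h3 := f.lev_nonneg z ξ
    have h4 : nsq (I • ξ) = nsq ξ := by rw [nsq_smul]; simp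
    rw [h4] at h2
    rw [lev] at h3
    have h5 := nsq_le_norm_sq ξ
    have h6 := nsq_nonneg ξ
    have h7 : (4 + C) * nsq ξ ≤ (4 + C) * n * ‖ξ‖ ^ 2 := by
      rw [mul_assoc]; exact mul_le_mul_of_nonneg_left h5 (by linarith)
    rw [abs_le]
    constructor <;> nlinarith
  have hu : ∀ ξ η, ‖ξ‖ = 1 → ‖η‖ = 1 → |hess f z ξ η| ≤ 2 * ((4 + C) * n) := by
    intro ξ η hξ hη
    have e : hess f z ξ η = 1 / 4 * (hess f z (ξ + η) (ξ + η) - hess f z (ξ - η) (ξ - η)) := by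
      simp only [map_add, map_sub, add_apply, sub_apply, hess_symm f.smooth z η ξ]
      ring
    have b1 := hd (ξ + η)
    have b2 := hd (ξ - η)
    have c1 : ‖ξ + η‖ ^ 2 ≤ 4 := by
      have := norm_add_le ξ η
      rw [hξ, hη] at this
      nlinarith [norm_nonneg (ξ + η)]
    have c2 : ‖ξ - η‖ ^ 2 ≤ 4 := by
      have := norm_sub_le ξ η
      rw [hξ, hη] at this
      nlinarith [norm_nonneg (ξ - η)]
    have d1 := mul_le_mul_of_nonneg_left c1 hK
    have d2 := mul_le_mul_of_nonneg_left c2 hK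
    rw [e, abs_le]
    rw [abs_le] at b1 b2
    constructor <;> linarith
  refine ContinuousLinearMap.opNorm_le_bound₂ _ (by positivity) fun ξ η => ?_
  rcases eq_or_ne ξ 0 with rfl | hξ
  · simp
  rcases eq_or_ne η 0 with rfl | hη
  · simp
  have hξ' := norm_pos_iff.2 hξ
  have hη' := norm_pos_iff.2 hη
  have := hu (‖ξ‖⁻¹ • ξ) (‖η‖⁻¹ • η) (by simp [norm_smul, hξ]) (by simp [norm_smul, hη])
  simp only [map_smul, smul_apply, smul_eq_mul, abs_mul, abs_inv, abs_norm] at this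
  rw [Real.norm_eq_abs]
  calc |hess f z ξ η| = ‖ξ‖ * ‖η‖ * (‖η‖⁻¹ * (‖ξ‖⁻¹ * |hess f z ξ η|)) := by
        field_simp
    _ ≤ ‖ξ‖ * ‖η‖ * (2 * ((4 + C) * n)) := mul_le_mul_of_nonneg_left this (by positivity)
    _ = _ := by ring

/-- Mollification inside the class `GF`. -/
def mol {u : (Fin n → ℂ) → ℝ} (hu : QP u) (k : ℕ) : GF n :=
  ⟨conv (kr (1 / ((k : ℝ) + 1))) u, contDiff_conv_kr (by positivity) hu.bm,
    hu.conv_kr (by positivity)⟩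

lemma mol_apply {u : (Fin n → ℂ) → ℝ} (hu : QP u) (k : ℕ) (x : Fin n → ℂ) :
    mol hu k x = conv (kr (1 / ((k : ℝ) + 1))) u x := rfl

lemma le_mol_apply {u : (Fin n → ℂ) → ℝ} (hu : QP u) {a : ℝ} (h : ∀ x, a ≤ u x) (k : ℕ)
    (x : Fin n → ℂ) : a ≤ mol hu k x :=
  le_conv_kr_of_forall (by positivity) hu.bm fun _ _ => h _

lemma mol_apply_le {u : (Fin n → ℂ) → ℝ} (hu : QP u) {b : ℝ} (h : ∀ x, u x ≤ b) (k : ℕ)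
    (x : Fin n → ℂ) : mol hu k x ≤ b :=
  conv_kr_le_of_forall (by positivity) hu.bm fun _ _ => h _

lemma eventually_inv_succ_lt {ε : ℝ} (hε : 0 < ε) : ∀ᶠ k : ℕ in atTop, 1 / ((k : ℝ) + 1) < ε :=
  tendsto_one_div_add_atTop_nhds_zero_nat.eventually_lt_const hε

lemma tendsto_mol {u : (Fin n → ℂ) → ℝ} (hu : QP u) (x : Fin n → ℂ) :
    Tendsto (fun k => mol hu k x) atTop (𝓝 (u x)) := by
  refine tendsto_order.2 ⟨fun a ha => ?_, fun b hb => ?_⟩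
  · obtain ⟨c, hc0, hc⟩ : ∃ c > 0, c ^ 2 < u x - a := by
      have h0 : 0 < u x - a := sub_pos.2 ha
      refine ⟨Real.sqrt ((u x - a) / 2), Real.sqrt_pos.2 (by linarith), ?_⟩
      rw [Real.sq_sqrt (by linarith)]
      linarith
    filter_upwards [eventually_inv_succ_lt hc0] with k hk
    have h1 := hu.le_conv_kr (ε := 1 / ((k : ℝ) + 1)) (by positivity) x
    have h2 : (1 / ((k : ℝ) + 1)) ^ 2 ≤ c ^ 2 := by gcongr
    rw [mol_apply]
    linarith
  · obtain ⟨b', h1, h2⟩ := exists_between hb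
    obtain ⟨ε₀, h0, h⟩ := conv_kr_eventually_le hu.bm hu.usc h1
    filter_upwards [eventually_inv_succ_lt h0] with k hk
    exact (h _ (by positivity) hk).trans_lt h2

section Regularity

variable {u : (Fin n → ℂ) → ℝ} {C : ℝ}

lemma norm_hess_mol_le (hu : QP u) (hC : 0 ≤ C) (h : SC C u) (k : ℕ) (z : Fin n → ℂ) :
    ‖hess (mol hu k) z‖ ≤ 2 * ((4 + C) * n) :=
  SC.norm_hess_le (f := mol hu k) hC (h.conv_kr hu.bm (by positivity)) z

lemma mol_quadratic_bound (hu : QP u) (hC : 0 ≤ C) (h : SC C u) (k : ℕ) (z y : Fin n → ℂ) :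
    |mol hu k (z + y) - mol hu k z - fderiv ℝ (mol hu k) z y| ≤ 2 * ((4 + C) * n) * ‖y‖ ^ 2 :=
  quadratic_bound (fun x => ((mol hu k).smooth.differentiable (by simp) x).hasFDerivAt)
    (lipschitz_fderiv (mol hu k).smooth (norm_hess_mol_le hu hC h k)) z y

lemma SC.continuous (hu : QP u) (hC : 0 ≤ C) (h : SC C u) : Continuous u := by
  obtain ⟨M, hM⟩ := hu.bm.bdd
  have hM0 : 0 ≤ M := (abs_nonneg _).trans (hM 0)
  have hMk : ∀ k x, |mol hu k x| ≤ M := fun k x => abs_le.2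
    ⟨le_mol_apply hu (fun x => (abs_le.1 (hM x)).1) k x,
      mol_apply_le hu (fun x => (abs_le.1 (hM x)).2) k x⟩
  set K := 2 * ((4 + C) * n) with hK
  have hK0 : 0 ≤ K := by positivity
  have hD : ∀ k z, ‖fderiv ℝ (mol hu k) z‖ ≤ 2 * M + K := by
    intro k z
    refine ContinuousLinearMap.opNorm_le_of_unit_norm (by positivity) fun y hy => ?_
    have h1 := mol_quadratic_bound hu hC h k z y
    rw [hy, ← hK] at h1
    have h2 := abs_le.1 (hMk k z)
    have h3 := abs_le.1 (hMk k (z + y))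
    rw [Real.norm_eq_abs, abs_le]
    rw [abs_le] at h1
    constructor <;> linarith
  have hL : ∀ k x y, |mol hu k x - mol hu k y| ≤ (2 * M + K) * ‖x - y‖ := fun k x y =>
    convex_univ.norm_image_sub_le_of_norm_fderiv_le (𝕜 := ℝ)
      (fun z _ => (mol hu k).smooth.differentiable (by simp) z) (fun z _ => hD k z)
      (mem_univ _) (mem_univ _)
  have hLu : ∀ x y, |u x - u y| ≤ (2 * M + K) * ‖x - y‖ := fun x y =>
    le_of_tendsto ((tendsto_mol hu x).sub (tendsto_mol hu y)).abs
      (Eventually.of_forall fun k => hL k x y)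
  have : LipschitzWith ⟨2 * M + K, by positivity⟩ u := LipschitzWith.of_dist_le_mul fun x y => by
    rw [Real.dist_eq, dist_eq_norm]; exact hLu x y
  exact this.continuous

lemma SC.exists_hasFDerivAt (hu : QP u) (hC : 0 ≤ C) (h : SC C u) :
    ∃ L : (Fin n → ℂ) → (Fin n → ℂ) →L[ℝ] ℝ, (∀ x, HasFDerivAt u (L x) x) ∧
      ∀ x y, ‖L x - L y‖ ≤ 2 * ((4 + C) * n) * ‖x - y‖ := by
  set K := 2 * ((4 + C) * n) with hK
  have hK0 : 0 ≤ K := by positivity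
  have hcl : ∀ η > 0, ∃ N, ∀ k ≥ N, ∀ z, |mol hu k z - u z| ≤ η := fun η hη => by
    obtain ⟨ε₀, h0, H⟩ := exists_conv_kr_close hu.per (h.continuous hu hC) hη
    obtain ⟨N, hN⟩ := eventually_atTop.1 (eventually_inv_succ_lt h0)
    exact ⟨N, fun k hk z => H _ (by positivity) (hN k hk) z⟩
  have hlim : ∀ z, ∃ A, Tendsto (fun k => fderiv ℝ (mol hu k) z) atTop (𝓝 A) := by
    intro z
    refine cauchySeq_tendsto_of_complete (Metric.cauchySeq_iff'.2 fun e he => ?_)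
    set t := e / (4 * (K + 1)) with ht
    have ht0 : 0 < t := by positivity
    obtain ⟨N, hN⟩ := hcl (e * t / 16) (by positivity)
    refine ⟨N, fun k hk => ?_⟩
    rw [dist_eq_norm]
    have htK : K * t ≤ e / 4 := by
      have : t * (4 * (K + 1)) = e := div_mul_cancel₀ _ (by positivity)
      nlinarith
    have : ‖fderiv ℝ (mol hu k) z - fderiv ℝ (mol hu N) z‖ ≤ 3 / 4 * e := by
      refine ContinuousLinearMap.opNorm_le_of_unit_norm (by positivity) fun y hy => ?_
      have h1 := abs_le.1 (mol_quadratic_bound hu hC h k z (t • y))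
      have h2 := abs_le.1 (mol_quadratic_bound hu hC h N z (t • y))
      have n1 : ‖t • y‖ ^ 2 = t ^ 2 := by rw [norm_smul, hy, Real.norm_of_nonneg ht0.le, mul_one]
      rw [n1, ← hK, map_smul, smul_eq_mul] at h1 h2
      have a1 := abs_le.1 (hN k hk z)
      have a2 := abs_le.1 (hN k hk (z + t • y))
      have a3 := abs_le.1 (hN N le_rfl z)
      have a4 := abs_le.1 (hN N le_rfl (z + t • y))
      have a5 := mul_le_mul_of_nonneg_right htK ht0.le
      rw [Real.norm_eq_abs, abs_le, sub_apply]
      constructor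
      · refine le_of_mul_le_mul_left ?_ ht0
        linarith
      · refine le_of_mul_le_mul_left ?_ ht0
        linarith
    linarith
  choose L hL using hlim
  have hq : ∀ z y, |u (z + y) - u z - L z y| ≤ K * ‖y‖ ^ 2 := fun z y => by
    have t1 : Tendsto (fun k => fderiv ℝ (mol hu k) z y) atTop (𝓝 (L z y)) :=
      ((ContinuousLinearMap.apply ℝ ℝ y).continuous.tendsto (L z)).comp (hL z)
    exact le_of_tendsto (((tendsto_mol hu (z + y)).sub (tendsto_mol hu z)).sub t1).abs
      (Eventually.of_forall fun k => mol_quadratic_bound hu hC h k z y)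
  refine ⟨L, fun x => ?_, fun x y => ?_⟩
  · rw [hasFDerivAt_iff_isLittleO_nhds_zero]
    refine Asymptotics.IsBigO.trans_isLittleO (g := fun y : Fin n → ℂ => ‖y‖ ^ 2) ?_ ?_
    · refine Asymptotics.IsBigO.of_bound K (Eventually.of_forall fun y => ?_)
      rw [Real.norm_eq_abs, Real.norm_of_nonneg (by positivity)]
      exact hq x y
    · have := Asymptotics.isLittleO_norm_pow_id (E' := Fin n → ℂ) one_lt_two
      exact this
  · exact le_of_tendsto ((hL x).sub (hL y)).norm (Eventually.of_forall fun k =>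
      lipschitz_fderiv (mol hu k).smooth (norm_hess_mol_le hu hC h k) x y)

end Regularity

/-- Integration by parts moves the derivative from the kernel to the function. -/
lemma conv_fderiv_kernel {k v : (Fin n → ℂ) → ℝ} {L : (Fin n → ℂ) → (Fin n → ℂ) →L[ℝ] ℝ}
    (hk : ContDiff ℝ ∞ k) (hkc : HasCompactSupport k) (hv : ∀ x, HasFDerivAt v (L x) x)
    (ξ : Fin n → ℂ) (hL : Continuous fun x => L x ξ) (z : Fin n → ℂ) :
    conv (fun y => fderiv ℝ k y ξ) v z = conv k (fun x => L x ξ) z := by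
  have hvc : Continuous v := continuous_iff_continuousAt.2 fun x => (hv x).continuousAt
  have hd : ∀ y, HasFDerivAt (fun y => v (z - y)) (-(L (z - y))) y := fun y => by
    have h1 : HasFDerivAt (fun y : Fin n → ℂ => z - y) (-ContinuousLinearMap.id ℝ _) y :=
      (hasFDerivAt_id y).const_sub z
    exact ((hv (z - y)).comp y h1).congr_fderiv (by ext w; simp)
  have hkd : Continuous fun y => fderiv ℝ k y ξ :=
    (hk.continuous_fderiv (by simp)).clm_apply continuous_const
  have hkdc : HasCompactSupport fun y => fderiv ℝ k y ξ := hkc.fderiv_apply ℝ ξ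
  have hvz : Continuous fun y => v (z - y) := hvc.comp (continuous_const.sub continuous_id)
  have hLz : Continuous fun y => L (z - y) ξ := hL.comp (continuous_const.sub continuous_id)
  have key := integral_mul_fderiv_eq_neg_fderiv_mul_of_integrable (μ := (volume : Measure (Fin n → ℂ)))
    (f := fun y => v (z - y)) (g := k) (v := ξ) ?_ ?_ ?_
    (fun y _ => (hd y).differentiableAt) (fun y _ => hk.differentiable (by simp) y)
  · unfold conv
    simp_rw [mul_comm _ (v _)]
    rw [key, ← integral_neg]
    refine integral_congr_ae (Eventually.of_forall fun y => ?_)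
    simp only [(hd y).fderiv, neg_apply]
    ring
  · simp only [fun y => (hd y).fderiv, neg_apply]
    exact (hLz.neg.mul hk.continuous).integrable_of_hasCompactSupport hkc.mul_left
  · exact (hvz.mul hkd).integrable_of_hasCompactSupport hkdc.mul_left
  · exact (hvz.mul hk.continuous).integrable_of_hasCompactSupport hkc.mul_left

/-- The scale invariant first moment of the derivative of the bump. -/
def kmom (ξ : Fin n → ℂ) : ℝ :=
  (∫ x : Fin n → ℂ, psi x)⁻¹ * ∫ x : Fin n → ℂ, |fderiv ℝ psi x ξ| * ‖x‖

lemma fderiv_kr {ε : ℝ} (y ξ : Fin n → ℂ) :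
    fderiv ℝ (kr ε) y ξ =
      (∫ x : Fin n → ℂ, psi (ε⁻¹ • x))⁻¹ * (ε⁻¹ * fderiv ℝ psi (ε⁻¹ • y) ξ) := by
  have h1 : HasFDerivAt (fun y : Fin n → ℂ => ε⁻¹ • y) (ε⁻¹ • ContinuousLinearMap.id ℝ _) y :=
    (hasFDerivAt_id y).const_smul ε⁻¹
  have h2 := (contDiff_psi (n := n)).differentiable (by simp) (ε⁻¹ • y)
  have h3 := (h2.hasFDerivAt.comp y h1).const_mul (∫ x : Fin n → ℂ, psi (ε⁻¹ • x))⁻¹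
  have h4 : fderiv ℝ (kr ε) y = _ := h3.fderiv
  rw [h4]
  simp

lemma integral_fderiv_kr_mul_norm {ε : ℝ} (hε : 0 < ε) (ξ : Fin n → ℂ) :
    ∫ y, |fderiv ℝ (kr ε) y ξ| * ‖y‖ = kmom ξ := by
  have h1 : ∀ y : Fin n → ℂ, |fderiv ℝ (kr ε) y ξ| * ‖y‖ =
      (∫ x : Fin n → ℂ, psi (ε⁻¹ • x))⁻¹ *
        (fun x => |fderiv ℝ psi x ξ| * ‖x‖) (ε⁻¹ • y) := fun y => by
    have h0 := (integral_psi_pos (n := n) hε).le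
    rw [fderiv_kr, abs_mul, abs_mul, abs_of_nonneg (inv_nonneg.2 h0),
      abs_of_pos (inv_pos.2 hε)]
    simp only [norm_smul, Real.norm_of_nonneg (inv_pos.2 hε).le]
    ring
  have e2 := Measure.integral_comp_smul (volume : Measure (Fin n → ℂ))
    (fun x => |fderiv ℝ psi x ξ| * ‖x‖) ε⁻¹
  rw [integral_congr_ae (Eventually.of_forall h1), integral_const_mul, e2,
    Measure.integral_comp_smul, kmom,
    smul_eq_mul, smul_eq_mul, mul_inv]
  have h2 : |(ε⁻¹ ^ Module.finrank ℝ (Fin n → ℂ))⁻¹| ≠ 0 := by positivity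
  field_simp

lemma fderiv_kr_ne_zero {ε : ℝ} (hε : 0 < ε) {y ξ : Fin n → ℂ} (h : fderiv ℝ (kr ε) y ξ ≠ 0) :
    nsq y ≤ ε ^ 2 := by
  have h1 : y ∈ tsupport (kr ε) := by
    refine tsupport_fderiv_subset ℝ (subset_tsupport _ ?_)
    intro h0
    rw [h0] at h
    exact h rfl
  refine closure_minimal (fun y hy => ?_) (isCompact_nsq_le (ε ^ 2)).isClosed h1
  exact (kr_ne_zero hε hy).le

lemma abs_conv_fderiv_kr_sub_le {g : (Fin n → ℂ) → ℝ} {G : (Fin n → ℂ) →L[ℝ] ℝ}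
    (hg : Continuous g) {ε δ : ℝ} (hε : 0 < ε) (ξ z : Fin n → ℂ)
    (h : ∀ y, nsq y ≤ ε ^ 2 → |g (z - y) - g z - G (-y)| ≤ δ * ‖y‖) :
    |conv (fun y => fderiv ℝ (kr ε) y ξ) g z - G ξ| ≤ δ * kmom ξ := by
  have hkd : Continuous fun y : Fin n → ℂ => fderiv ℝ (kr ε) y ξ :=
    (contDiff_kr.continuous_fderiv (by simp)).clm_apply continuous_const
  have hkdc : HasCompactSupport fun y : Fin n → ℂ => fderiv ℝ (kr ε) y ξ :=
    (hasCompactSupport_kr hε).fderiv_apply ℝ ξ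
  have ha : ∀ x, HasFDerivAt (fun x => g z + G (x - z)) G x := fun x => by
    have h1 : HasFDerivAt (fun x : Fin n → ℂ => x - z) (ContinuousLinearMap.id ℝ _) x :=
      (hasFDerivAt_id x).sub_const z
    simpa using (G.hasFDerivAt.comp x h1).const_add (g z)
  have hac : Continuous fun x => g z + G (x - z) :=
    continuous_iff_continuousAt.2 fun x => (ha x).continuousAt
  have e1 : conv (fun y => fderiv ℝ (kr ε) y ξ) (fun x => g z + G (x - z)) z = G ξ := by
    rw [conv_fderiv_kernel contDiff_kr (hasCompactSupport_kr hε) ha ξ continuous_const]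
    unfold conv
    rw [integral_mul_const, integral_kr hε, one_mul]
  have i1 : Integrable fun y => fderiv ℝ (kr ε) y ξ * g (z - y) :=
    (hkd.mul (hg.comp (continuous_const.sub continuous_id))).integrable_of_hasCompactSupport
      hkdc.mul_right
  have i2 : Integrable fun y => fderiv ℝ (kr ε) y ξ * (g z + G (z - y - z)) :=
    (hkd.mul (hac.comp (continuous_const.sub continuous_id))).integrable_of_hasCompactSupport
      hkdc.mul_right
  have i3 : Integrable fun y : Fin n → ℂ => δ * (|fderiv ℝ (kr ε) y ξ| * ‖y‖) := by
    refine ((hkd.abs.mul continuous_norm).integrable_of_hasCompactSupport ?_).const_mul δ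
    exact (hkdc.comp_left (g := fun x => |x|) abs_zero).mul_right
  rw [← e1, ← integral_fderiv_kr_mul_norm hε ξ, ← integral_const_mul]
  unfold conv
  rw [← integral_sub i1 i2]
  rw [← Real.norm_eq_abs]
  refine norm_integral_le_of_norm_le i3 (Eventually.of_forall fun y => ?_)
  by_cases h0 : fderiv ℝ (kr ε) y ξ = 0
  · simp [h0]
  · have h1 := h y (fderiv_kr_ne_zero hε h0)
    have h2 : fderiv ℝ (kr ε) y ξ * g (z - y) - fderiv ℝ (kr ε) y ξ * (g z + G (z - y - z)) =
        fderiv ℝ (kr ε) y ξ * (g (z - y) - g z - G (-y)) := by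
      rw [show z - y - z = -y by abel]; ring
    rw [h2, norm_mul, Real.norm_eq_abs, Real.norm_eq_abs]
    calc _ ≤ |fderiv ℝ (kr ε) y ξ| * (δ * ‖y‖) := by gcongr
      _ = _ := by ring

lemma Per.hasFDerivAt {u : (Fin n → ℂ) → ℝ} (hper : Per u)
    {L : (Fin n → ℂ) → (Fin n → ℂ) →L[ℝ] ℝ} (h : ∀ x, HasFDerivAt u (L x) x) : Per L := by
  intro l hl z
  have h1 : HasFDerivAt (fun x : Fin n → ℂ => x + l) (ContinuousLinearMap.id ℝ _) z :=
    (hasFDerivAt_id z).add_const l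
  have h2 := (h (z + l)).comp z h1
  have h3 : (u ∘ fun x : Fin n → ℂ => x + l) = u := funext fun x => hper l hl x
  rw [h3] at h2
  simpa using h2.unique (h z)

lemma exists_delta_norm_of_nsq (r : ℝ) (hr : 0 < r) :
    ∃ ε₀ > 0, ∀ ε, 0 < ε → ε < ε₀ → ∀ y : Fin n → ℂ, nsq y ≤ ε ^ 2 → ‖y‖ < r := by
  refine ⟨r, hr, fun ε h0 h1 y hy => ?_⟩
  have := norm_sq_le_nsq y
  exact (abs_lt_of_sq_lt_sq' (by nlinarith) hr.le).2

/-- At points of second differentiability the Hessians of the mollifications converge. -/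
theorem tendsto_hess_mol {u : (Fin n → ℂ) → ℝ} (hu : QP u)
    {L : (Fin n → ℂ) → (Fin n → ℂ) →L[ℝ] ℝ} (hL : ∀ x, HasFDerivAt u (L x) x)
    (hLc : Continuous L) {z : Fin n → ℂ} {Q : (Fin n → ℂ) →L[ℝ] (Fin n → ℂ) →L[ℝ] ℝ}
    (hQ : HasFDerivAt L Q z) (ξ η : Fin n → ℂ) :
    Tendsto (fun k => hess (mol hu k) z ξ η) atTop (𝓝 (Q ξ η)) := by
  have hη : Continuous fun x => L x η := hLc.clm_apply continuous_const
  have hbm : BM fun x => L x η := Per.bm (fun l hl x => by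
    rw [hu.per.hasFDerivAt hL l hl x]) hη
  have e1 : ∀ k, hess (mol hu k) z ξ η =
      conv (fun y => fderiv ℝ (kr (1 / ((k : ℝ) + 1))) y ξ) (fun x => L x η) z := by
    intro k
    have hε : (0 : ℝ) < 1 / ((k : ℝ) + 1) := by positivity
    rw [hess_eq (mol hu k).smooth, ← fderiv_conv contDiff_kr (hasCompactSupport_kr hε) hbm]
    congr 2
    funext y
    exact (fderiv_conv contDiff_kr (hasCompactSupport_kr hε) hu.bm η y).trans
      (conv_fderiv_kernel contDiff_kr (hasCompactSupport_kr hε) hL η hη y)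
  simp_rw [e1]
  have hG : HasFDerivAt (fun x => L x η) (Q.flip η) z := by
    exact (hQ.clm_apply (hasFDerivAt_const η z)).congr_fderiv (by ext w; simp)
  rw [Metric.tendsto_atTop]
  intro e he
  have hm0 : 0 ≤ kmom ξ := by
    have := integral_fderiv_kr_mul_norm (n := n) one_pos ξ
    rw [← this]
    exact integral_nonneg fun y => by positivity
  set δ := e / (2 * (kmom ξ + 1)) with hδ
  have hδ0 : 0 < δ := by positivity
  have h1 := (hasFDerivAt_iff_isLittleO_nhds_zero.1 hG).def hδ0
  obtain ⟨r, hr, h2⟩ := Metric.eventually_nhds_iff.1 h1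
  obtain ⟨ε₀, h0, h3⟩ := exists_delta_norm_of_nsq (n := n) r hr
  obtain ⟨N, hN⟩ := eventually_atTop.1 (eventually_inv_succ_lt h0)
  refine ⟨N, fun k hk => ?_⟩
  rw [Real.dist_eq]
  have h4 := abs_conv_fderiv_kr_sub_le (G := Q.flip η) hη (by positivity) ξ z
    (ε := 1 / ((k : ℝ) + 1)) (δ := δ) fun y hy => by
      have h5 := h3 _ (by positivity) (hN k hk) y hy
      have h6 := h2 (y := -y) (by simpa using h5)
      rw [Real.norm_eq_abs, norm_neg, ← sub_eq_add_neg] at h6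
      exact h6
  calc _ ≤ δ * kmom ξ := h4
    _ < e := by
      have : δ * (2 * (kmom ξ + 1)) = e := div_mul_cancel₀ _ (by positivity)
      nlinarith

lemma nsq_zero : nsq (0 : Fin n → ℂ) = 0 := by simp [nsq]

lemma circleAverage_linear (g : (Fin n → ℂ) →L[ℝ] ℝ) (w : Fin n → ℂ) (a : ℝ) :
    Real.circleAverage (fun ζ : ℂ => a + g (ζ • w)) 0 1 = a := by
  have := circleAverage_quadratic g 0 a w
  simpa [lev] using this

/-- The derivative of `nsq`. -/
def nsqL (x : Fin n → ℂ) : (Fin n → ℂ) →L[ℝ] ℝ :=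
  ∑ i, (2 : ℝ) • (Complex.reCLM ∘L
    ((ContinuousLinearMap.mul ℝ ℂ ((starRingEnd ℂ) (x i))) ∘L ContinuousLinearMap.proj i))

lemma nsq_add (x y : Fin n → ℂ) : nsq (x + y) = nsq x + nsqL x y + nsq y := by
  simp only [nsq, nsqL, sum_apply, ← Finset.sum_add_distrib]
  refine Finset.sum_congr rfl fun i _ => ?_
  simp [← Complex.normSq_eq_norm_sq, Complex.normSq_apply]
  ring

lemma cmean_nsq (x w : Fin n → ℂ) : cmean nsq x w = nsq x + nsq w := by
  have h : Set.EqOn (fun ζ : ℂ => nsq (x + ζ • w))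
      (fun ζ : ℂ => (nsq x + nsq w) + nsqL x (ζ • w)) (sphere 0 |1|) := by
    intro ζ hζ
    have : ‖ζ‖ = 1 := by simpa using hζ
    simp only [nsq_add x, nsq_smul, this]
    ring
  unfold cmean
  rw [Real.circleAverage_congr_sphere h, circleAverage_linear]

/-- A quadratic polynomial centred at `z` . -/
def quad (a : ℝ) (ℓ : (Fin n → ℂ) →L[ℝ] ℝ) (Q : (Fin n → ℂ) →L[ℝ] (Fin n → ℂ) →L[ℝ] ℝ)
    (κ : ℝ) (y : Fin n → ℂ) : ℝ := a + ℓ y + 1 / 2 * Q y y - κ * nsq y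

lemma continuous_quad (a : ℝ) (ℓ : (Fin n → ℂ) →L[ℝ] ℝ)
    (Q : (Fin n → ℂ) →L[ℝ] (Fin n → ℂ) →L[ℝ] ℝ) (κ : ℝ) : Continuous (quad a ℓ Q κ) := by
  have := continuous_nsq (n := n)
  unfold quad
  fun_prop

lemma cmean_quad (a : ℝ) (ℓ : (Fin n → ℂ) →L[ℝ] ℝ)
    (Q : (Fin n → ℂ) →L[ℝ] (Fin n → ℂ) →L[ℝ] ℝ) (κ : ℝ) (y w : Fin n → ℂ) :
    cmean (quad a ℓ Q κ) y w = quad a ℓ Q κ y + lev Q w - κ * nsq w := by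
  have h : Set.EqOn (fun ζ : ℂ => quad a ℓ Q κ (y + ζ • w))
      (fun ζ : ℂ => (quad a ℓ Q κ y - κ * nsq w) +
        (ℓ + (1 / 2 : ℝ) • (Q y + Q.flip y) - κ • nsqL y) (ζ • w) +
          1 / 2 * Q (ζ • w) (ζ • w)) (sphere 0 |1|) := by
    intro ζ hζ
    have : ‖ζ‖ = 1 := by simpa using hζ
    simp only [quad, nsq_add y, map_add, add_apply, sub_apply, smul_apply, smul_eq_mul,
      ContinuousLinearMap.flip_apply, nsq_smul, this]
    ring
  unfold cmean
  rw [Real.circleAverage_congr_sphere h, circleAverage_quadratic]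
  ring

lemma lev_smul (Q : (Fin n → ℂ) →L[ℝ] (Fin n → ℂ) →L[ℝ] ℝ) (c : ℝ) (w : Fin n → ℂ) :
    lev Q (c • w) = c ^ 2 * lev Q w := by
  simp only [lev, smul_comm I c w, map_smul, smul_apply, smul_eq_mul]
  ring

lemma exists_pos_mul_nsq_le {Q : (Fin n → ℂ) →L[ℝ] (Fin n → ℂ) →L[ℝ] ℝ}
    (h : ∀ w, w ≠ 0 → 0 < lev Q w + nsq w) :
    ∃ δ > 0, ∀ w, δ * nsq w ≤ lev Q w + nsq w := by
  have hcn := continuous_nsq (n := n)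
  have hcl : Continuous fun w : Fin n → ℂ => lev Q w + nsq w := by
    unfold lev; fun_prop
  have hK : IsCompact {w : Fin n → ℂ | nsq w = 1} :=
    (isCompact_nsq_le 1).of_isClosed_subset (isClosed_eq hcn continuous_const)
      fun w (hw : nsq w = 1) => hw.le
  obtain ⟨δ, hδ, hS⟩ : ∃ δ > 0, ∀ w : Fin n → ℂ, nsq w = 1 → δ ≤ lev Q w + nsq w := by
    rcases Set.eq_empty_or_nonempty {w : Fin n → ℂ | nsq w = 1} with he | hne
    · exact ⟨1, one_pos, fun w hw => absurd (show w ∈ {w : Fin n → ℂ | nsq w = 1} from hw)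
        (he ▸ Set.notMem_empty w)⟩
    · obtain ⟨w₀, hw₀, hmin⟩ := hK.exists_isMinOn hne hcl.continuousOn
      refine ⟨lev Q w₀ + nsq w₀, h w₀ fun h0 => ?_, fun w hw => hmin hw⟩
      have h1 : nsq w₀ = 1 := hw₀
      rw [h0, nsq_zero] at h1
      exact zero_ne_one h1
  refine ⟨δ, hδ, fun w => ?_⟩
  by_cases hw : w = 0
  · subst hw
    simp [nsq_zero, lev]
  have hpos : 0 < nsq w := lt_of_le_of_ne (nsq_nonneg w) fun h0 => hw (nsq_eq_zero h0.symm)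
  have hs := Real.sq_sqrt hpos.le
  set t := Real.sqrt (nsq w) with ht
  have ht0 : 0 < t := Real.sqrt_pos.2 hpos
  have h1 := hS (t⁻¹ • w) (by rw [nsq_real_smul, ← hs]; field_simp)
  rw [lev_smul, nsq_real_smul] at h1
  have h2 : t⁻¹ ^ 2 * t ^ 2 = 1 := by field_simp
  have h3 : δ * t ^ 2 ≤ (t⁻¹ ^ 2 * lev Q w + t⁻¹ ^ 2 * nsq w) * t ^ 2 := by gcongr
  have h4 : (t⁻¹ ^ 2 * lev Q w + t⁻¹ ^ 2 * nsq w) * t ^ 2 = lev Q w + nsq w := by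
    linear_combination (lev Q w + nsq w) * h2
  rw [h4, hs] at h3
  exact h3

/-- The envelope is maximal off the contact set. -/
theorem exists_lev_le_of_pEnv_lt {φ : (Fin n → ℂ) → ℝ} {a : ℝ} (hφ : Continuous φ) (hper : Per φ)
    (ha : ∀ z, a ≤ φ z) {L : (Fin n → ℂ) → (Fin n → ℂ) →L[ℝ] ℝ}
    {Q : (Fin n → ℂ) →L[ℝ] (Fin n → ℂ) →L[ℝ] ℝ} {z : Fin n → ℂ}
    (hL : ∀ x, HasFDerivAt (pEnv φ) (L x) x) (hQ : HasFDerivAt L Q z)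
    (hz : pEnv φ z < φ z) : ∃ w, w ≠ 0 ∧ lev Q w + nsq w ≤ 0 := by
  by_contra! hcon
  obtain ⟨κ, hκ, hlev⟩ := exists_pos_mul_nsq_le hcon
  have hv : QP (pEnv φ) := QP.pEnv ha hper hφ.upperSemicontinuous
  have hvc : Continuous (pEnv φ) := continuous_iff_continuousAt.2 fun x => (hL x).continuousAt
  have ht := (isLittleO_taylor_two hL hQ).def (c := κ / 4) (by positivity)
  have hgap : ∀ᶠ y in 𝓝 (0 : Fin n → ℂ), pEnv φ (z + y) + (φ z - pEnv φ z) / 2 < φ (z + y) := by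
    have hc : Continuous fun y => φ (z + y) - (pEnv φ (z + y) + (φ z - pEnv φ z) / 2) := by
      fun_prop
    have := (hc.tendsto 0).eventually_const_lt (u := 0) (by rw [add_zero]; linarith)
    filter_upwards [this] with y hy
    linarith
  obtain ⟨ρ, hρ, hball⟩ := Metric.eventually_nhds_iff.1 (ht.and hgap)
  set g := φ z - pEnv φ z with hg
  have hg0 : 0 < g := sub_pos.2 hz
  obtain ⟨r, hr0, hr1, hr2, hr3⟩ : ∃ r > 0, r ≤ sepRad n ∧ r ≤ ρ ^ 2 ∧ κ * r ≤ g / 2 := by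
    refine ⟨min (sepRad n) (min (ρ ^ 2) (g / 2 / κ)),
      lt_min (sepRad_pos) (lt_min (by positivity) (by positivity)), min_le_left _ _,
      (min_le_right _ _).trans (min_le_left _ _), ?_⟩
    have : min (sepRad n) (min (ρ ^ 2) (g / 2 / κ)) ≤ g / 2 / κ :=
      (min_le_right _ _).trans (min_le_right _ _)
    calc _ ≤ κ * (g / 2 / κ) := by gcongr
      _ = g / 2 := by field_simp
  have hnear : ∀ x, nsq (x - z) < r → |pEnv φ x - pEnv φ z - L z (x - z) -
      1 / 2 * Q (x - z) (x - z)| ≤ κ / 4 * nsq (x - z) ∧ pEnv φ x + g / 2 < φ x := by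
    intro x hx
    have h1 : ‖x - z‖ < ρ := (abs_lt_of_sq_lt_sq' (by
      have := norm_sq_le_nsq (x - z); linarith) hρ.le).2
    obtain ⟨h2, h3⟩ := hball (y := x - z) (by simpa using h1)
    rw [add_sub_cancel] at h2 h3
    refine ⟨?_, h3⟩
    rw [Real.norm_eq_abs, Real.norm_of_nonneg (by positivity)] at h2
    have := norm_sq_le_nsq (x - z)
    exact h2.trans (by gcongr)
  set W : (Fin n → ℂ) → ℝ := fun x => quad (pEnv φ z + κ * r / 8) (L z) Q κ (x - z) with hW
  have hWc : Continuous W := (continuous_quad _ _ _ _).comp (by fun_prop)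
  have hWle : ∀ x, nsq (x - z) < r → W x ≤ pEnv φ x + κ * r / 8 - 3 / 4 * κ * nsq (x - z) := by
    intro x hx
    have := (abs_le.1 (hnear x hx).1).1
    simp only [hW, quad]
    linarith
  have hglue : QP (RelExt.glue z r (pEnv φ) W) := by
    refine QP.glue hv hr0 hr1 (hWc.upperSemicontinuous.upperSemicontinuousOn _) ?_ ?_
    · refine fun x _ w => Eventually.of_forall fun s => ⟨?_, ?_⟩
      · exact (Continuous.continuousOn (by fun_prop)).circleIntegrable zero_le_one
      · have h1 : cmean W x ((s : ℂ) • w) =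
            cmean (quad (pEnv φ z + κ * r / 8) (L z) Q κ) (x - z) ((s : ℂ) • w) := by
          simp only [cmean, hW, add_sub_right_comm]
        rw [h1, cmean_quad]
        have h2 := hlev ((s : ℂ) • w)
        have h3 : nsq ((s : ℂ) • w) = s ^ 2 * nsq w := by
            rw [nsq_smul, Complex.norm_real, Real.norm_eq_abs, sq_abs]
        rw [h3] at h2 ⊢
        simp only [hW]
        linarith
    · intro x hx hx4
      have := hWle x hx
      nlinarith
  have hper' : Per (RelExt.glue z r (pEnv φ) W) := hglue.per
  have hle : ∀ x, RelExt.glue z r (pEnv φ) W x ≤ φ x := by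
    intro x
    by_cases h : ∃ l ∈ lat n, nsq (x + l - z) < r
    · obtain ⟨l, hl, h⟩ := h
      rw [← hper' l hl x, ← hper l hl x, glue_of_mem hr1 _ _ h]
      have h1 := hWle _ h
      have h2 := (hnear _ h).2
      have h3 := mul_nonneg hκ.le (nsq_nonneg (x + l - z))
      refine max_le (pEnv_le ha _) ?_
      have : 0 ≤ κ * r := by positivity
      linarith
    · push Not at h
      rw [glue_of_forall _ _ h]
      exact pEnv_le ha x
  have h1 := le_pEnv hglue hle z
  have h0 : nsq (z - z) < r := by rw [sub_self, nsq_zero]; exact hr0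
  rw [glue_of_mem hr1 _ _ h0] at h1
  have h2 : W z = pEnv φ z + κ * r / 8 := by simp [hW, quad, nsq_zero]
  have h3 := (le_max_right _ _).trans h1
  rw [h2] at h3
  have : 0 < κ * r := by positivity
  linarith

lemma continuous_det_cmat : Continuous fun Q : (Fin n → ℂ) →L[ℝ] (Fin n → ℂ) →L[ℝ] ℝ =>
    (1 + cmat Q).det := by
  refine Continuous.matrix_det (continuous_const.add (continuous_matrix fun a b => ?_))
  simp only [cmat, Matrix.of_apply, hf]
  have h : ∀ v w : Fin n → ℂ,
      Continuous fun Q : (Fin n → ℂ) →L[ℝ] (Fin n → ℂ) →L[ℝ] ℝ => ((Q v w : ℝ) : ℂ) :=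
    fun v w => Complex.continuous_ofReal.comp
      ((continuous_id.clm_apply continuous_const).clm_apply continuous_const)
  exact continuous_const.mul (((h _ _).add (h _ _)).add
    (continuous_const.mul ((h _ _).sub (h _ _))))

lemma tendsto_det_cmat {q : ℕ → (Fin n → ℂ) →L[ℝ] (Fin n → ℂ) →L[ℝ] ℝ}
    {Q : (Fin n → ℂ) →L[ℝ] (Fin n → ℂ) →L[ℝ] ℝ}
    (h : ∀ v w, Tendsto (fun k => q k v w) atTop (𝓝 (Q v w))) :
    Tendsto (fun k => (1 + cmat (q k)).det) atTop (𝓝 (1 + cmat Q).det) := by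
  have h1 : Tendsto (fun k => cmat (q k)) atTop (𝓝 (cmat Q)) := by
    refine tendsto_pi_nhds.2 fun a => tendsto_pi_nhds.2 fun b => ?_
    have h2 : ∀ v w : Fin n → ℂ, Tendsto (fun k => ((q k v w : ℝ) : ℂ)) atTop (𝓝 (Q v w : ℝ)) :=
      fun v w => (Complex.continuous_ofReal.tendsto _).comp (h v w)
    simp only [cmat, Matrix.of_apply, hf]
    exact tendsto_const_nhds.mul (((h2 _ _).add (h2 _ _)).add
      (tendsto_const_nhds.mul ((h2 _ _).sub (h2 _ _))))
  have h3 : Continuous fun A : Matrix (Fin n) (Fin n) ℂ => (1 + A).det :=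
    Continuous.matrix_det (continuous_const.add continuous_id)
  exact (h3.tendsto _).comp h1

lemma exists_abs_le_of_norm_le {E : Type*} [NormedAddCommGroup E] [NormedSpace ℝ E]
    [FiniteDimensional ℝ E] {f : E → ℝ} (hf : Continuous f) (K : ℝ) :
    ∃ B, ∀ x, ‖x‖ ≤ K → |f x| ≤ B := by
  have : ProperSpace E := FiniteDimensional.proper ℝ E
  obtain ⟨B, hB⟩ := (isCompact_closedBall (0 : E) K).exists_bound_of_continuousOn hf.continuousOn
  exact ⟨B, fun x hx => hB x (mem_closedBall_zero_iff.2 hx)⟩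

lemma exists_abs_det_cmat_le (K : ℝ) : ∃ B, ∀ Q : (Fin n → ℂ) →L[ℝ] (Fin n → ℂ) →L[ℝ] ℝ,
    ‖Q‖ ≤ K → |((1 + cmat Q).det).re| ≤ B :=
  exists_abs_le_of_norm_le (E := (Fin n → ℂ) →L[ℝ] (Fin n → ℂ) →L[ℝ] ℝ)
    (f := fun Q => ((1 + cmat Q).det).re) (Complex.continuous_re.comp continuous_det_cmat) K

/-- The smooth approximants of an envelope carry almost no Monge-Ampère mass off the contact set. -/
theorem exists_GF_near_pEnv {φ : (Fin n → ℂ) → ℝ} (hφ : ContDiff ℝ ∞ φ) (hper : Per φ)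
    {η : ℝ} (hη : 0 < η) : ∃ f : GF n, (∀ x, |f x - pEnv φ x| ≤ η) ∧
      pr (fun x => φ x - pEnv φ x) (List.replicate n f) ≤ η := by
  obtain ⟨M, hM⟩ := hper.exists_bound hφ.continuous
  have ha : ∀ z, -M ≤ φ z := fun z => (abs_le.1 (hM z)).1
  have husc := hφ.continuous.upperSemicontinuous
  have hu : QP (pEnv φ) := QP.pEnv ha hper husc
  obtain ⟨C, hC0, hC⟩ := exists_SC hφ hper
  have hCu : SC C (pEnv φ) := hC.pEnv husc hper ha
  obtain ⟨L, hL, hLlip⟩ := hCu.exists_hasFDerivAt hu hC0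
  set K := 2 * ((4 + C) * n) with hK
  have hK0 : 0 ≤ K := by positivity
  have hLL : LipschitzWith ⟨K, hK0⟩ L := LipschitzWith.of_dist_le_mul fun x y => by
    rw [dist_eq_norm, dist_eq_norm]; exact hLlip x y
  have hcont : Continuous (pEnv φ) := hCu.continuous hu hC0
  have hd : BM fun x => φ x - pEnv φ x :=
    BM.sub (Per.bm hper hφ.continuous) hu.bm
  obtain ⟨D, hD⟩ := hd.bdd
  have hD0 : 0 ≤ D := (abs_nonneg _).trans (hD 0)
  obtain ⟨B, hB⟩ := exists_abs_det_cmat_le (n := n) K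
  have hlim : Tendsto (fun k => pr (fun x => φ x - pEnv φ x) (List.replicate n (mol hu k))) atTop
      (𝓝 (∫ x in cell n, (0 : ℝ))) := by
    refine tendsto_integral_of_dominated_convergence (fun _ => D * (n.factorial * B)) (fun k => ?_)
      (integrable_const _) (fun k => Eventually.of_forall fun x => ?_) ?_
    · exact (integrable_mul_MA hd _).aestronglyMeasurable
    · rw [norm_mul, Real.norm_eq_abs, MA_replicate, norm_mul, Real.norm_natCast, Real.norm_eq_abs]
      have h2 := hB _ (norm_hess_mol_le hu hC0 hCu k x)
      have h1 := hD x
      gcongr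
    · filter_upwards [ae_restrict_of_ae hLL.ae_differentiableAt] with z hz
      obtain ⟨Q, hQ⟩ := hz
      have hlimQ := fun v w => tendsto_hess_mol hu hL hLL.continuous hQ v w
      by_cases hcz : φ z - pEnv φ z = 0
      · simp [hcz]
      have hlt : pEnv φ z < φ z := lt_of_le_of_ne (pEnv_le ha z) fun h => hcz (by rw [h, sub_self])
      obtain ⟨w, hw0, hw⟩ := exists_lev_le_of_pEnv_lt hφ.continuous hper ha hL hQ hlt
      have hsymm : ∀ v w, Q v w = Q w v := fun v w =>
        tendsto_nhds_unique (hlimQ v w) (by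
          simp_rw [hess_symm (mol hu _).smooth z v w]
          exact hlimQ w v)
      have hdet : (1 + cmat Q).det = 0 := by
        refine det_cmat_eq_zero hsymm (fun v => ?_) hw0 hw
        exact QP.lev_nonneg hu (isLittleO_taylor_two hL hQ) v
      have h1 := (Complex.continuous_re.tendsto _).comp (tendsto_det_cmat hlimQ)
      rw [hdet, Complex.zero_re] at h1
      have h2 := (h1.const_mul (n.factorial : ℝ)).const_mul (φ z - pEnv φ z)
      simp only [mul_zero] at h2
      simp_rw [MA_replicate]
      exact h2
  rw [integral_zero] at hlim
  obtain ⟨ε₀, h0, hclose⟩ := exists_conv_kr_close hu.per hcont hη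
  obtain ⟨k, hk1, hk2⟩ := ((hlim.eventually_lt_const hη).and (eventually_inv_succ_lt h0)).exists
  exact ⟨mol hu k, hclose _ (by positivity) hk2, hk1.le⟩

lemma tendsto_mul_half_pow (c : ℝ) : Tendsto (fun l : ℕ => c * (1 / 2) ^ l) atTop (𝓝 0) := by
  simpa only [mul_zero] using (tendsto_pow_atTop_nhds_zero_of_lt_one
    (by norm_num : (0:ℝ) ≤ 1 / 2) (by norm_num)).const_mul c

lemma tendsto_pr {w : ℕ → (Fin n → ℂ) → ℝ} {w' : (Fin n → ℂ) → ℝ} {M : ℝ}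
    (hw : ∀ k, Measurable (w k)) (hM : ∀ k x, |w k x| ≤ M)
    (hlim : ∀ᵐ x, Tendsto (fun k => w k x) atTop (𝓝 (w' x))) (T : List (GF n)) :
    Tendsto (fun k => pr (w k) T) atTop (𝓝 (pr w' T)) := by
  obtain ⟨B, hB⟩ := (per_MA T).exists_bound (continuous_MA T)
  refine tendsto_integral_of_dominated_convergence (fun _ => M * B)
    (fun k => ((hw k).mul (continuous_MA T).measurable).aestronglyMeasurable)
    (integrable_const _) (fun k => .of_forall fun x => ?_) ?_
  · rw [Real.norm_eq_abs, abs_mul]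
    exact mul_le_mul (hM k x) (hB x) (abs_nonneg _) ((abs_nonneg _).trans (hM k x))
  · filter_upwards [ae_restrict_of_ae hlim] with x hx using hx.mul_const _

lemma per_lipEnv {g : (Fin n → ℂ) → ℝ} (hg : Per g) (k : ℝ) : Per (lipEnv g k) := by
  intro l hl z
  unfold lipEnv
  rw [← (Equiv.addRight l).iSup_comp]
  congr 1 with y
  simp [hg l hl y]

lemma tendsto_pEnv {φ : ℕ → (Fin n → ℂ) → ℝ} {ρ : (Fin n → ℂ) → ℝ} {a : ℝ}
    (ha : ∀ z, a ≤ ρ z) (hφ : ∀ l z, ρ z ≤ φ l z) (hper : ∀ l, Per (φ l))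
    (husc : ∀ l, UpperSemicontinuous (φ l)) (hanti : ∀ z, Antitone fun l => φ l z)
    (hlim : ∀ z, Tendsto (fun l => φ l z) atTop (𝓝 (ρ z))) (z : Fin n → ℂ) :
    Tendsto (fun l => pEnv (φ l) z) atTop (𝓝 (pEnv ρ z)) := by
  have haφ : ∀ l z, a ≤ φ l z := fun l z => (ha z).trans (hφ l z)
  have hqp : ∀ l, QP (pEnv (φ l)) := fun l => QP.pEnv (haφ l) (hper l) (husc l)
  have hmono : ∀ z, Antitone fun l => pEnv (φ l) z := fun z l j hlj =>
    pEnv_mono (haφ j) (fun x => hanti x hlj) z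
  have hbb : ∀ z, BddBelow (range fun l => pEnv (φ l) z) := fun z =>
    ⟨a, by rintro _ ⟨l, rfl⟩; exact const_le_pEnv (haφ l) z⟩
  have ht : ∀ z, Tendsto (fun l => pEnv (φ l) z) atTop (𝓝 (⨅ l, pEnv (φ l) z)) := fun z =>
    tendsto_atTop_ciInf (hmono z) (hbb z)
  obtain ⟨b, hb⟩ := (hper 0).bddAbove (husc 0)
  have hbd : ∀ l z, |pEnv (φ l) z| ≤ max |a| |b| := fun l z =>
    abs_le_max_abs_abs (const_le_pEnv (haφ l) z)
      ((hmono z (Nat.zero_le l)).trans ((pEnv_le (haφ 0) z).trans (hb z)))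
  have hP : QP (fun z => ⨅ l, pEnv (φ l) z) := by
    refine ⟨upperSemicontinuous_ciInf (fun z => hbb z) fun l => (hqp l).usc, fun l hl z => ?_,
      ⟨a, fun z => le_ciInf fun l => const_le_pEnv (haφ l) z⟩, fun z v => ?_⟩
    · congr 1 with j
      exact (hqp j).per l hl z
    · have h1 : Tendsto (fun l => cmean (pEnv (φ l)) z v + nsq v) atTop
          (𝓝 (cmean (fun z => ⨅ l, pEnv (φ l) z) z v + nsq v)) := by
        refine Tendsto.add_const _ (tendsto_circleAverage_of_bounded (M := max |a| |b|) (fun l => ?_)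
          (fun l x => hbd l _) fun x => ht _)
        exact (hqp l).bm.meas.comp (by fun_prop)
      exact le_of_tendsto_of_tendsto (ht z) h1 (.of_forall fun l => (hqp l).sub z v)
  have hPρ : ∀ z, (⨅ l, pEnv (φ l) z) ≤ ρ z := fun z =>
    le_of_tendsto_of_tendsto (ht z) (hlim z) (.of_forall fun l => pEnv_le (haφ l) z)
  have : (⨅ l, pEnv (φ l) z) = pEnv ρ z :=
    le_antisymm (le_pEnv hP hPρ z) (le_ciInf fun l => pEnv_mono ha (hφ l) z)
  rw [← this]
  exact ht z

lemma continuous_pEnv {φ : (Fin n → ℂ) → ℝ} (hφ : ContDiff ℝ ∞ φ) (hper : Per φ) :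
    Continuous (pEnv φ) := by
  obtain ⟨M, hM⟩ := hper.exists_bound hφ.continuous
  have ha : ∀ z, -M ≤ φ z := fun z => (abs_le.1 (hM z)).1
  have hc := hφ.continuous.upperSemicontinuous
  obtain ⟨C, hC, hSC⟩ := exists_SC hφ hper
  exact SC.continuous (QP.pEnv ha hper hc) hC (hSC.pEnv hc hper ha)

/-- A periodic upper semicontinuous function is a decreasing limit of smooth periodic functions. -/
lemma exists_smooth_antitone {ρ : (Fin n → ℂ) → ℝ} (hper : Per ρ)
    (husc : UpperSemicontinuous ρ) {b : ℝ} (hb : ∀ z, ρ z ≤ b) {ε : ℝ} (hε : 0 < ε) :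
    ∃ φ : ℕ → (Fin n → ℂ) → ℝ, (∀ l, ContDiff ℝ ∞ (φ l)) ∧ (∀ l, Per (φ l)) ∧
      (∀ l z, ρ z ≤ φ l z) ∧ (∀ l z, φ l z ≤ b + ε) ∧ (∀ z, Antitone fun l => φ l z) ∧
      ∀ z, Tendsto (fun l => φ l z) atTop (𝓝 (ρ z)) := by
  set θ : ℕ → ℝ := fun l => ε / 4 * (1 / 2) ^ l with hθ
  have hθ0 : ∀ l, 0 < θ l := fun l => by positivity
  have hθs : ∀ l, θ (l + 1) = θ l / 2 := fun l => by simp only [hθ, pow_succ]; ring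
  have hθl : Tendsto θ atTop (𝓝 0) := tendsto_mul_half_pow _
  have hθb : ∀ l, θ l ≤ ε / 4 := fun l =>
    mul_le_of_le_one_right (by positivity) (pow_le_one₀ (by norm_num) (by norm_num))
  have hk : ∀ l : ℕ, (0 : ℝ) ≤ l := fun l => l.cast_nonneg
  have hlp := fun l : ℕ => per_lipEnv hper l
  have hlc := fun l : ℕ => continuous_lipEnv (X := Fin n → ℂ) hb (hk l)
  choose ε₀ hε₀ hcl using fun l => exists_conv_kr_close (hlp l) (hlc l) (hθ0 l)
  have hcl' : ∀ l z, |conv (kr (ε₀ l / 2)) (lipEnv ρ l) z - lipEnv ρ l z| ≤ θ l := fun l =>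
    hcl l _ (half_pos (hε₀ l)) (half_lt_self (hε₀ l))
  have hlo : ∀ (l : ℕ) z, lipEnv ρ l z + 2 * θ l ≤ conv (kr (ε₀ l / 2)) (lipEnv ρ l) z + 3 * θ l := by
    intro l z; have := abs_le.1 (hcl' l z); linarith
  have hhi : ∀ (l : ℕ) z, conv (kr (ε₀ l / 2)) (lipEnv ρ l) z + 3 * θ l ≤ lipEnv ρ l z + 4 * θ l := by
    intro l z; have := abs_le.1 (hcl' l z); linarith
  refine ⟨fun l z => conv (kr (ε₀ l / 2)) (lipEnv ρ l) z + 3 * θ l, fun l => ?_, fun l => ?_,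
    fun l z => ?_, fun l z => ?_, fun z => antitone_nat_of_succ_le fun l => ?_, fun z => ?_⟩
  · exact (contDiff_conv_kr (half_pos (hε₀ l)) ((hlp l).bm (hlc l))).add contDiff_const
  · exact (hlp l).conv.comp fun x => x + 3 * θ l
  · have := le_lipEnv (X := Fin n → ℂ) hb (hk l) z
    linarith [hlo l z, hθ0 l]
  · have := lipEnv_le (X := Fin n → ℂ) hb (hk l) z
    linarith [hhi l z, hθb l]
  · have := lipEnv_anti (X := Fin n → ℂ) hb (hk l) (l := ((l + 1 : ℕ) : ℝ)) (by simp) z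
    linarith [hhi (l + 1) z, hlo l z, hθs l]
  · have hL := tendsto_lipEnv (X := Fin n → ℂ) hb husc z
    refine tendsto_of_tendsto_of_tendsto_of_le_of_le (g := fun l : ℕ => lipEnv ρ l z + 2 * θ l)
      (h := fun l : ℕ => lipEnv ρ l z + 4 * θ l) ?_ ?_ (fun l => hlo l z) (fun l => hhi l z)
    · simpa using hL.add (hθl.const_mul 2)
    · simpa using hL.add (hθl.const_mul 4)

/-- Simultaneous approximation of a periodic obstacle and of its envelope. -/
lemma exists_approx_pEnv {ρ : (Fin n → ℂ) → ℝ} {a : ℝ} (ha : ∀ z, a ≤ ρ z) (hper : Per ρ)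
    (husc : UpperSemicontinuous ρ) {b : ℝ} (hb : ∀ z, ρ z ≤ b) {M : ℝ} (hMa : -M ≤ a - 1)
    (hMb : b + 2 ≤ M) {ε : ℝ} (hε : 0 < ε) (hε1 : ε ≤ 1) :
    ∃ (φ : (Fin n → ℂ) → ℝ) (f : GF n), BM φ ∧ (∀ z, ρ z ≤ φ z) ∧ Continuous (pEnv φ) ∧
      QP (pEnv φ) ∧
      (∀ z, pEnv ρ z ≤ pEnv φ z) ∧ (∀ z, |f z - pEnv φ z| ≤ ε) ∧
      pr (fun x => φ x - pEnv φ x) (List.replicate n f) ≤ ε ∧ (∀ z, |f z| ≤ M) ∧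
      (∀ z, f z ≤ b + 2 * ε) ∧
      ∀ T : List (GF n), T.length = n → (∀ q ∈ T, ∀ x, |q x| ≤ M) →
        pr (fun x => f x - pEnv ρ x) T ≤ ε := by
  obtain ⟨φ, hφ, hφp, hρφ, hφb, hanti, hlim⟩ := exists_smooth_antitone hper husc hb hε
  have haφ : ∀ l z, a ≤ φ l z := fun l z => (ha z).trans (hρφ l z)
  have hφu := fun l => (hφ l).continuous.upperSemicontinuous
  have hqp : ∀ l, QP (pEnv (φ l)) := fun l => QP.pEnv (haφ l) (hφp l) (hφu l)
  set θ : ℕ → ℝ := fun l => ε * (1 / 2) ^ l with hθ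
  have hθ0 : ∀ l, 0 < θ l := fun l => by positivity
  have hθl : Tendsto θ atTop (𝓝 0) := tendsto_mul_half_pow _
  have hθb : ∀ l, θ l ≤ ε := fun l =>
    mul_le_of_le_one_right (by positivity) (pow_le_one₀ (by norm_num) (by norm_num))
  have hθa : ∀ k j, k ≤ j → θ j ≤ θ k := fun k j h =>
    mul_le_mul_of_nonneg_left (pow_le_pow_of_le_one (by norm_num) (by norm_num) h) hε.le
  choose f hf1 hf2 using fun l => exists_GF_near_pEnv (hφ l) (hφp l) (hθ0 l)
  have hfM : ∀ l z, |f l z| ≤ M := fun l z => by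
    have h1 := abs_le.1 (hf1 l z)
    have h2 := const_le_pEnv (haφ l) z
    have h3 := (pEnv_le (haφ l) z).trans (hφb l z)
    have := hθb l
    exact abs_le.2 ⟨by linarith, by linarith⟩
  have hdec : ∀ k j, k ≤ j → ∀ x, f j x ≤ f k x + 2 * θ k := fun k j hkj x => by
    have h1 := abs_le.1 (hf1 k x)
    have h2 := abs_le.1 (hf1 j x)
    have h3 := pEnv_mono (haφ j) (fun y => hanti y hkj) x
    linarith [hθa k j hkj]
  obtain ⟨K, hK⟩ := exists_pr_le_of_almost_decreasing hfM (by simpa using hθl.const_mul 2) hdec hε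
  have hmono : ∀ z, pEnv ρ z ≤ pEnv (φ K) z := pEnv_mono ha (hρφ K)
  refine ⟨φ K, f K, (hφp K).bm (hφ K).continuous, hρφ K, continuous_pEnv (hφ K) (hφp K), hqp K,
    hmono, fun z => (hf1 K z).trans (hθb K), (hf2 K).trans (hθb K), hfM K, fun z => ?_,
    fun T hT hTM => ?_⟩
  · have h1 := abs_le.1 (hf1 K z)
    have h3 := (pEnv_le (haφ K) z).trans (hφb K z)
    linarith [hθb K]
  have ht : ∀ z, Tendsto (fun j => f j z) atTop (𝓝 (pEnv ρ z)) := fun z => by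
    have h1 := tendsto_pEnv ha hρφ hφp hφu hanti hlim z
    have h2 : Tendsto (fun j => f j z - pEnv (φ j) z) atTop (𝓝 0) :=
      squeeze_zero_norm (fun j => hf1 j z) hθl
    simpa using h2.add h1
  refine le_of_tendsto (tendsto_pr (M := M + M) (w := fun j x => f K x - f j x) (fun j => ?_)
    (fun j x => ?_) (.of_forall fun x => (ht x).const_sub (f K x)) T) ?_
  · exact (f K).bm.meas.sub (f j).bm.meas
  · exact (abs_sub _ _).trans (add_le_add (hfM K x) (hfM j x))
  · filter_upwards [eventually_ge_atTop K] with j hj using hK K j le_rfl hj T hT hTM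

/-- Open lattice-invariant neighbourhoods of a set. -/
structure Adm (N O : Set (Fin n → ℂ)) : Prop where
  isOpen : IsOpen O
  subset : N ⊆ O
  per : Per fun z => z ∈ O

/-- The obstacle equal to `-c` on `O` and to `0` elsewhere. -/
def obst (c : ℝ) (O : Set (Fin n → ℂ)) : (Fin n → ℂ) → ℝ := O.indicator fun _ => -c

section obst

variable {c : ℝ} {N O O' : Set (Fin n → ℂ)}

lemma obst_of_mem {z : Fin n → ℂ} (h : z ∈ O) : obst c O z = -c := indicator_of_mem h _

lemma obst_of_notMem {z : Fin n → ℂ} (h : z ∉ O) : obst c O z = 0 := indicator_of_notMem h _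

lemma neg_le_obst (hc : 0 ≤ c) (z : Fin n → ℂ) : -c ≤ obst c O z := by
  by_cases h : z ∈ O
  · rw [obst_of_mem h]
  · rw [obst_of_notMem h]; linarith

lemma obst_le_zero (hc : 0 ≤ c) (z : Fin n → ℂ) : obst c O z ≤ 0 := by
  by_cases h : z ∈ O
  · rw [obst_of_mem h]; linarith
  · rw [obst_of_notMem h]

lemma obst_anti (hc : 0 ≤ c) (h : O' ⊆ O) (z : Fin n → ℂ) : obst c O z ≤ obst c O' z := by
  by_cases h1 : z ∈ O'
  · rw [obst_of_mem h1, obst_of_mem (h h1)]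
  · rw [obst_of_notMem h1]; exact obst_le_zero hc z

lemma per_obst (h : Adm N O) : Per (obst c O) := fun l hl z => by
  have := h.per l hl z
  classical
  simp only [obst, indicator_apply]
  simp only [this]

lemma usc_obst (hc : 0 ≤ c) (h : IsOpen O) : UpperSemicontinuous (obst c O) :=
  h.upperSemicontinuous_indicator (by linarith)

lemma qp_obst (hc : 0 ≤ c) (h : Adm N O) : QP (pEnv (obst c O)) :=
  QP.pEnv (neg_le_obst hc) (per_obst h) (usc_obst hc h.isOpen)

lemma pEnv_obst_anti (hc : 0 ≤ c) (h : O' ⊆ O) (z : Fin n → ℂ) :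
    pEnv (obst c O) z ≤ pEnv (obst c O') z :=
  pEnv_mono (neg_le_obst hc) (obst_anti hc h) z

lemma pEnv_obst_le_zero (hc : 0 ≤ c) (z : Fin n → ℂ) : pEnv (obst c O) z ≤ 0 :=
  (pEnv_le (neg_le_obst hc) z).trans (obst_le_zero hc z)

lemma neg_le_pEnv_obst (hc : 0 ≤ c) (z : Fin n → ℂ) : -c ≤ pEnv (obst c O) z :=
  const_le_pEnv (neg_le_obst hc) z

lemma pEnv_obst_of_mem (hc : 0 ≤ c) {z : Fin n → ℂ} (hz : z ∈ O) : pEnv (obst c O) z = -c :=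
  le_antisymm ((pEnv_le (neg_le_obst hc) z).trans (obst_of_mem hz).le) (neg_le_pEnv_obst hc z)

lemma Adm.univ : Adm N univ := ⟨isOpen_univ, subset_univ _, fun _ _ _ => rfl⟩

lemma Adm.inter (h : Adm N O) (h' : Adm N O') : Adm N (O ∩ O') :=
  ⟨h.isOpen.inter h'.isOpen, subset_inter h.subset h'.subset, fun l hl z => by
    have h1 := h.per l hl z
    have h2 := h'.per l hl z
    simp only [mem_inter_iff]
    simp only [h1, h2]⟩

/-- Choquet's lemma for the envelopes of the obstacles attached to a set. -/
lemma exists_adm_limit (hc : 0 ≤ c) (N : Set (Fin n → ℂ)) :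
    ∃ (O : ℕ → Set (Fin n → ℂ)) (H : (Fin n → ℂ) → ℝ), (∀ k, Adm N (O k)) ∧ Antitone O ∧ QP H ∧
      (∀ z, H z ≤ 0) ∧ (∀ᵐ z, Tendsto (fun k => pEnv (obst c (O k)) z) atTop (𝓝 (H z))) ∧
      ∀ O', Adm N O' → ∀ z, pEnv (obst c O') z ≤ H z := by
  set I : Set (Fin n → ℂ) → ℝ := fun O => ∫ z in cell n, pEnv (obst c O) z with hI
  have hint : ∀ {O}, Adm N O → IntegrableOn (pEnv (obst c O)) (cell n) := fun h =>
    (qp_obst hc h).bm.integrableOn_cell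
  have hI0 : ∀ {O}, Adm N O → I O ≤ 0 := fun h =>
    integral_nonpos fun z => pEnv_obst_le_zero hc z
  have hne : (I '' {O | Adm N O}).Nonempty := ⟨_, univ, Adm.univ, rfl⟩
  have hbd : BddAbove (I '' {O | Adm N O}) := ⟨0, by rintro _ ⟨O, hO, rfl⟩; exact hI0 hO⟩
  obtain ⟨x, -, hx, hxm⟩ := exists_seq_tendsto_sSup hne hbd
  choose B hB hBx using hxm
  have key : ∀ B : ℕ → Set (Fin n → ℂ), (∀ k, Adm N (B k)) → Antitone B →
      (∀ k, x k ≤ I (B k)) → ∃ H, QP H ∧ (∀ k z, pEnv (obst c (B k)) z ≤ H z) ∧ (∀ z, H z ≤ 0) ∧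
      (∀ᵐ z, Tendsto (fun k => pEnv (obst c (B k)) z) atTop (𝓝 (H z))) ∧
      ∫ z in cell n, H z = sSup (I '' {O | Adm N O}) := by
    intro B hB hanti hle
    obtain ⟨H, hH, h1, h2, h3⟩ := exists_QP_limit (fun k => qp_obst hc (hB k))
      (fun z k j hkj => pEnv_obst_anti hc (hanti hkj) z) fun k z => pEnv_obst_le_zero hc z
    refine ⟨H, hH, h1, h2, h3, ?_⟩
    have ht : Tendsto (fun k => I (B k)) atTop (𝓝 (∫ z in cell n, H z)) := by
      refine tendsto_integral_of_dominated_convergence (fun _ => c)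
        (fun k => (qp_obst hc (hB k)).bm.meas.aestronglyMeasurable) (integrable_const _)
        (fun k => .of_forall fun z => ?_) (ae_restrict_of_ae h3)
      exact abs_le.2 ⟨neg_le_pEnv_obst hc z, (pEnv_obst_le_zero hc z).trans hc⟩
    refine tendsto_nhds_unique ht (tendsto_of_tendsto_of_tendsto_of_le_of_le hx tendsto_const_nhds
      hle fun k => le_csSup hbd ⟨_, hB k, rfl⟩)
  have hO : ∀ k, Adm N (⋂ i ∈ Finset.range (k + 1), B i) := by
    intro k
    refine ⟨isOpen_biInter_finset fun i _ => (hB i).isOpen, subset_iInter₂ fun i _ => (hB i).subset,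
      fun l hl z => ?_⟩
    simp only [mem_iInter]
    have := fun i => (hB i).per l hl z
    simp only [this]
  have hanti : Antitone fun k => ⋂ i ∈ Finset.range (k + 1), B i := fun k j hkj =>
    biInter_subset_biInter_left (by
      intro i hi
      simp only [Finset.coe_range, mem_Iio] at hi ⊢
      omega)
  have hle : ∀ k, x k ≤ I (⋂ i ∈ Finset.range (k + 1), B i) := fun k => by
    rw [← hBx]
    exact integral_mono (hint (hB k)) (hint (hO k)) fun z => pEnv_obst_anti hc
      (biInter_subset_of_mem (by simp)) z
  obtain ⟨H, hH, h1, h2, h3, h4⟩ := key _ hO hanti hle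
  refine ⟨_, H, hO, hanti, hH, h2, h3, fun O' hO' => ?_⟩
  obtain ⟨H', hH', h1', h2', h3', h4'⟩ := key (fun k => O' ∩ ⋂ i ∈ Finset.range (k + 1), B i)
    (fun k => hO'.inter (hO k)) (fun k j hkj => inter_subset_inter_right _ (hanti hkj))
    fun k => (hle k).trans (integral_mono (hint (hO k)) (hint (hO'.inter (hO k)))
      fun z => pEnv_obst_anti hc inter_subset_right z)
  have hHH' : ∀ᵐ z, H z ≤ H' z := by
    filter_upwards [h3] with z hz
    exact le_of_tendsto hz (.of_forall fun k =>
      (pEnv_obst_anti hc inter_subset_right z).trans (h1' k z))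
  have heq : ∀ᵐ z ∂(volume.restrict (cell n)), H' z - H z = 0 := by
    refine (integral_eq_zero_iff_of_nonneg_ae ?_ (hH'.bm.sub hH.bm).integrableOn_cell).1 ?_
    · filter_upwards [ae_restrict_of_ae hHH'] with z hz using sub_nonneg.2 hz
    · rw [integral_sub hH'.bm.integrableOn_cell hH.bm.integrableOn_cell, h4, h4', sub_self]
  refine QP.le_of_ae_le (qp_obst hc hO') hH.bm hH.usc ?_
  have hp : Per fun z => H' z - H z = 0 := fun l hl z => by
    simp only [hH'.per l hl z, hH.per l hl z]
  filter_upwards [ae_of_ae_cell hp heq] with z hz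
  have := (pEnv_obst_anti hc (inter_subset_left (t := ⋂ i ∈ Finset.range (0 + 1), B i)) z).trans
    (h1' 0 z)
  linarith

end obst

/-- If the obstacle problems attached to a set `N` are not solved by `-c`, then `N` is contained in
the minimum set of quasi-plurisubharmonic functions of small mass. -/
theorem exists_QP_small {c t : ℝ} (ht : 0 < t) (htc : t < c) {N : Set (Fin n → ℂ)}
    (hN : ∀ a ∈ N, ∀ U, IsOpen U → a ∈ U →
      ∃ O, Adm N O ∧ ∃ x ∈ U, -c + t < pEnv (obst c O) x) {η : ℝ} (hη : 0 < η) :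
    ∃ w, QP w ∧ (∀ z, -c ≤ w z) ∧ (∀ z, w z ≤ 0) ∧ (∀ z ∈ N, w z ≤ -c) ∧
      ∫ z in cell n, -w z ≤ η := by
  have hc : 0 ≤ c := by linarith
  obtain ⟨O, H, hO, hOa, hH, hH0, hlim, hmax⟩ := exists_adm_limit hc N
  have hcH : ∀ z, -c ≤ H z := fun z => (neg_le_pEnv_obst hc z).trans (hmax _ (hO 0) z)
  have hNH : ∀ a ∈ N, -c + t ≤ H a := by
    intro a ha
    by_contra! hlt
    obtain ⟨U, hU, hUo, haU⟩ := _root_.eventually_nhds_iff.1 (hH.usc a _ hlt)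
    obtain ⟨O', hO', x, hx, hlt'⟩ := hN a ha U hUo haU
    linarith [hmax O' hO' x, hU x hx]
  have hm := mass_pos (n := n)
  set m := mass n with hmdef
  obtain ⟨δ, hδ, hCS⟩ := exists_pr_sub_le_of_length_eq (n := n) (c + 2) (half_pos hη)
  set B : ℝ := (2 + m) + 2 * c / t * (4 + 2 * m) + m + 2 with hB
  have hB0 : 0 < B := by positivity
  obtain ⟨ε, hε, hε1, hεη, hεδ⟩ : ∃ ε : ℝ, 0 < ε ∧ ε ≤ 1 ∧ ε ≤ η / 2 ∧ B * ε ≤ δ := by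
    refine ⟨min (min 1 (η / 2)) (δ / B), by positivity, (min_le_left _ _).trans (min_le_left _ _),
      (min_le_left _ _).trans (min_le_right _ _), ?_⟩
    calc B * _ ≤ B * (δ / B) := mul_le_mul_of_nonneg_left (min_le_right _ _) hB0.le
      _ = δ := by field_simp
  have hHenv : ∀ z, pEnv H z = H z := fun z =>
    le_antisymm (pEnv_le hcH z) (le_pEnv hH (fun _ => le_rfl) z)
  obtain ⟨φ, g, -, -, hGc, hGq, hHG, hgG, -, hgM, -, hgH⟩ := exists_approx_pEnv hcH hH.per hH.usc hH0
    (M := c + 2) (by linarith) (by linarith) hε hε1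
  simp only [hHenv] at hHG hgH
  set O' : ℕ → Set (Fin n → ℂ) := fun k => O k ∩ {z | -c + t / 2 < pEnv φ z} with hO'def
  have hO' : ∀ k, Adm N (O' k) := fun k => (hO k).inter
    ⟨isOpen_lt continuous_const hGc, fun a ha => by
      have := hNH a ha
      have := hHG a
      show -c + t / 2 < pEnv φ a
      linarith, fun l hl z => by
        show (-c + t / 2 < _) = (-c + t / 2 < _)
        rw [hGq.per l hl z]⟩
  have hO'a : Antitone O' := fun k j h => inter_subset_inter_left _ (hOa h)
  set w : ℕ → (Fin n → ℂ) → ℝ := fun k => pEnv (obst c (O' k)) with hw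
  have hwq : ∀ k, QP (w k) := fun k => qp_obst hc (hO' k)
  have hwH : ∀ k z, w k z ≤ H z := fun k z => hmax _ (hO' k) z
  have hwlim : ∀ᵐ z, Tendsto (fun k => w k z) atTop (𝓝 (H z)) := by
    filter_upwards [hlim] with z hz
    exact tendsto_of_tendsto_of_tendsto_of_le_of_le hz tendsto_const_nhds
      (fun k => pEnv_obst_anti hc inter_subset_left z) fun k => hwH k z
  set e : ℕ → ℝ := fun k => ε * (1 / 2) ^ k with he
  have he0 : ∀ k, 0 < e k := fun k => by positivity
  have hel : Tendsto e atTop (𝓝 0) := tendsto_mul_half_pow ε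
  have heb : ∀ k, e k ≤ ε := fun k =>
    mul_le_of_le_one_right hε.le (pow_le_one₀ (by norm_num) (by norm_num))
  have hea : ∀ k j, k ≤ j → e j ≤ e k := fun k j h =>
    mul_le_mul_of_nonneg_left (pow_le_pow_of_le_one (by norm_num) (by norm_num) h) hε.le
  choose φ' v hφ'm hφ'ρ _ hφ'q hwφ' hvφ' hφ'v hvM hv0 hvw using fun k =>
    exists_approx_pEnv (neg_le_obst (O := O' k) hc) (per_obst (hO' k))
      (usc_obst hc (hO' k).isOpen) (obst_le_zero hc) (M := c + 2) (by linarith) (by linarith)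
      (he0 k) ((heb k).trans hε1)
  have hvw' : ∀ k z, -e k ≤ v k z - w k z := fun k z => by
    have h1 := abs_le.1 (hvφ' k z)
    have h2 := hwφ' k z
    simp only [hw]
    linarith
  have hvb := fun k => (v k).bm
  have hwb := fun k => (hwq k).bm
  obtain ⟨K, hK⟩ := exists_pr_le_of_almost_increasing (v := v) (η := fun k => e k * m + e k) hvM
    (by simpa using (hel.mul_const m).add hel) (fun k j hkj T hT hTM => by
      have h1 := le_pr hT ((hvb j).sub (hwb j)) (hvw' j)
      have h2 : 0 * mass n ≤ pr (fun x => w j x - w k x) T := le_pr hT ((hwb j).sub (hwb k)) fun x =>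
        sub_nonneg.2 (pEnv_obst_anti hc (hO'a hkj) x)
      have h3 := hvw k T hT hTM
      rw [pr_sub (hvb _) (hwb _)] at h1 h3
      rw [pr_sub (hwb _) (hwb _)] at h2
      rw [pr_sub (hvb _) (hvb _)]
      change pr (v k) T - pr (w k) T ≤ e k at h3
      have := mul_le_mul_of_nonneg_right (hea k j hkj) hm.le
      linarith) hε
  set μ := List.replicate n (v K) with hμ
  have hμl : μ.length = n := List.length_replicate
  have hμM : ∀ q ∈ μ, ∀ x, |q x| ≤ c + 2 := fun q hq => by
    rw [List.eq_of_mem_replicate hq]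
    exact hvM K
  obtain ⟨j, hKj, hj⟩ : ∃ j, K ≤ j ∧ pr (fun x => H x - w j x) μ ≤ ε := by
    have h1 : Tendsto (fun j => pr (fun x => H x - w j x) μ) atTop (𝓝 (pr (fun _ => 0) μ)) := by
      refine tendsto_pr (w := fun j x => H x - w j x) (M := c) (fun j => hH.bm.meas.sub (hwb j).meas) (fun j x => ?_) ?_ μ
      · have := hwH j x
        have := hH0 x
        have : -c ≤ w j x := neg_le_pEnv_obst hc x
        exact abs_le.2 ⟨by linarith, by linarith⟩
      · filter_upwards [hwlim] with z hz
        simpa using hz.const_sub (H z)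
    rw [pr_const hμl, zero_mul] at h1
    obtain ⟨j, h2, h3⟩ := ((eventually_ge_atTop K).and (h1.eventually (ge_mem_nhds hε))).exists
    exact ⟨j, h2, h3⟩
  have hgv : pr g μ - pr (v K) μ ≤ (3 + m) * ε := by
    have h1 := hgH μ hμl hμM
    have h2 := le_pr hμl ((hvb j).sub (hwb j)) (hvw' j)
    have h3 := hK K j le_rfl hKj
    rw [pr_sub g.bm hH.bm] at h1
    rw [pr_sub (hvb _) (hwb _)] at h2
    rw [pr_sub (hvb _) (hvb _)] at h3
    rw [pr_sub hH.bm (hwb _)] at hj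
    have := mul_le_mul_of_nonneg_right (heb j) hm.le
    linarith
  have hvwK : pr (v K) μ - pr (w K) μ ≤ ε := by
    have := hvw K μ hμl hμM
    rw [pr_sub (hvb _) (qp_obst hc (hO' K)).bm] at this
    exact this.trans (heb K)
  have hρb : BM (obst c (O' K)) :=
    BM.of_usc (usc_obst hc (hO' K).isOpen) (neg_le_obst hc) (obst_le_zero hc)
  have hρw : pr (obst c (O' K)) μ - pr (w K) μ ≤ (2 + m) * ε := by
    have h1 := hφ'v K
    have h2 : pr (fun x => pEnv (φ' K) x - v K x) μ ≤ ε * m := pr_le hμl ((hφ'q K).bm.sub (hvb K))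
      fun x => by
        have h1 := abs_le.1 (hvφ' K x)
        linarith [heb K]
    have h3 := pr_mono hρb (hφ'm K) (hφ'ρ K) μ
    rw [pr_sub (hφ'm K) (hφ'q K).bm] at h1
    rw [pr_sub (hφ'q K).bm (hvb _)] at h2
    linarith [heb K]
  have hpt : ∀ z, -w K z ≤ (obst c (O' K) z - w K z) + 2 * c / t * (g z - w K z + ε) := by
    intro z
    have h1 := abs_le.1 (hgG z)
    by_cases hz : z ∈ O' K
    · have h2 : w K z = -c := pEnv_obst_of_mem hc hz
      have h3 : -c + t / 2 < pEnv φ z := hz.2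
      rw [obst_of_mem hz, h2]
      have : 2 * c / t * (t / 2) ≤ 2 * c / t * (g z - -c + ε) :=
        mul_le_mul_of_nonneg_left (by linarith) (by positivity)
      have h4 : 2 * c / t * (t / 2) = c := by field_simp
      linarith
    · rw [obst_of_notMem hz]
      have : 0 ≤ 2 * c / t * (g z - w K z + ε) :=
        mul_nonneg (by positivity) (by linarith [hwH K z, hHG z])
      linarith
  have hneg : -pr (w K) μ ≤ ((2 + m) + 2 * c / t * (4 + 2 * m)) * ε := by
    have h1 := pr_mono ((hwb K).const_mul (-1)) ((hρb.sub (hwb K)).add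
      (((g.bm.sub (hwb K)).add (BM.const ε)).const_mul (2 * c / t)))
      (fun z => by simpa using hpt z) μ
    rw [pr_const_mul, pr_add (hρb.sub (hwb K))
      (((g.bm.sub (hwb K)).add (BM.const ε)).const_mul (2 * c / t)), pr_const_mul,
      pr_add (g.bm.sub (hwb K)) (BM.const ε), pr_sub hρb (hwb K), pr_sub g.bm (hwb K),
      pr_const hμl] at h1
    have h2 : 2 * c / t * (pr g μ - pr (w K) μ + ε * mass n) ≤ 2 * c / t * ((4 + 2 * m) * ε) :=
      mul_le_mul_of_nonneg_left (by rw [← hmdef]; linarith) (by positivity)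
    linarith
  have hzM : ∀ x, |(0 : GF n) x| ≤ c + 2 := fun x => by
    rw [GF.zero_apply, abs_zero]
    positivity
  have hCS' := hCS 0 (v K) hzM (hvM K) (fun x => by
      rw [GF.zero_apply]
      have h1 := hv0 K x
      have h2 : 2 * ε ≤ B * ε := mul_le_mul_of_nonneg_right (by rw [hB]; linarith [show 0 ≤ 2 * c / t * (4 + 2 * m) by positivity]) hε.le
      linarith [heb K]) (by
      rw [pr_sub (0 : GF n).bm (hvb K)]
      have h1 : pr ((0 : GF n) : (Fin n → ℂ) → ℝ) μ = 0 := by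
        have h0 : ((0 : GF n) : (Fin n → ℂ) → ℝ) = fun _ => 0 := funext fun x => GF.zero_apply x
        rw [h0, pr_const hμl, zero_mul]
      have h2 := le_pr hμl ((hvb K).sub (hwb K)) (hvw' K)
      rw [pr_sub (hvb _) (hwb _)] at h2
      have h3 := mul_le_mul_of_nonneg_right (heb K) hm.le
      rw [h1]
      have : B * ε = ((2 + m) + 2 * c / t * (4 + 2 * m)) * ε + m * ε + 2 * ε := by rw [hB]; ring
      linarith) (List.replicate n 0) List.length_replicate (fun q hq x => by
        rw [List.eq_of_mem_replicate hq]
        exact hzM x)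
  have hvw0 := hvw K (List.replicate n 0) List.length_replicate (fun q hq x => by
    rw [List.eq_of_mem_replicate hq]
    exact hzM x)
  refine ⟨w K, hwq K, fun z => neg_le_pEnv_obst hc z, fun z => pEnv_obst_le_zero hc z,
    fun z hz => (pEnv_obst_of_mem hc ((hO' K).subset hz)).le, ?_⟩
  have hfin : n.factorial * ∫ z in cell n, -w K z ≤ η := by
    rw [← pr_replicate_zero]
    have h1 := pr_mono ((hwb K).const_mul (-1)) (((0 : GF n).bm.sub (hvb K)).add ((hvb K).sub (hwb K)))
      (fun z => by rw [GF.zero_apply]; linarith) (List.replicate n 0)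
    rw [pr_add ((0 : GF n).bm.sub (hvb K)) ((hvb K).sub (hwb K))] at h1
    simp only [neg_one_mul] at h1
    have h2 : pr (fun x => v K x - w K x) (List.replicate n 0) ≤ e K := hvw0
    linarith [heb K]
  have h0 : 0 ≤ ∫ z in cell n, -w K z :=
    integral_nonneg fun z => neg_nonneg.2 (pEnv_obst_le_zero hc z)
  have h1 : (1 : ℝ) ≤ n.factorial := by exact_mod_cast n.factorial_pos
  nlinarith

lemma exists_bump (b : Fin n → ℂ) {r : ℝ} (hr0 : 0 < r) (hr : r ≤ sepRad n) :
    ∃ β : (Fin n → ℂ) → ℝ, ContDiff ℝ ∞ β ∧ Per β ∧ (∀ z, 0 ≤ β z) ∧ (∀ z, β z ≤ 1) ∧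
      (∀ z, nsq (z - b) < r / 32 → β z = 1) ∧
      ∀ z, nsq (z - b) < r → r / 4 ≤ nsq (z - b) → β z = 0 := by
  set S : Set (Fin n → ℂ) := {z | ∃ l ∈ lat n, nsq (z + l - b) < r / 12} with hS
  have hSo : IsOpen S := by
    have : S = ⋃ l ∈ lat n, {z | nsq (z + l - b) < r / 12} := by ext; simp [hS]
    rw [this]
    refine isOpen_biUnion fun l _ => isOpen_lt (continuous_nsq.comp (by fun_prop)) continuous_const
  have hSp : Per fun z => z ∈ S := by
    intro l hl z
    refine propext ⟨fun ⟨l', hl', h⟩ => ⟨l + l', add_mem hl hl', by rwa [← add_assoc]⟩,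
      fun ⟨l', hl', h⟩ => ⟨l' - l, sub_mem hl' hl, by
        rwa [show z + l + (l' - l) - b = z + l' - b by abel]⟩⟩
  set f : (Fin n → ℂ) → ℝ := S.indicator fun _ => 1 with hf
  have hf0 : ∀ z, 0 ≤ f z := indicator_nonneg fun _ _ => zero_le_one
  have hf1 : ∀ z, f z ≤ 1 := indicator_le' (fun _ _ => le_rfl) fun _ _ => zero_le_one
  have hfb : BM f := ⟨measurable_const.indicator hSo.measurableSet, 1, fun z =>
    abs_le.2 ⟨by linarith [hf0 z], hf1 z⟩⟩
  have hfp : Per f := fun l hl z => by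
    have := hSp l hl z
    classical
    simp only [hf, indicator_apply]
    simp only [this]
  set ε := √r / 10
  have hε : 0 < ε := by positivity
  have hε2 : ε ^ 2 = r / 100 := by rw [div_pow, Real.sq_sqrt hr0.le]; norm_num
  have h0 : ∀ z, 0 ≤ conv (kr ε) f z := fun z => le_conv_kr_of_forall hε hfb fun y _ => hf0 _
  have h1 : ∀ z, conv (kr ε) f z ≤ 1 := fun z => conv_kr_le_of_forall hε hfb fun y _ => hf1 _
  refine ⟨conv (kr ε) f, contDiff_conv_kr hε hfb, hfp.conv, h0, h1, fun z hz => ?_,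
    fun z hz hz' => ?_⟩
  · refine le_antisymm (h1 z) (le_conv_kr_of_forall hε hfb fun y hy => ?_)
    have : z - y ∈ S := by
      refine ⟨0, zero_mem _, ?_⟩
      have h2 := nsq_add_le (z - b) (-y)
      rw [nsq_neg, show z - b + -y = z - y + 0 - b by abel] at h2
      rw [hε2] at hy
      linarith
    exact (indicator_of_mem this fun _ => (1 : ℝ)).ge
  · refine le_antisymm (conv_kr_le_of_forall hε hfb fun y hy => ?_) (h0 z)
    have : z - y ∉ S := by
      rintro ⟨l, hl, h⟩
      have h2 := nsq_add_le (z - y + l - b) y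
      rw [show z - y + l - b + y = z + l - b by abel] at h2
      rw [hε2] at hy
      have h3 : l = 0 := lat_eq_of_near (z := z) (z₀ := b) hl (zero_mem _) hr (by linarith)
        (by simpa using hz)
      rw [h3] at h h2
      rw [add_zero] at h2
      linarith
    exact (indicator_of_notMem this fun _ => (1 : ℝ)).le

lemma abs_lev_le (Q : (Fin n → ℂ) →L[ℝ] (Fin n → ℂ) →L[ℝ] ℝ) (v : Fin n → ℂ) :
    |lev Q v| ≤ ‖Q‖ * nsq v := by
  have key : ∀ w : Fin n → ℂ, ‖w‖ = ‖v‖ → |Q w w| ≤ ‖Q‖ * nsq v := fun w hw => by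
    calc |Q w w| ≤ ‖Q‖ * ‖w‖ * ‖w‖ := Q.le_opNorm₂ w w
      _ = ‖Q‖ * ‖v‖ ^ 2 := by rw [hw]; ring
      _ ≤ _ := mul_le_mul_of_nonneg_left (norm_sq_le_nsq v) Q.opNorm_nonneg
  have h1 := abs_le.1 (key v rfl)
  have h2 := abs_le.1 (key (I • v) (by simp [norm_smul]))
  have h3 : 0 ≤ ‖Q‖ * nsq v := mul_nonneg Q.opNorm_nonneg (nsq_nonneg v)
  unfold lev
  exact abs_le.2 ⟨by linarith, by linarith⟩

lemma exists_QP_sub_mul {β : (Fin n → ℂ) → ℝ} (hβ : ContDiff ℝ ∞ β) (hper : Per β) :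
    ∃ τ : ℝ, 0 < τ ∧ τ ≤ 1 ∧ ∀ d, QP fun z => d - τ * β z := by
  obtain ⟨C, hC⟩ := norm_hess_bound hβ hper
  have hC0 : 0 ≤ C := (hess β 0).opNorm_nonneg.trans (hC 0)
  refine ⟨1 / (C + 1), by positivity, by rw [div_le_one (by positivity)]; linarith, fun d => ?_⟩
  set τ := 1 / (C + 1)
  refine QP.of_contDiff (contDiff_const.sub (contDiff_const.mul hβ)) (hper.comp fun x => d - τ * x)
    fun z v hv => ?_
  have hd := hβ.differentiable (by simp)
  have hd2 : Differentiable ℝ (fderiv ℝ β) := (hβ.fderiv_right (m := ∞) (by simp)).differentiable (by simp)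
  have e1 : fderiv ℝ (fun z => d - τ * β z) = fun z => -(τ • fderiv ℝ β z) := funext fun z => by
    rw [fderiv_const_sub, fderiv_const_mul (hd z)]
  have e2 : hess (fun z => d - τ * β z) z = -(τ • hess β z) := by
    show fderiv ℝ (fderiv ℝ _) z = _
    rw [e1, fderiv_fun_neg, fderiv_fun_const_smul (hd2 z)]
  have e3 : lev (hess (fun z => d - τ * β z) z) v = -(τ * lev (hess β z) v) := by
    rw [e2]
    simp only [lev, neg_apply, smul_apply, smul_eq_mul]
    ring
  have hv0 : 0 < nsq v := lt_of_le_of_ne (nsq_nonneg v) fun h => hv (nsq_eq_zero h.symm)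
  have h1 : lev (hess β z) v ≤ C * nsq v := (le_abs_self _).trans ((abs_lev_le _ v).trans
    (mul_le_mul_of_nonneg_right (hC z) hv0.le))
  rw [e3]
  have hτ : 0 < τ := by positivity
  have h2 : τ * lev (hess β z) v ≤ τ * (C * nsq v) := mul_le_mul_of_nonneg_left h1 hτ.le
  have h3 : τ * (C * nsq v) = nsq v - τ * nsq v := by
    simp only [τ]; field_simp; ring
  have := mul_pos hτ hv0
  linarith

/-- Plurisubharmonic functions with values in `[0, 1]`. -/
structure PB (u : (Fin n → ℂ) → ℝ) (D : Set (Fin n → ℂ)) : Prop where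
  usc : UpperSemicontinuousOn u D
  nonneg : ∀ x ∈ D, 0 ≤ u x
  le_one : ∀ x ∈ D, u x ≤ 1
  sub : ∀ z ∈ D, ∀ w, ∀ᶠ s : ℝ in 𝓝[>] 0, u z ≤ cmean u z ((s : ℂ) • w)

lemma eventually_circle_mem {D : Set (Fin n → ℂ)} (hD : IsOpen D) {z : Fin n → ℂ} (hz : z ∈ D)
    (w : Fin n → ℂ) : ∀ᶠ s : ℝ in 𝓝[>] 0, ∀ ζ : ℂ, ‖ζ‖ ≤ 1 → z + ζ • (s : ℂ) • w ∈ D := by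
  obtain ⟨ε, hε, hb⟩ := Metric.isOpen_iff.1 hD z hz
  have h1 : Tendsto (fun s : ℝ => s * ‖w‖) (𝓝[>] 0) (𝓝 0) :=
    ((continuous_id.mul continuous_const).tendsto' 0 0 (by simp)).mono_left nhdsWithin_le_nhds
  filter_upwards [h1.eventually (gt_mem_nhds hε), self_mem_nhdsWithin] with s hs hs0 ζ hζ
  refine hb ?_
  rw [mem_ball, dist_eq_norm, add_sub_cancel_left, norm_smul, norm_smul, norm_real,
    Real.norm_of_nonneg (le_of_lt hs0)]
  have : 0 ≤ s * ‖w‖ := mul_nonneg (le_of_lt hs0) (norm_nonneg _)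
  nlinarith

lemma circleIntegrable_slice_on {D : Set (Fin n → ℂ)} {u : (Fin n → ℂ) → ℝ}
    (hu : UpperSemicontinuousOn u D) {m M : ℝ} (hm : ∀ x ∈ D, m ≤ u x) (hM : ∀ x ∈ D, u x ≤ M)
    {z v : Fin n → ℂ} (hzv : ∀ ζ : ℂ, ‖ζ‖ ≤ 1 → z + ζ • v ∈ D) :
    CircleIntegrable (fun ζ : ℂ => u (z + ζ • v)) 0 1 := by
  have hmem : ∀ θ : ℝ, z + circleMap 0 1 θ • v ∈ D := fun θ => hzv _ (by simp)
  have hus : UpperSemicontinuous fun θ : ℝ => u (z + circleMap 0 1 θ • v) := by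
    intro θ y hy
    have hc : Continuous fun θ : ℝ => z + circleMap 0 1 θ • v := by fun_prop
    have ht : Tendsto (fun θ : ℝ => z + circleMap 0 1 θ • v) (𝓝 θ)
        (𝓝[D] (z + circleMap 0 1 θ • v)) :=
      tendsto_nhdsWithin_iff.2 ⟨hc.tendsto θ, .of_forall hmem⟩
    exact ht.eventually (hu _ (hmem θ) y hy)
  have hI : IntegrableOn (fun θ : ℝ => u (z + circleMap 0 1 θ • v)) (Ioc 0 (2 * π)) volume :=
    Integrable.of_bound (C := max |m| |M|) hus.measurable.aestronglyMeasurable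
      (.of_forall fun θ => abs_le_max_abs_abs (hm _ (hmem θ)) (hM _ (hmem θ)))
  exact (intervalIntegrable_iff_integrableOn_Ioc_of_le Real.two_pi_pos.le).2 hI

lemma PB.circleIntegrable {D : Set (Fin n → ℂ)} {u : (Fin n → ℂ) → ℝ} (hu : PB u D)
    {z v : Fin n → ℂ} (hzv : ∀ ζ : ℂ, ‖ζ‖ ≤ 1 → z + ζ • v ∈ D) :
    CircleIntegrable (fun ζ : ℂ => u (z + ζ • v)) 0 1 :=
  circleIntegrable_slice_on hu.usc hu.nonneg hu.le_one hzv

lemma integral_eq_cmean (u : (Fin n → ℂ) → ℝ) (z v : Fin n → ℂ) (r : ℝ) :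
    (1 / (2 * Real.pi)) * ∫ θ in (0:ℝ)..(2 * Real.pi),
      u (z + (Complex.ofReal r * Complex.exp (θ * Complex.I)) • v) = cmean u z ((r : ℂ) • v) := by
  rw [cmean, Real.circleAverage_def, smul_eq_mul, one_div]
  congr 2 with θ
  rw [circleMap, smul_smul]
  simp [mul_comm]

lemma PB.psh {D : Set (Fin n → ℂ)} {u : (Fin n → ℂ) → ℝ} (hu : PB u D) : PSHOn u D :=
  ⟨hu.usc, fun z hz v => by simpa only [integral_eq_cmean] using hu.sub z hz v⟩

/-- The positive part of a plurisubharmonic function. -/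
lemma PB.of_psh {D : Set (Fin n → ℂ)} (hD : IsOpen D) {u : (Fin n → ℂ) → ℝ} (hu : PSHOn u D)
    (h1 : ∀ x ∈ D, u x ≤ 1) : PB (fun x => max (u x) 0) D := by
  have husc : UpperSemicontinuousOn (fun x => max (u x) 0) D :=
    hu.1.sup upperSemicontinuousOn_const
  have hle : ∀ x ∈ D, max (u x) 0 ≤ 1 := fun x hx => max_le (h1 x hx) zero_le_one
  refine ⟨husc, fun x _ => le_max_right _ _, hle, fun z hz w => ?_⟩
  filter_upwards [hu.2 z hz w, eventually_circle_mem hD hz w] with s hs hmem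
  rw [integral_eq_cmean] at hs
  have hI := circleIntegrable_slice_on husc (fun x _ => le_max_right _ _) hle hmem
  refine max_le ?_ (Real.circleAverage_nonneg_of_nonneg fun x _ => le_max_right _ _)
  by_cases hi : CircleIntegrable (fun ζ : ℂ => u (z + ζ • (s : ℂ) • w)) 0 1
  · exact hs.trans (circleAverage_le_of_forall hi hI fun x => le_max_left _ _)
  · have : cmean u z ((s : ℂ) • w) = 0 := by
      rw [cmean, Real.circleAverage_def, intervalIntegral.integral_undef hi, smul_zero]
    rw [this] at hs
    exact hs.trans (Real.circleAverage_nonneg_of_nonneg fun x _ => le_max_right _ _)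

lemma PB.mono {D E : Set (Fin n → ℂ)} (hED : E ⊆ D) {u : (Fin n → ℂ) → ℝ}
    (hu : PB u D) : PB u E :=
  ⟨hu.usc.mono hED, fun x hx => hu.nonneg x (hED hx), fun x hx => hu.le_one x (hED hx),
    fun z hz => hu.sub z (hED hz)⟩

lemma limsup_eq_of_usc {D : Set (Fin n → ℂ)} {u : (Fin n → ℂ) → ℝ}
    (hu : UpperSemicontinuousOn u D) {a : Fin n → ℂ} (ha : a ∈ D) :
    Filter.limsup u (𝓝[D] a) = u a := by
  rw [Filter.limsup_eq]
  have hlb : ∀ c ∈ {c | ∀ᶠ x in 𝓝[D] a, u x ≤ c}, u a ≤ c := fun c hc =>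
    (hc : ∀ᶠ x in 𝓝[D] a, u x ≤ c).self_of_nhdsWithin ha
  refine le_antisymm (le_of_forall_gt_imp_ge_of_dense fun c hc => ?_) (le_csInf ?_ hlb)
  · exact csInf_le ⟨u a, hlb⟩ ((hu a ha c hc).mono fun x hx => hx.le)
  · exact ⟨u a + 1, (hu a ha _ (lt_add_one _)).mono fun x hx => hx.le⟩

section hFun

variable {D B : Set (Fin n → ℂ)}

lemma mem_family_of_PB (hB : B ⊆ D) {u : (Fin n → ℂ) → ℝ} (hu : PB u D) (h0 : ∀ a ∈ B, u a = 0) :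
    u ∈ {u | PSHOn u D ∧ (∀ x ∈ D, u x ≤ 1) ∧ ∀ a ∈ B, Filter.limsup u (𝓝[D] a) ≤ 0} :=
  ⟨hu.psh, hu.le_one, fun a ha => by rw [limsup_eq_of_usc hu.usc (hB ha), h0 a ha]⟩

lemma PB.zero : PB (fun _ => 0) D :=
  ⟨upperSemicontinuousOn_const, fun _ _ => le_rfl, fun _ _ => zero_le_one, fun z _ w =>
    .of_forall fun s => by rw [cmean_const]⟩

lemma hFun_bdd {z : Fin n → ℂ} (hz : z ∈ D) : BddAbove ((fun u : (Fin n → ℂ) → ℝ => u z) ''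
    {u | PSHOn u D ∧ (∀ x ∈ D, u x ≤ 1) ∧ ∀ a ∈ B, Filter.limsup u (𝓝[D] a) ≤ 0}) :=
  ⟨1, by rintro _ ⟨u, hu, rfl⟩; exact hu.2.1 z hz⟩

lemma le_hFun (hB : B ⊆ D) {u : (Fin n → ℂ) → ℝ} (hu : PB u D) (h0 : ∀ a ∈ B, u a = 0)
    {z : Fin n → ℂ} (hz : z ∈ D) : u z ≤ hFun B D z :=
  le_csSup (hFun_bdd hz) ⟨u, mem_family_of_PB hB hu h0, rfl⟩

lemma hFun_nonneg (hB : B ⊆ D) {z : Fin n → ℂ} (hz : z ∈ D) : 0 ≤ hFun B D z :=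
  le_hFun hB PB.zero (fun _ _ => rfl) hz

lemma hFun_le_one (hB : B ⊆ D) {z : Fin n → ℂ} (hz : z ∈ D) : hFun B D z ≤ 1 :=
  csSup_le (Nonempty.image _ ⟨_, mem_family_of_PB hB PB.zero fun _ _ => rfl⟩)
    (by rintro _ ⟨u, hu, rfl⟩; exact hu.2.1 z hz)

lemma exists_PB_of_lt_hFun (hD : IsOpen D) (hB : B ⊆ D) {z : Fin n → ℂ}
    {s : ℝ} (hs : s < hFun B D z) : ∃ u, PB u D ∧ (∀ a ∈ B, u a = 0) ∧ s < u z := by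
  obtain ⟨_, ⟨u, hu, rfl⟩, hlt⟩ := exists_lt_of_lt_csSup (Nonempty.image _
    ⟨_, mem_family_of_PB hB PB.zero fun _ _ => rfl⟩) hs
  refine ⟨_, PB.of_psh hD hu.1 hu.2.1, fun a ha => ?_, hlt.trans_le (le_max_left _ _)⟩
  have := hu.2.2 a ha
  rw [limsup_eq_of_usc hu.1.1 (hB ha)] at this
  exact max_eq_right this

lemma eventually_hFun_mem (hD : IsOpen D) (hB : B ⊆ D) {z : Fin n → ℂ} (hz : z ∈ D) :
    ∀ᶠ x in 𝓝 z, 0 ≤ hFun B D x ∧ hFun B D x ≤ 1 := by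
  filter_upwards [hD.mem_nhds hz] with x hx using ⟨hFun_nonneg hB hx, hFun_le_one hB hx⟩

lemma omegaC_eq (hD : IsOpen D) {z : Fin n → ℂ} (hz : z ∈ D) :
    omegaC B D z = Filter.limsup (hFun B D) (𝓝 z) := by
  rw [omegaC, hD.nhdsWithin_eq hz]

lemma omegaC_le_of_eventually (hD : IsOpen D) (hB : B ⊆ D) {z : Fin n → ℂ} (hz : z ∈ D) {s : ℝ}
    (h : ∀ᶠ x in 𝓝 z, hFun B D x ≤ s) : omegaC B D z ≤ s := by
  rw [omegaC_eq hD hz]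
  have hb : IsBoundedUnder (· ≥ ·) (𝓝 z) (hFun B D) :=
    isBoundedUnder_of_eventually_ge ((eventually_hFun_mem hD hB hz).mono fun x hx => hx.1)
  exact Filter.limsup_le_of_le hb.isCoboundedUnder_le h

lemma le_omegaC_of_frequently (hD : IsOpen D) (hB : B ⊆ D) {z : Fin n → ℂ} (hz : z ∈ D) {s : ℝ}
    (h : ∃ᶠ x in 𝓝 z, s ≤ hFun B D x) : s ≤ omegaC B D z := by
  rw [omegaC_eq hD hz]
  exact Filter.le_limsup_of_frequently_le h
    ⟨1, (eventually_map.2 ((eventually_hFun_mem hD hB hz).mono fun x hx => hx.2))⟩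

lemma hFun_le_omegaC (hD : IsOpen D) (hB : B ⊆ D) {z : Fin n → ℂ} (hz : z ∈ D) :
    hFun B D z ≤ omegaC B D z :=
  le_omegaC_of_frequently hD hB hz fun h => h.self_of_nhds le_rfl

lemma frequently_of_lt_omegaC (hD : IsOpen D) (hB : B ⊆ D) {z : Fin n → ℂ} (hz : z ∈ D) {s : ℝ}
    (hs : s < omegaC B D z) : ∃ᶠ x in 𝓝 z, s < hFun B D x := by
  intro h
  exact not_le_of_gt hs (omegaC_le_of_eventually hD hB hz (h.mono fun x hx => not_lt.1 hx))

lemma omegaC_nonneg (hD : IsOpen D) (hB : B ⊆ D) {z : Fin n → ℂ} (hz : z ∈ D) :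
    0 ≤ omegaC B D z := (hFun_nonneg hB hz).trans (hFun_le_omegaC hD hB hz)

lemma omegaC_mono {B' D' : Set (Fin n → ℂ)} (hD : IsOpen D) (hD' : IsOpen D') (hB : B ⊆ D)
    (hB' : B' ⊆ D') (hDD : D' ⊆ D) (hBB : B' ⊆ B) {z : Fin n → ℂ} (hz : z ∈ D') :
    omegaC B D z ≤ omegaC B' D' z := by
  refine le_of_forall_lt fun s hs => ?_
  obtain ⟨s', hs1, hs2⟩ := exists_between hs
  refine hs1.trans_le (le_omegaC_of_frequently hD' hB' hz ?_)
  refine ((frequently_of_lt_omegaC hD hB (hDD hz) hs2).and_eventually (hD'.mem_nhds hz)).mono ?_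
  rintro x ⟨hx, hxD⟩
  obtain ⟨u, hu, h0, hlt⟩ := exists_PB_of_lt_hFun hD hB hx
  exact hlt.le.trans (le_hFun hB' (hu.mono hDD) (fun a ha => h0 a (hBB ha)) hxD)

end hFun

lemma isOpen_nsq_lt (b : Fin n → ℂ) (r : ℝ) : IsOpen {x : Fin n → ℂ | nsq (x - b) < r} :=
  isOpen_lt (continuous_nsq.comp (by fun_prop)) continuous_const

/-- A bounded plurisubharmonic function near `b` extends, after rescaling, to a periodic
quasi-plurisubharmonic function. -/
lemma exists_QP_localize (b : Fin n → ℂ) {r : ℝ} (hr0 : 0 < r) (hr : r ≤ sepRad n) :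
    ∃ δ : ℝ, 0 < δ ∧ ∀ c : ℝ, 1 ≤ c → ∀ s : ℝ, 0 ≤ s → s ≤ 1 → ∀ v,
      PB v {x | nsq (x - b) < r} → ∃ u, QP u ∧ (∀ x, u x ≤ 0) ∧
        ∀ x, nsq (x - b) < r / 32 → u x = δ * v x - c - δ * s / 2 := by
  obtain ⟨β, hβ, hper, h0, h1, hin, hann⟩ := exists_bump b hr0 hr
  obtain ⟨τ, hτ, hτ1, hQ⟩ := exists_QP_sub_mul hβ hper
  refine ⟨τ / 2, by positivity, fun c hc s hs0 hs1 v hv => ?_⟩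
  set W : (Fin n → ℂ) → ℝ := fun x => τ / 2 * v x + (-c - τ / 2 * s / 2) with hW
  set v₀ : (Fin n → ℂ) → ℝ := fun x => (-c + τ / 2) - τ * β x with hv₀
  have hτs : 0 ≤ τ * s := mul_nonneg hτ.le hs0
  have hτs1 : τ * s ≤ τ := by nlinarith
  have hW1 : ∀ x, nsq (x - b) < r → W x ≤ -c + τ / 2 := fun x hx => by
    have := hv.le_one x hx
    simp only [hW]
    nlinarith
  have hv1 : ∀ x, v₀ x ≤ -c + τ / 2 := fun x => by
    have := mul_nonneg hτ.le (h0 x)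
    simp only [hv₀]
    linarith
  have hper' : Per (glue b r v₀ W) := per_glue hr (hQ _).per W
  refine ⟨glue b r v₀ W, QP.glue (hQ _) hr0 hr ?_ ?_ ?_, fun x => ?_, fun x hx => ?_⟩
  · have h2 : UpperSemicontinuousOn (fun x => τ / 2 * v x) {x | nsq (x - b) < r} := by
      intro x hx y hy
      have : v x < y / (τ / 2) := by rw [lt_div_iff₀ (by positivity)]; linarith
      filter_upwards [hv.usc x hx _ this] with z hz
      rw [lt_div_iff₀ (by positivity)] at hz
      linarith
    exact h2.add upperSemicontinuousOn_const
  · intro z hz w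
    filter_upwards [hv.sub z hz w, eventually_circle_mem (isOpen_nsq_lt b r) hz w] with s' hs' hmem
    have hi := hv.circleIntegrable hmem
    have hi' : CircleIntegrable (fun ζ : ℂ => τ / 2 * v (z + ζ • (s' : ℂ) • w)) 0 1 :=
      hi.const_fun_smul (a := τ / 2)
    have hic : CircleIntegrable (fun _ : ℂ => -c - τ / 2 * s / 2) 0 1 := circleIntegrable_const _ _ _
    refine ⟨hi'.add hic, ?_⟩
    rw [hW, cmean_add hi' hic, cmean_const, cmean_const_mul]
    have h3 : 0 ≤ s' ^ 2 * nsq w := mul_nonneg (sq_nonneg _) (nsq_nonneg _)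
    have h4 := mul_le_mul_of_nonneg_left hs' (by positivity : 0 ≤ τ / 2)
    linarith
  · intro z hz hz'
    simp only [hann z hz hz', mul_zero, sub_zero]
    exact hW1 z hz
  · by_cases h : ∃ l ∈ lat n, nsq (x + l - b) < r
    · obtain ⟨l, hl, h⟩ := h
      rw [← hper' l hl, glue_of_mem hr v₀ W h]
      exact (max_le (hv1 _) (hW1 _ h)).trans (by linarith)
    · push Not at h
      rw [glue_of_forall v₀ W h]
      exact (hv1 x).trans (by linarith)
  · have hx' : nsq (x - b) < r := by linarith
    rw [glue_of_mem hr v₀ W hx', max_eq_right]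
    · simp only [hW]; ring
    · simp only [hv₀, hin x hx, hW]
      have := mul_nonneg hτ.le (hv.nonneg x hx')
      nlinarith

/-- A set on which relative extremal functions of a thinner set are bounded below is small. -/
lemma exists_QP_small_of_omegaC (b : Fin n → ℂ) {r : ℝ} (hr0 : 0 < r) (hr : r ≤ sepRad n)
    {s : ℝ} (hs0 : 0 < s) (hs1 : s ≤ 1) {A N : Set (Fin n → ℂ)} (hNA : N ⊆ A)
    (hNr : ∀ a ∈ N, nsq (a - b) < r / 32)
    (hN : ∀ a ∈ N, s < omegaC (A ∩ {x | nsq (x - b) < r}) {x | nsq (x - b) < r} a)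
    {c η : ℝ} (hc : 1 ≤ c) (hη : 0 < η) :
    ∃ w, QP w ∧ (∀ z, -c ≤ w z) ∧ (∀ z, w z ≤ 0) ∧ (∀ z ∈ N, w z ≤ -c) ∧
      ∫ z in cell n, -w z ≤ η := by
  set E := {x : Fin n → ℂ | nsq (x - b) < r} with hE
  have hEo : IsOpen E := isOpen_nsq_lt b r
  have hN' : ∀ a ∈ N, a ∈ E := fun a ha => by
    have := hNr a ha
    simp only [hE, mem_ofPred_eq]; linarith
  obtain ⟨δ, hδ, H⟩ := exists_QP_localize b hr0 hr
  have hδs : 0 < δ * s := mul_pos hδ hs0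
  set t := min (δ * s / 2) (c / 2) with ht
  have ht0 : 0 < t := lt_min (by positivity) (by positivity)
  refine exists_QP_small (c := c) ht0 ((min_le_right _ _).trans_lt (by linarith)) ?_ hη
  intro a ha U hU haU
  have hf := frequently_of_lt_omegaC hEo inter_subset_right (hN' a ha) (hN a ha)
  have hmem : ∀ᶠ x in 𝓝 a, x ∈ U ∧ nsq (x - b) < r / 32 :=
    ((hU.inter (isOpen_nsq_lt b (r / 32))).mem_nhds ⟨haU, hNr a ha⟩ :)
  obtain ⟨x, hx, hxU, hxr⟩ := (hf.and_eventually hmem).exists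
  obtain ⟨v, hv, hv0, hvx⟩ := exists_PB_of_lt_hFun hEo inter_subset_right hx
  obtain ⟨u, hu, hu0, hue⟩ := H c hc s hs0.le hs1 v hv
  refine ⟨{z | u z < -c}, ⟨hu.usc.isOpen_preimage _, fun y hy => ?_, fun l hl z => ?_⟩,
    x, hxU, ?_⟩
  · rw [mem_ofPred_eq, hue y (hNr y hy), hv0 y ⟨hNA hy, hN' y hy⟩]
    linarith
  · simp only [mem_ofPred_eq, hu.per l hl z]
  · have h1 : u x ≤ pEnv (obst c {z | u z < -c}) x := by
      refine le_pEnv hu (fun z => ?_) x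
      by_cases hz : z ∈ {z | u z < -c}
      · rw [obst_of_mem hz]
        exact le_of_lt hz
      · rw [obst_of_notMem hz]
        exact hu0 z
    have h2 := mul_lt_mul_of_pos_left hvx hδ
    rw [hue x hxr] at h1
    have := min_le_left (δ * s / 2) (c / 2)
    linarith

lemma exists_setLIntegral_le_mul_cell {D : Set (Fin n → ℂ)} (hD : Bornology.IsBounded D) :
    ∃ k : ℕ, ∀ f : (Fin n → ℂ) → ENNReal, Per f →
      ∫⁻ x in D, f x ≤ k * ∫⁻ x in cell n, f x := by
  have hfin : (image2 (fun x y => x - y) (cell n) D ∩ (lat n : Set (Fin n → ℂ))).Finite :=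
    ZSpan.setFinite_inter _ (isBounded_cell.sub hD)
  set T := image2 (fun x y => x - y) (cell n) D ∩ (lat n : Set (Fin n → ℂ)) with hT
  have := hfin.fintype
  refine ⟨Fintype.card T, fun f hf => ?_⟩
  have hsub : D ⊆ ⋃ l : T, (fun x => x + (l : Fin n → ℂ)) ⁻¹' cell n := fun x hx => by
    obtain ⟨l, hl, h⟩ := exists_lat_add_mem_cell x
    exact mem_iUnion.2 ⟨⟨l, ⟨x + l, h, x, hx, add_sub_cancel_left x l⟩, hl⟩, h⟩
  calc ∫⁻ x in D, f x ≤ ∫⁻ x in ⋃ l : T, (fun x => x + (l : Fin n → ℂ)) ⁻¹' cell n, f x :=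
        lintegral_mono_set hsub
    _ ≤ ∑' l : T, ∫⁻ x in (fun x => x + (l : Fin n → ℂ)) ⁻¹' cell n, f x := lintegral_iUnion_le _ _
    _ = ∑' _ : T, ∫⁻ x in cell n, f x := by
        congr 1 with l
        rw [← (measurePreserving_add_right volume (l : Fin n → ℂ)).setLIntegral_comp_preimage_emb
          (MeasurableEquiv.addRight (l : Fin n → ℂ)).measurableEmbedding f (cell n)]
        simp only [hf l l.2.2]
    _ = _ := by rw [tsum_fintype, Finset.sum_const, nsmul_eq_mul, Finset.card_univ]

/-- Globally defined plurisubharmonic functions, bounded below, and nonpositive on `D`. -/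
structure NegPSH (D : Set (Fin n → ℂ)) (ψ : (Fin n → ℂ) → ℝ) : Prop where
  usc : UpperSemicontinuous ψ
  lb : ∃ m, ∀ x, m ≤ ψ x
  sub : ∀ z v, ψ z ≤ cmean ψ z v
  nonpos : ∀ x ∈ D, ψ x ≤ 0

lemma NegPSH.zero (D : Set (Fin n → ℂ)) : NegPSH D fun _ => 0 :=
  ⟨upperSemicontinuous_const, ⟨0, fun _ => le_rfl⟩, fun z v => (cmean_const 0 z v).ge,
    fun _ _ => le_rfl⟩

lemma NegPSH.add {D : Set (Fin n → ℂ)} {φ ψ : (Fin n → ℂ) → ℝ} (hφ : NegPSH D φ)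
    (hψ : NegPSH D ψ) : NegPSH D fun x => φ x + ψ x := by
  obtain ⟨a, ha⟩ := hφ.lb
  obtain ⟨b, hb⟩ := hψ.lb
  refine ⟨hφ.usc.add hψ.usc, ⟨a + b, fun x => add_le_add (ha x) (hb x)⟩, fun z v => ?_,
    fun x hx => add_nonpos (hφ.nonpos x hx) (hψ.nonpos x hx)⟩
  rw [cmean_add (circleIntegrable_slice hφ.usc ha z v) (circleIntegrable_slice hψ.usc hb z v)]
  exact add_le_add (hφ.sub z v) (hψ.sub z v)

lemma exists_NegPSH_of_QP {D N : Set (Fin n → ℂ)} (hD : Bornology.IsBounded D)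
    (H : ∀ c : ℝ, 1 ≤ c → ∃ w, QP w ∧ (∀ z, -c ≤ w z) ∧ (∀ z, w z ≤ 0) ∧ (∀ z ∈ N, w z ≤ -c) ∧
      ∫ z in cell n, -w z ≤ 1) {η : ℝ} (hη : 0 < η) :
    ∃ ψ, NegPSH D ψ ∧ (∀ z ∈ N ∩ D, ψ z ≤ -1) ∧
      ∫⁻ x in D, ENNReal.ofReal (-ψ x) ≤ ENNReal.ofReal η := by
  obtain ⟨k, hk⟩ := exists_setLIntegral_le_mul_cell hD
  obtain ⟨R, hR⟩ := hD.exists_norm_le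
  obtain ⟨K, hK0, hDK⟩ : ∃ K : ℝ, 0 ≤ K ∧ ∀ x ∈ D, nsq x ≤ K :=
    ⟨n * R ^ 2, by positivity, fun x hx => (nsq_le_norm_sq x).trans <|
      mul_le_mul_of_nonneg_left (pow_le_pow_left₀ (norm_nonneg x) (hR x hx) 2) n.cast_nonneg⟩
  set c : ℝ := 1 + (K * (volume D).toReal + k) / η with hc
  have hvol : 0 ≤ (volume D).toReal := ENNReal.toReal_nonneg
  have hc1 : 1 ≤ c := by
    have : 0 ≤ (K * (volume D).toReal + k) / η := by positivity
    linarith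
  have hc0 : 0 < c := by linarith
  obtain ⟨w, hw, hwc, hw0, hwN, hwI⟩ := H c hc1
  have hcn : Continuous (fun x : Fin n → ℂ => nsq x - K) := continuous_nsq.sub continuous_const
  have husc : UpperSemicontinuous fun x => w x + (nsq x - K) :=
    hw.usc.add hcn.upperSemicontinuous
  refine ⟨fun x => c⁻¹ * (w x + (nsq x - K)), ⟨?_, ⟨c⁻¹ * (-c - K), fun x => ?_⟩, fun z v => ?_,
    fun x hx => ?_⟩, fun x hx => ?_, ?_⟩
  · intro x y hy
    have h1 : w x + (nsq x - K) < c * y := by rwa [inv_mul_lt_iff₀ hc0] at hy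
    filter_upwards [husc x _ h1] with z hz
    rwa [inv_mul_lt_iff₀ hc0]
  · have := nsq_nonneg x
    have := hwc x
    refine mul_le_mul_of_nonneg_left ?_ (by positivity)
    linarith
  · have hi := hw.circleIntegrable z v
    have hi2 : CircleIntegrable (fun ζ : ℂ => nsq (z + ζ • v)) 0 1 :=
      circleIntegrable_slice continuous_nsq.upperSemicontinuous nsq_nonneg z v
    have hi3 : CircleIntegrable (fun _ : ℂ => -K) 0 1 := circleIntegrable_const _ _ _
    have hi4 : CircleIntegrable (fun ζ : ℂ => nsq (z + ζ • v) + -K) 0 1 := hi2.add hi3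
    simp only [sub_eq_add_neg]
    rw [cmean_const_mul, cmean_add hi hi4, cmean_add hi2 hi3, cmean_const, cmean_nsq]
    refine mul_le_mul_of_nonneg_left ?_ (by positivity)
    linarith [hw.sub z v]
  · have := hDK x hx
    have := hw0 x
    exact mul_nonpos_of_nonneg_of_nonpos (by positivity) (by linarith)
  · have := hDK x hx.2
    have := hwN x hx.1
    rw [inv_mul_le_iff₀ hc0]
    linarith
  · have hint : IntegrableOn (fun x => -w x) (cell n) := hw.bm.integrableOn_cell.neg
    have h1 : ∫⁻ x in cell n, ENNReal.ofReal (-w x) ≤ 1 := by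
      rw [← ofReal_integral_eq_lintegral_ofReal hint (.of_forall fun x => by simpa using hw0 x)]
      exact ENNReal.ofReal_le_one.2 hwI
    have h2 : ∫⁻ x in D, ENNReal.ofReal (-w x) ≤ k := by
      refine (hk _ (hw.per.comp fun y => ENNReal.ofReal (-y))).trans ?_
      calc (k : ENNReal) * _ ≤ k * 1 := by gcongr
        _ = k := mul_one _
    calc ∫⁻ x in D, ENNReal.ofReal (-(c⁻¹ * (w x + (nsq x - K))))
        ≤ ∫⁻ x in D, ENNReal.ofReal c⁻¹ * (ENNReal.ofReal K + ENNReal.ofReal (-w x)) := by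
          refine lintegral_mono fun x => ?_
          rw [← ENNReal.ofReal_add hK0 (by linarith [hw0 x]), ← ENNReal.ofReal_mul (by positivity)]
          refine ENNReal.ofReal_le_ofReal ?_
          rw [← mul_neg]
          refine mul_le_mul_of_nonneg_left ?_ (by positivity)
          linarith [nsq_nonneg x]
      _ = ENNReal.ofReal c⁻¹ * (ENNReal.ofReal K * volume D +
            ∫⁻ x in D, ENNReal.ofReal (-w x)) := by
          rw [lintegral_const_mul' _ _ ENNReal.ofReal_ne_top,
            lintegral_add_left measurable_const, setLIntegral_const]
      _ ≤ ENNReal.ofReal c⁻¹ * (ENNReal.ofReal K * volume D + k) := by gcongr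
      _ = ENNReal.ofReal (c⁻¹ * (K * (volume D).toReal + k)) := by
          rw [ENNReal.ofReal_mul (by positivity), ENNReal.ofReal_add (by positivity) (by positivity),
            ENNReal.ofReal_mul hK0, ENNReal.ofReal_toReal hD.measure_lt_top.ne,
            ENNReal.ofReal_natCast]
      _ ≤ ENNReal.ofReal η := by
          refine ENNReal.ofReal_le_ofReal ?_
          rw [inv_mul_le_iff₀ hc0, hc, add_mul, div_mul_cancel₀ _ hη.ne']
          linarith

lemma exists_nsq_ball_subset {U : Set (Fin n → ℂ)} (hU : IsOpen U) {z : Fin n → ℂ} (hz : z ∈ U) :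
    ∃ r : ℝ, 0 < r ∧ ∀ x, nsq (x - z) < r → x ∈ U := by
  obtain ⟨ε, hε, hb⟩ := Metric.isOpen_iff.1 hU z hz
  refine ⟨ε ^ 2, by positivity, fun x hx => hb ?_⟩
  rw [mem_ball, dist_eq_norm]
  exact lt_of_pow_lt_pow_left₀ 2 hε.le ((norm_sq_le_nsq _).trans_lt hx)

lemma PB.le_of_ae {D U : Set (Fin n → ℂ)} {u : (Fin n → ℂ) → ℝ} (hu : PB u D) (hU : IsOpen U)
    (hUD : U ⊆ D) {t : ℝ} (h : ∀ᵐ x, x ∈ U → u x ≤ t) {z : Fin n → ℂ} (hz : z ∈ U) : u z ≤ t := by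
  obtain ⟨r₀, hr₀, hsub⟩ := exists_nsq_ball_subset hU hz
  set r := min r₀ (sepRad n) with hr
  have hr0 : 0 < r := lt_min hr₀ sepRad_pos
  have hrU : ∀ x, nsq (x - z) < r → x ∈ U := fun x hx => hsub x (hx.trans_le (min_le_left _ _))
  obtain ⟨δ, hδ, H⟩ := exists_QP_localize z hr0 (min_le_right _ _)
  obtain ⟨w, hw, -, hwe⟩ := H 1 le_rfl 0 le_rfl zero_le_one u (hu.mono fun x hx => hUD (hrU x hx))
  have hzz : nsq (z - z) < r / 32 := by rw [sub_self, nsq_zero]; positivity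
  obtain ⟨M, hM⟩ := hw.bm.bdd
  have key : ∀ ε : ℝ, 0 < ε → ε ^ 2 < r / 32 → w z ≤ δ * t - 1 + ε ^ 2 := fun ε hε hεr => by
    refine (hw.le_conv_kr hε z).trans (add_le_add_left ?_ _)
    have h1 : ∫ y : Fin n → ℂ, kr ε y * (δ * t - 1) = δ * t - 1 := by
      rw [integral_mul_const, integral_kr hε, one_mul]
    have h2 : ∀ᵐ y : Fin n → ℂ, z - y ∈ U → u (z - y) ≤ t :=
      (Measure.measurePreserving_sub_left volume z).quasiMeasurePreserving.ae h
    rw [← h1, conv]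
    refine integral_mono_ae ?_ ((integrable_kr hε).mul_const _) ?_
    · refine (integrable_kr hε).mul_bdd (c := M) ?_ (.of_forall fun y => hM _)
      exact (hw.bm.meas.comp (measurable_const.sub measurable_id)).aestronglyMeasurable
    · filter_upwards [h2] with y hy
      by_cases h0 : kr ε y = 0
      · simp only [h0, zero_mul, le_refl]
      · have h3 : nsq (z - y - z) < r / 32 := by
          rw [sub_sub_cancel_left, nsq_neg]
          exact (kr_ne_zero hε h0).trans hεr
        refine mul_le_mul_of_nonneg_left ?_ (kr_nonneg hε y)
        rw [hwe _ h3]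
        have := mul_le_mul_of_nonneg_left (hy (hrU _ (by linarith))) hδ.le
        linarith
  have hlim : w z ≤ δ * t - 1 := by
    have ht : Tendsto (fun ε : ℝ => δ * t - 1 + ε ^ 2) (𝓝[>] 0) (𝓝 (δ * t - 1)) :=
      ((continuous_const.add (continuous_pow 2)).tendsto' 0 _ (by simp)).mono_left
        nhdsWithin_le_nhds
    have hs : Tendsto (fun ε : ℝ => ε ^ 2) (𝓝[>] 0) (𝓝 0) :=
      ((continuous_pow 2).tendsto' 0 _ (by simp)).mono_left nhdsWithin_le_nhds
    refine ge_of_tendsto ht ?_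
    filter_upwards [hs.eventually (gt_mem_nhds (by positivity : 0 < r / 32)),
      self_mem_nhdsWithin] with ε h1 h2 using key ε h2 h1
  rw [hwe z hzz] at hlim
  refine le_of_mul_le_mul_left ?_ hδ
  linarith

section PBinf

variable {D : Set (Fin n → ℂ)} {u : (Fin n → ℂ) → ℝ} {ψ : ℕ → (Fin n → ℂ) → ℝ}

/-- The perturbation of `u` by the first `K` of the functions `ψ k`, truncated at `0`. -/
def trunc (u : (Fin n → ℂ) → ℝ) (ψ : ℕ → (Fin n → ℂ) → ℝ) (K : ℕ) (x : Fin n → ℂ) : ℝ :=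
  max (u x + ∑ k ∈ Finset.range K, ψ k x) 0

/-- The limit of the functions `trunc u ψ K`. -/
def truncInf (u : (Fin n → ℂ) → ℝ) (ψ : ℕ → (Fin n → ℂ) → ℝ) (x : Fin n → ℂ) : ℝ :=
  ⨅ K, trunc u ψ K x

lemma trunc_nonneg (K : ℕ) (x : Fin n → ℂ) : 0 ≤ trunc u ψ K x := le_max_right _ _

lemma truncInf_le (K : ℕ) (x : Fin n → ℂ) : truncInf u ψ x ≤ trunc u ψ K x :=
  ciInf_le ⟨0, by rintro _ ⟨K, rfl⟩; exact trunc_nonneg K x⟩ K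

lemma truncInf_nonneg (x : Fin n → ℂ) : 0 ≤ truncInf u ψ x := le_ciInf fun K => trunc_nonneg K x

lemma NegPSH.sum (hψ : ∀ k, NegPSH D (ψ k)) (K : ℕ) :
    NegPSH D fun x => ∑ k ∈ Finset.range K, ψ k x := by
  induction K with
  | zero => simpa using NegPSH.zero D
  | succ K ih => simpa only [Finset.sum_range_succ] using ih.add (hψ K)

lemma trunc_anti (hψ : ∀ k, NegPSH D (ψ k)) {x : Fin n → ℂ} (hx : x ∈ D) :
    Antitone fun K => trunc u ψ K x :=
  antitone_nat_of_succ_le fun K => by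
    have := (hψ K).nonpos x hx
    simp only [trunc, Finset.sum_range_succ]
    exact max_le_max_right _ (by linarith)

lemma trunc_le_one (hu : PB u D) (hψ : ∀ k, NegPSH D (ψ k)) (K : ℕ) {x : Fin n → ℂ} (hx : x ∈ D) :
    trunc u ψ K x ≤ 1 := by
  refine (trunc_anti hψ hx (Nat.zero_le K)).trans ?_
  simpa [trunc] using hu.le_one x hx

lemma trunc_usc (hu : PB u D) (hψ : ∀ k, NegPSH D (ψ k)) (K : ℕ) :
    UpperSemicontinuousOn (trunc u ψ K) D :=
  (hu.usc.add ((NegPSH.sum hψ K).usc.upperSemicontinuousOn D)).sup upperSemicontinuousOn_const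

lemma tendsto_trunc (hψ : ∀ k, NegPSH D (ψ k)) {x : Fin n → ℂ} (hx : x ∈ D) :
    Tendsto (fun K => trunc u ψ K x) atTop (𝓝 (truncInf u ψ x)) :=
  tendsto_atTop_ciInf (trunc_anti hψ hx) ⟨0, by rintro _ ⟨K, rfl⟩; exact trunc_nonneg K x⟩

lemma PB.truncInf (hD : IsOpen D) (hu : PB u D) (hψ : ∀ k, NegPSH D (ψ k)) :
    PB (truncInf u ψ) D := by
  refine ⟨fun x hx y hy => ?_, fun x _ => truncInf_nonneg x,
    fun x hx => (truncInf_le 0 x).trans (trunc_le_one hu hψ 0 hx), fun z hz w => ?_⟩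
  · obtain ⟨K, hK⟩ := exists_lt_of_ciInf_lt hy
    filter_upwards [trunc_usc hu hψ K x hx y hK] with a ha using (truncInf_le K a).trans_lt ha
  · filter_upwards [hu.sub z hz w, eventually_circle_mem hD hz w] with s hs hmem
    have hi : ∀ K, CircleIntegrable (fun ζ : ℂ => trunc u ψ K (z + ζ • (s : ℂ) • w)) 0 1 :=
      fun K => circleIntegrable_slice_on (trunc_usc hu hψ K) (fun x _ => trunc_nonneg K x)
        (fun x hx => trunc_le_one hu hψ K hx) hmem
    have hle : ∀ K, RelExt.truncInf u ψ z ≤ cmean (trunc u ψ K) z ((s : ℂ) • w) := fun K => by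
      refine (truncInf_le K z).trans (max_le ?_ ?_)
      · have hsum := NegPSH.sum hψ K
        obtain ⟨m, hm⟩ := hsum.lb
        have hi1 := hu.circleIntegrable hmem
        have hi2 := circleIntegrable_slice hsum.usc hm z ((s : ℂ) • w)
        refine (add_le_add hs (hsum.sub z ((s : ℂ) • w))).trans ?_
        rw [← cmean_add hi1 hi2]
        exact circleAverage_le_of_forall (hi1.add hi2) (hi K) fun ζ => le_max_left _ _
      · exact Real.circleAverage_nonneg_of_nonneg fun x _ => trunc_nonneg K _
    refine ge_of_tendsto' (x := atTop) (f := fun K => cmean (trunc u ψ K) z ((s : ℂ) • w)) ?_ hle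
    simp only [cmean, Real.circleAverage_def]
    refine Tendsto.const_smul ?_ _
    have hmem' : ∀ θ : ℝ, z + circleMap 0 1 θ • (s : ℂ) • w ∈ D := fun θ => hmem _ (by simp)
    refine intervalIntegral.tendsto_integral_filter_of_dominated_convergence (fun _ => 1)
      (.of_forall fun K => ?_) (.of_forall fun K => .of_forall fun θ _ => ?_)
      intervalIntegrable_const (.of_forall fun θ _ => tendsto_trunc hψ (hmem' θ))
    · have := (hi K).aestronglyMeasurable
      rwa [uIoc_of_le Real.two_pi_pos.le]
    · rw [Real.norm_of_nonneg (trunc_nonneg _ _)]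
      exact trunc_le_one hu hψ K (hmem' θ)

lemma ofReal_sub_le_tsum {x : Fin n → ℂ} {t : ℝ} (h : RelExt.truncInf u ψ x ≤ t) :
    ENNReal.ofReal (u x - t) ≤ ∑' k, ENNReal.ofReal (-ψ k x) := by
  by_cases hB : ∑' k, ENNReal.ofReal (-ψ k x) = ⊤
  · rw [hB]; exact le_top
  rw [ENNReal.ofReal_le_iff_le_toReal hB]
  have h1 : u x - (∑' k, ENNReal.ofReal (-ψ k x)).toReal ≤ RelExt.truncInf u ψ x := by
    refine le_ciInf fun K => le_max_of_le_left ?_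
    have h2 : ENNReal.ofReal (∑ k ∈ Finset.range K, -ψ k x) ≤ ∑' k, ENNReal.ofReal (-ψ k x) := by
      refine le_trans ?_ (ENNReal.sum_le_tsum (Finset.range K))
      induction K with
      | zero => simp
      | succ K ih =>
        rw [Finset.sum_range_succ, Finset.sum_range_succ]
        exact ENNReal.ofReal_add_le.trans (add_le_add_left ih _)
    rw [ENNReal.ofReal_le_iff_le_toReal hB, Finset.sum_neg_distrib] at h2
    linarith
  linarith

end PBinf

/-- The part of `A` near `b` where the relative extremal function exceeds `s`. -/
def thinPart (A : Set (Fin n → ℂ)) (b : Fin n → ℂ) (r s : ℝ) : Set (Fin n → ℂ) :=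
  {a ∈ A | nsq (a - b) < r / 32 ∧
    s < omegaC (A ∩ {x | nsq (x - b) < r}) {x | nsq (x - b) < r} a}

lemma exists_mem_thinPart {D A : Set (Fin n → ℂ)} (hD : IsOpen D) (hAD : A ⊆ D)
    {a : Fin n → ℂ} (ha : a ∈ A) (hs : a ∉ starSet A D) :
    ∃ i j l : ℕ, a ∈ thinPart A (TopologicalSpace.denseSeq _ i) (sepRad n / (j + 1)) (1 / (l + 1)) := by
  have h1 : ¬ PlrgAt A D a := fun h => hs ⟨⟨subset_closure ha, hAD ha⟩, h⟩
  unfold PlrgAt at h1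
  push Not at h1
  obtain ⟨U, hU, haU, hne⟩ := h1
  have haDU : a ∈ D ∩ U := ⟨hAD ha, haU⟩
  have hpos : 0 < omegaC (A ∩ U) (D ∩ U) a :=
    lt_of_le_of_ne (omegaC_nonneg (hD.inter hU) (inter_subset_inter_left _ hAD) haDU) hne.symm
  obtain ⟨r₀, hr₀, hsub⟩ := exists_nsq_ball_subset (hD.inter hU) haDU
  obtain ⟨j, hj⟩ := exists_nat_gt (4 * sepRad n / r₀)
  have hsep := sepRad_pos (n := n)
  set r : ℝ := sepRad n / (j + 1) with hr
  have hr0 : 0 < r := by positivity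
  have hrr : 4 * r ≤ r₀ := by
    rw [div_lt_iff₀ hr₀] at hj
    rw [hr, ← mul_div_assoc, div_le_iff₀ (by positivity)]
    nlinarith
  obtain ⟨l, hl⟩ := exists_nat_one_div_lt hpos
  have hcont : Continuous fun b : Fin n → ℂ => nsq (a - b) := continuous_nsq.comp (by fun_prop)
  obtain ⟨i, hi⟩ := (TopologicalSpace.denseRange_denseSeq (Fin n → ℂ)).exists_mem_open
    (isOpen_lt hcont continuous_const : IsOpen {b : Fin n → ℂ | nsq (a - b) < r / 32})
    ⟨a, by rw [mem_ofPred_eq, sub_self, nsq_zero]; positivity⟩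
  set b := TopologicalSpace.denseSeq (Fin n → ℂ) i with hb
  replace hi : nsq (a - b) < r / 32 := hi
  refine ⟨i, j, l, ha, hi, hl.trans_le ?_⟩
  have hE : {x | nsq (x - b) < r} ⊆ D ∩ U := fun x hx => by
    refine hsub x ?_
    have h2 := nsq_add_le (x - b) (-(a - b))
    rw [nsq_neg, show x - b + -(a - b) = x - a by abel] at h2
    have h3 : nsq (x - b) < r := hx
    linarith
  refine omegaC_mono (hD.inter hU) (isOpen_nsq_lt b r) (inter_subset_inter_left _ hAD)
    inter_subset_right hE (fun x hx => ⟨hx.1, (hE hx.2).2⟩) ?_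
  simp only [mem_ofPred_eq]
  linarith

/-- The thin part of `A` is negligible for plurisubharmonic functions on `D`. -/
lemma exists_NegPSH_seq {D A : Set (Fin n → ℂ)} (hD : IsOpen D) (hDb : Bornology.IsBounded D)
    (hAD : A ⊆ D) {η : ENNReal} (hη : η ≠ 0) :
    ∃ ψ : ℕ → (Fin n → ℂ) → ℝ, (∀ k, NegPSH D (ψ k)) ∧
      (∀ a ∈ A, a ∉ starSet A D → ∃ k, ψ k a ≤ -1) ∧
      ∑' k, ∫⁻ x in D, ENNReal.ofReal (-ψ k x) ≤ η := by
  obtain ⟨e, he⟩ := exists_surjective_nat (ℕ × ℕ × ℕ)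
  obtain ⟨η', hη', hsum⟩ := ENNReal.exists_pos_sum_of_countable hη ℕ
  have hsep := sepRad_pos (n := n)
  have H : ∀ k, ∃ ψ, NegPSH D ψ ∧ (∀ z ∈ thinPart A (TopologicalSpace.denseSeq _ (e k).1)
      (sepRad n / ((e k).2.1 + 1)) (1 / ((e k).2.2 + 1)) ∩ D, ψ z ≤ -1) ∧
      ∫⁻ x in D, ENNReal.ofReal (-ψ x) ≤ ENNReal.ofReal (η' k) := fun k => by
    refine exists_NegPSH_of_QP hDb (fun c hc => ?_) (hη' k)
    refine exists_QP_small_of_omegaC _ (div_pos hsep (by positivity))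
      (div_le_self hsep.le (by simp)) (s := 1 / ((e k).2.2 + 1)) (by positivity)
      ((div_le_one (by positivity)).2 (by simp)) (fun a ha => ha.1) (fun a ha => ha.2.1)
      (fun a ha => ha.2.2) hc one_pos
  choose ψ hψ hψN hψI using H
  refine ⟨ψ, hψ, fun a ha hs => ?_, (ENNReal.tsum_le_tsum fun k => hψI k).trans ?_⟩
  · obtain ⟨i, j, l, hm⟩ := exists_mem_thinPart hD hAD ha hs
    obtain ⟨k, hk⟩ := he (i, j, l)
    refine ⟨k, hψN k a ⟨?_, hAD ha⟩⟩
    rw [hk]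
    exact hm
  · simpa only [ENNReal.ofReal_coe_nnreal] using hsum.le

lemma starSet_subset (D A : Set (Fin n → ℂ)) : starSet A D ⊆ D := fun _ ha => ha.1.2

lemma eventually_hFun_le {D B : Set (Fin n → ℂ)} (hD : IsOpen D) (hB : B ⊆ D) {z : Fin n → ℂ}
    (hz : z ∈ D) {t : ℝ} (ht : omegaC B D z < t) : ∀ᶠ x in 𝓝 z, hFun B D x ≤ t := by
  by_contra h
  exact not_le_of_gt ht (le_omegaC_of_frequently hD hB hz
    ((not_eventually.1 h).mono fun x hx => (not_le.1 hx).le))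

lemma omegaC_le_omegaC_starSet {D A : Set (Fin n → ℂ)} (hD : IsOpen D) (hAD : A ⊆ D)
    {z : Fin n → ℂ} (hz : z ∈ D) : omegaC A D z ≤ omegaC (starSet A D) D z := by
  have h1 : ∀ x ∈ D, hFun A D x ≤ hFun (starSet A D) D x := fun x hx => by
    refine le_of_forall_lt fun s hs => ?_
    obtain ⟨u, hu, hu0, hlt⟩ := exists_PB_of_lt_hFun hD hAD hs
    refine hlt.trans_le (le_hFun (starSet_subset D A) hu (fun a ha => ?_) hx)
    have h2 := ha.2 univ isOpen_univ (mem_univ a)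
    rw [inter_univ, inter_univ] at h2
    have h3 := (le_hFun hAD hu hu0 ha.1.2).trans (hFun_le_omegaC hD hAD ha.1.2)
    exact le_antisymm (h3.trans h2.le) (hu.nonneg a ha.1.2)
  refine le_of_forall_gt_imp_ge_of_dense fun t ht => omegaC_le_of_eventually hD hAD hz ?_
  filter_upwards [eventually_hFun_le hD (starSet_subset D A) hz ht, hD.mem_nhds hz] with x hx hxD
  exact (h1 x hxD).trans hx

lemma PB.le_of_eventually_hFun_le {D A : Set (Fin n → ℂ)} (hD : IsOpen D)
    (hDb : Bornology.IsBounded D) (hAD : A ⊆ D) {u : (Fin n → ℂ) → ℝ} (hu : PB u D)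
    (hu0 : ∀ a ∈ starSet A D, u a = 0) {U : Set (Fin n → ℂ)} (hU : IsOpen U) (hUD : U ⊆ D) {t : ℝ}
    (h : ∀ x ∈ U, hFun A D x ≤ t) {z : Fin n → ℂ} (hz : z ∈ U) : u z ≤ t := by
  refine hu.le_of_ae hU hUD ?_ hz
  have hm : AEMeasurable (fun x => ENNReal.ofReal (u x - t)) (volume.restrict U) := by
    refine aemeasurable_restrict_of_measurable_subtype hU.measurableSet ?_
    have : Measurable fun x : U => u x :=
      (upperSemicontinuousOn_iff_restrict.2 (hu.usc.mono hUD)).measurable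
    exact (this.sub_const t).ennreal_ofReal
  have key : ∫⁻ x in U, ENNReal.ofReal (u x - t) = 0 := by
    refine nonpos_iff_eq_zero.1 (le_of_forall_pos_le_add fun η hη => ?_)
    rw [zero_add]
    obtain ⟨ψ, hψ, hψA, hsum⟩ := exists_NegPSH_seq hD hDb hAD hη.ne'
    have hF := hu.truncInf hD hψ
    have hF0 : ∀ a ∈ A, RelExt.truncInf u ψ a = 0 := fun a ha => by
      refine le_antisymm ?_ (RelExt.truncInf_nonneg a)
      by_cases hs : a ∈ starSet A D
      · exact (RelExt.truncInf_le (u := u) (ψ := ψ) 0 a).trans (by simp [trunc, hu0 a hs])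
      · obtain ⟨k, hk⟩ := hψA a ha hs
        refine (RelExt.truncInf_le (k + 1) a).trans (max_le ?_ le_rfl)
        have h1 := (NegPSH.sum hψ k).nonpos a (hAD ha)
        have h2 := hu.le_one a (hAD ha)
        rw [Finset.sum_range_succ]
        linarith
    calc ∫⁻ x in U, ENNReal.ofReal (u x - t)
        ≤ ∫⁻ x in U, ∑' k, ENNReal.ofReal (-ψ k x) :=
          setLIntegral_mono' hU.measurableSet fun x hx =>
            ofReal_sub_le_tsum ((le_hFun hAD hF hF0 (hUD hx)).trans (h x hx))
      _ ≤ ∫⁻ x in D, ∑' k, ENNReal.ofReal (-ψ k x) := lintegral_mono_set hUD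
      _ = ∑' k, ∫⁻ x in D, ENNReal.ofReal (-ψ k x) :=
          lintegral_tsum fun k => (hψ k).usc.measurable.neg.ennreal_ofReal.aemeasurable
      _ ≤ η := hsum
  rw [lintegral_eq_zero_iff' hm, EventuallyEq, ae_restrict_iff' hU.measurableSet] at key
  filter_upwards [key] with x hx hxU
  have := ENNReal.ofReal_eq_zero.1 (hx hxU)
  linarith

lemma omegaC_starSet_le_omegaC {D A : Set (Fin n → ℂ)} (hD : IsOpen D)
    (hDb : Bornology.IsBounded D) (hAD : A ⊆ D) {z : Fin n → ℂ} (hz : z ∈ D) :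
    omegaC (starSet A D) D z ≤ omegaC A D z := by
  refine le_of_forall_gt_imp_ge_of_dense fun t ht => ?_
  have h1 := eventually_hFun_le hD hAD hz ht
  refine omegaC_le_of_eventually hD (starSet_subset D A) hz ?_
  obtain ⟨U, hUs, hUo, hzU⟩ := _root_.mem_nhds_iff.1 (h1.and (hD.mem_nhds hz))
  filter_upwards [hUo.mem_nhds hzU] with x hx
  refine le_of_forall_lt fun s hs => ?_
  obtain ⟨u, hu, hu0, hlt⟩ := exists_PB_of_lt_hFun hD (starSet_subset D A) hs
  exact hlt.trans_le (hu.le_of_eventually_hFun_le hD hDb hAD hu0 hUo (fun y hy => (hUs hy).2)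
    (fun y hy => (hUs hy).1) hx)

end RelExt

/-- for a bounded open `D ⊆ ℂⁿ` and any `A ⊆ D`, the relative
extremal functions of `A` and of `A*` coincide on `D`. -/
theorem omega_eq_omega_star
    {n : ℕ} (D A : Set (Fin n → ℂ)) (hD : IsOpen D) (hDb : Bornology.IsBounded D)
    (hAD : A ⊆ D) :
    ∀ z ∈ D, omegaC A D z = omegaC (starSet A D) D z := by
  intro z hz
  exact le_antisymm (RelExt.omegaC_le_omegaC_starSet hD hAD hz)
    (RelExt.omegaC_starSet_le_omegaC hD hDb hAD hz)

end
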